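/- arXiv:1709.00858 — 5 statements merged into one kernel-verified Lean document; each statement's English description precedes it below -/
import Mathlib

section
/- Let d ≥ 1, let Σ be a finite alphabet, and let X ⊆ Σ^{ℤ^d} be a subshift of finite type with positive entropy and dense minimal points. Then Aut(X) does not satisfy the Tits alternative: it has a finitely generated subgroup which is not virtually solvable and which contains no subgroup isomorphic to the free group on two generators. -/
/-- The shift by `v ∈ ℤ^d` on the full shift `Γ^{ℤ^d}`: `σ_v(x)(u) = x(u + v)`. -/
def shiftV {d : ℕ} (Γ : Type*) (v : Fin d → ℤ) : ((Fin d → ℤ) → Γ) → ((Fin d → ℤ) → Γ) :=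
  fun x u => x (u + v)

/-- `f` is continuous and commutes (on the subset `X`) with every map in `S`. -/
def GoodPerm {A : Type*} [TopologicalSpace A] {X : Set A} (S : Set (A → A))
    (f : Equiv.Perm X) : Prop :=
  Continuous ⇑f ∧ ∀ s ∈ S, ∀ x y : X, s ↑x = ↑y → s ↑(f x) = ↑(f y)

theorem GoodPerm.mul {A : Type*} [TopologicalSpace A] {X : Set A} {S : Set (A → A)}
    {f g : Equiv.Perm X} (hf : GoodPerm S f) (hg : GoodPerm S g) : GoodPerm S (f * g) := by
  refine ⟨by simpa [Equiv.Perm.coe_mul] using hf.1.comp hg.1, fun s hs x y hxy => ?_⟩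
  simp only [Equiv.Perm.mul_apply]
  exact hf.2 s hs _ _ (hg.2 s hs x y hxy)

theorem GoodPerm.one {A : Type*} [TopologicalSpace A] {X : Set A} {S : Set (A → A)} :
    GoodPerm (X := X) S 1 :=
  ⟨by simpa [Equiv.Perm.coe_one] using continuous_id, fun _ _ _ _ h => h⟩

/-- The automorphism group of `X`: homeomorphisms of `X` commuting with (the restriction to
`X` of) every map in `S`. -/
def SubAut {A : Type*} [TopologicalSpace A] (X : Set A) (S : Set (A → A)) :
    Subgroup (Equiv.Perm X) where
  carrier := {f | GoodPerm S f ∧ GoodPerm S f⁻¹}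
  one_mem' := ⟨GoodPerm.one, by rw [inv_one]; exact GoodPerm.one⟩
  mul_mem' := fun hf hg => ⟨hf.1.mul hg.1, by rw [mul_inv_rev]; exact hg.2.mul hf.2⟩
  inv_mem' := fun hf => ⟨hf.2, by rw [inv_inv]; exact hf.1⟩

/-- `X ⊆ Γ^{ℤ^d}` is a subshift of finite type: it is defined by a set `Q` of allowed
patterns on a finite shape `F ⊆ ℤ^d`. -/
def IsSFT {d : ℕ} {Γ : Type*} (X : Set ((Fin d → ℤ) → Γ)) : Prop :=
  ∃ (F : Finset (Fin d → ℤ)) (Q : Set (F → Γ)),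
    X = {x | ∀ v : Fin d → ℤ, (fun t : F => x (v + (t : Fin d → ℤ))) ∈ Q}

/-- The set of patterns on the box `{0, …, n-1}^d` arising as restrictions of points of `X`. -/
def boxPatterns {d : ℕ} {Γ : Type*} (X : Set ((Fin d → ℤ) → Γ)) (n : ℕ) :
    Set ((Fin d → Fin n) → Γ) :=
  {p | ∃ x ∈ X, ∀ u : Fin d → Fin n, p u = x fun i => ((u i : ℕ) : ℤ)}

/-- `X` has positive entropy. -/
def PosEntropy {d : ℕ} {Γ : Type*} (X : Set ((Fin d → ℤ) → Γ)) : Prop :=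
  ∃ c : ℝ, 0 < c ∧ ∀ n : ℕ, 1 ≤ n →
    Real.exp (c * (n : ℝ) ^ d) ≤ ((boxPatterns X n).ncard : ℝ)

/-- A point is minimal if its orbit closure contains no nonempty proper closed
shift-invariant subset. -/
def IsMinimalPt {d : ℕ} {Γ : Type*} [TopologicalSpace Γ] (x : (Fin d → ℤ) → Γ) : Prop :=
  ∀ C : Set ((Fin d → ℤ) → Γ),
    C ⊆ closure {y | ∃ v, y = shiftV Γ v x} → IsClosed C →
      (∀ v, shiftV Γ v '' C = C) → C.Nonempty → C = closure {y | ∃ v, y = shiftV Γ v x}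

section GroupPart

variable {G X V : Type*} [Group G] [MulAction (V → G) X]

/-- Functions `X → (V → G)` which are invariant under the action of `V → G`. -/
def InvFun (G X V : Type*) [Group G] [MulAction (V → G) X] : Subgroup (X → V → G) where
  carrier := {φ | ∀ (γ : V → G) (x : X), φ (γ • x) = φ x}
  one_mem' := fun _ _ => rfl
  mul_mem' := fun ha hb γ x => by simp only [Pi.mul_apply]; rw [ha, hb]
  inv_mem' := fun ha γ x => by simp only [Pi.inv_apply]; rw [ha]

/-- The permutation of `X` induced by an invariant function. -/
def invPerm : InvFun G X V →* Equiv.Perm X where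
  toFun φ :=
    { toFun := fun x => φ.1 x • x
      invFun := fun x => (φ.1 x)⁻¹ • x
      left_inv := fun x => by
        have := φ.2 (φ.1 x) x
        simp only [this, inv_smul_smul]
      right_inv := fun x => by
        have := φ.2 (φ.1 x)⁻¹ x
        simp only [this, smul_inv_smul] }
  map_one' := by ext x; simp
  map_mul' := fun a b => by
    ext x
    simp only [Equiv.coe_fn_mk, Equiv.Perm.mul_apply, Subgroup.coe_mul, Pi.mul_apply]
    rw [a.2, mul_smul]

theorem invPerm_apply (φ : InvFun G X V) (x : X) : invPerm φ x = φ.1 x • x := rfl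

/-- Conjugating an invariant function by a permutation commuting with the action. -/
def invConj (t : Equiv.Perm X) (ht : ∀ (γ : V → G) (x : X), t (γ • x) = γ • t x)
    (φ : InvFun G X V) : InvFun G X V :=
  ⟨fun x => φ.1 (t x), fun γ x => by simp only [ht]; exact φ.2 _ _⟩

theorem invPerm_conj (t : Equiv.Perm X) (ht : ∀ (γ : V → G) (x : X), t (γ • x) = γ • t x)
    (φ : InvFun G X V) : invPerm (invConj t ht φ) = t⁻¹ * invPerm φ * t := by
  ext x
  apply t.injective
  have h1 : ∀ y, t (t⁻¹ y) = y := fun y => t.apply_symm_apply y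
  simp only [Equiv.Perm.mul_apply, h1, invPerm_apply, ht]
  rfl

theorem commutes_inv (t : Equiv.Perm X) (ht : ∀ (γ : V → G) (x : X), t (γ • x) = γ • t x) :
    ∀ (γ : V → G) (x : X), t⁻¹ (γ • x) = γ • t⁻¹ x := fun γ x => by
  apply t.injective
  simp [ht]

theorem commutes_pow (t : Equiv.Perm X) (ht : ∀ (γ : V → G) (x : X), t (γ • x) = γ • t x)
    (n : ℕ) : ∀ (γ : V → G) (x : X), (t ^ n) (γ • x) = γ • (t ^ n) x := by
  induction n with
  | zero => simp
  | succ n ih => intro γ x; rw [pow_succ, Equiv.Perm.mul_apply, ht, ih]; rfl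

theorem commutes_zpow (t : Equiv.Perm X) (ht : ∀ (γ : V → G) (x : X), t (γ • x) = γ • t x)
    (n : ℤ) : ∀ (γ : V → G) (x : X), (t ^ n) (γ • x) = γ • (t ^ n) x := by
  cases n with
  | ofNat n => simpa using commutes_pow t ht n
  | negSucc n =>
    rw [zpow_negSucc]
    exact commutes_inv _ (commutes_pow t ht _)

theorem conj_mem_range (t : Equiv.Perm X) (ht : ∀ (γ : V → G) (x : X), t (γ • x) = γ • t x)
    (n : ℤ) (e : Equiv.Perm X) (he : e ∈ (invPerm (G := G) (X := X) (V := V)).range) :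
    t ^ n * e * (t ^ n)⁻¹ ∈ (invPerm (G := G) (X := X) (V := V)).range := by
  obtain ⟨φ, rfl⟩ := he
  refine ⟨invConj ((t ^ n)⁻¹) (commutes_inv _ (commutes_zpow t ht n)) φ, ?_⟩
  rw [invPerm_conj, inv_inv]

/-- Cyclic-by-`range invPerm` decomposition. -/
theorem closure_decomp (t : Equiv.Perm X) (ht : ∀ (γ : V → G) (x : X), t (γ • x) = γ • t x)
    (S : Set (Equiv.Perm X))
    (hS : ∀ s ∈ S, s = t ∨ s ∈ (invPerm (G := G) (X := X) (V := V)).range)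
    (h : Equiv.Perm X) (hh : h ∈ Subgroup.closure S) :
    ∃ e ∈ (invPerm (G := G) (X := X) (V := V)).range, ∃ k : ℤ, h = e * t ^ k := by
  induction hh using Subgroup.closure_induction with
  | mem s hs =>
    rcases hS s hs with rfl | h
    · exact ⟨1, one_mem _, 1, by simp⟩
    · exact ⟨s, h, 0, by simp⟩
  | one => exact ⟨1, one_mem _, 0, by simp⟩
  | mul a b _ _ iha ihb =>
    obtain ⟨e, he, k, rfl⟩ := iha
    obtain ⟨f, hf, l, rfl⟩ := ihb
    refine ⟨e * (t ^ k * f * (t ^ k)⁻¹), mul_mem he (conj_mem_range t ht k f hf), k + l, ?_⟩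
    rw [zpow_add]; group
  | inv a _ iha =>
    obtain ⟨e, he, k, rfl⟩ := iha
    refine ⟨t ^ (-k) * e⁻¹ * (t ^ (-k))⁻¹, conj_mem_range t ht _ _ (inv_mem he), -k, ?_⟩
    group

theorem commutator_mem_range (t : Equiv.Perm X)
    (ht : ∀ (γ : V → G) (x : X), t (γ • x) = γ • t x)
    (S : Set (Equiv.Perm X))
    (hS : ∀ s ∈ S, s = t ∨ s ∈ (invPerm (G := G) (X := X) (V := V)).range)
    (a b : Equiv.Perm X) (ha : a ∈ Subgroup.closure S) (hb : b ∈ Subgroup.closure S) :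
    a * b * a⁻¹ * b⁻¹ ∈ (invPerm (G := G) (X := X) (V := V)).range := by
  obtain ⟨e, he, k, rfl⟩ := closure_decomp t ht S hS a ha
  obtain ⟨f, hf, l, rfl⟩ := closure_decomp t ht S hS b hb
  have : e * t ^ k * (f * t ^ l) * (e * t ^ k)⁻¹ * (f * t ^ l)⁻¹ =
      e * (t ^ k * f * (t ^ k)⁻¹) * (t ^ l * e⁻¹ * (t ^ l)⁻¹) * f⁻¹ := by
    have h1 : t ^ k * t ^ l = t ^ l * t ^ k := (Commute.refl t).zpow_zpow k l
    have h2 : (t ^ k)⁻¹ = t ^ (-k) := by rw [zpow_neg]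
    group
  rw [this]
  exact mul_mem (mul_mem (mul_mem he (conj_mem_range t ht k f hf))
    (conj_mem_range t ht l _ (inv_mem he))) (inv_mem hf)

theorem range_pow_eq_one [Finite G] (e : Equiv.Perm X)
    (he : e ∈ (invPerm (G := G) (X := X) (V := V)).range) : e ^ Nat.card G = 1 := by
  obtain ⟨φ, rfl⟩ := he
  rw [← map_pow]
  have : φ ^ Nat.card G = 1 := by
    apply Subtype.ext
    ext x v
    simp [pow_card_eq_one']
  rw [this, map_one]

theorem freeGroup_comm_ne : (FreeGroup.of (0 : Fin 2)) * FreeGroup.of 1 * (FreeGroup.of 0)⁻¹ *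
    (FreeGroup.of 1)⁻¹ ≠ 1 := by
  decide

open Classical in
/-- Indicator function with value `g` on the event `β`. -/
noncomputable def evFun (β : X → V → Prop) (hβ : ∀ (γ : V → G) (x : X), β (γ • x) = β x) :
    G →* InvFun G X V where
  toFun g := ⟨fun x v => if β x v then g else 1, fun γ x => by simp only [hβ]⟩
  map_one' := by apply Subtype.ext; ext x v; simp
  map_mul' := fun a b => by apply Subtype.ext; ext x v; simp; split_ifs <;> simp

theorem groupPart [Finite G] [IsSimpleGroup G] (hG : ¬ Group.IsSolvable G)
    {A : Type*} [Group A] (ι : A →* Equiv.Perm X) (hι : Function.Injective ι)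
    (τ : A) (hτ : ∀ (γ : V → G) (x : X), ι τ (γ • x) = γ • ι τ x)
    (β : X → V → Prop) (hβ : ∀ (γ : V → G) (x : X), β (γ • x) = β x)
    (f : G → A) (hf : ∀ g, ι (f g) = invPerm (evFun β hβ g))
    (hfree : ∀ i j : ℕ, i ≠ j → ∃ x v, β ((ι τ ^ i) x) v ∧ ¬ β ((ι τ ^ j) x) v ∧
      ∀ γ : V → G, γ • x = x → γ v = 1) :
    ∃ H : Subgroup A, H.FG ∧
      (¬∃ K : Subgroup H, K.FiniteIndex ∧ Group.IsSolvable K) ∧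
      ¬∃ K : Subgroup H, Nonempty (K ≃* FreeGroup (Fin 2)) := by
  classical
  set S : Set A := insert τ (Set.range f) with hSdef
  have hτS : τ ∈ Subgroup.closure S := Subgroup.subset_closure (by simp [hSdef])
  have hfS : ∀ g, f g ∈ Subgroup.closure S :=
    fun g => Subgroup.subset_closure (by simp [hSdef])
  let H := Subgroup.closure S
  refine ⟨H, ?_, ?_, ?_⟩
  · rw [Subgroup.fg_iff]
    exact ⟨S, rfl, (Set.finite_range f).insert τ⟩
  · rintro ⟨K₀, hK₀, hsol⟩
    let K := K₀.normalCore
    have hKfin : K.FiniteIndex := Subgroup.finiteIndex_normalCore (H := K₀)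
    have hKn : K.Normal := inferInstance
    have hsol' : Group.IsSolvable K₀ := hsol
    have hKsol : Group.IsSolvable K :=
      Group.isSolvable_of_isSolvable_injective (Subgroup.inclusion_injective K₀.normalCore_le)
    -- the elements of `H` and their permutations
    let π : H →* Equiv.Perm X := ι.comp H.subtype
    have hπ : Function.Injective π := hι.comp H.subtype_injective
    let T : H := ⟨τ, hτS⟩
    let e : ℕ → G → H := fun i g => (T ^ i)⁻¹ * ⟨f g, hfS g⟩ * T ^ i
    have hβi : ∀ i : ℕ, ∀ (γ : V → G) (x : X),
        β ((ι τ ^ i) (γ • x)) = β ((ι τ ^ i) x) := fun i γ x => by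
      rw [commutes_pow _ hτ, hβ]
    have he : ∀ i g, π (e i g) = invPerm (evFun (fun x => β ((ι τ ^ i) x)) (hβi i) g) := by
      intro i g
      have : evFun (fun x => β ((ι τ ^ i) x)) (hβi i) g =
        invConj (ι τ ^ i) (commutes_pow _ hτ i) (evFun β hβ g) := rfl
      rw [this, invPerm_conj, ← hf]
      simp [e, π, T]
    -- noncommuting pair
    have hnc : ∃ g h : G, g * h * g⁻¹ * h⁻¹ ≠ 1 := by
      by_contra! hcon
      exact hG (Group.isSolvable_of_comm fun a b => by
        have := hcon a b
        rw [mul_inv_eq_one, mul_inv_eq_iff_eq_mul] at this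
        exact this)
    obtain ⟨g, h, hgh⟩ := hnc
    have : Finite (H ⧸ K) := Subgroup.finite_quotient_of_finiteIndex
    obtain ⟨i, j, hij, heq⟩ := Finite.exists_ne_map_eq_of_infinite
      (fun i : ℕ => (QuotientGroup.mk (e i g)⁻¹ : H ⧸ K))
    have hmem : e i g * (e j g)⁻¹ ∈ K := by
      have := QuotientGroup.eq.1 heq
      simpa using this
    have hβW : ∀ (γ : V → G) (x : X),
      (fun v => β ((ι τ ^ i) (γ • x)) v ∧ ¬ β ((ι τ ^ j) (γ • x)) v) =
      (fun v => β ((ι τ ^ i) x) v ∧ ¬ β ((ι τ ^ j) x) v) := fun γ x => by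
      rw [hβi, hβi]
    let ω : G →* InvFun G X V :=
      evFun (fun x v => β ((ι τ ^ i) x) v ∧ ¬ β ((ι τ ^ j) x) v) hβW
    have hωinj : ∀ k, invPerm (ω k) = 1 → k = 1 := by
      intro k hk
      obtain ⟨x, v, h1, h2, h3⟩ := hfree i j hij
      have h4 : (ω k).1 x • x = x := by
        rw [← invPerm_apply, hk]; rfl
      have := h3 _ h4
      simpa [ω, evFun, h1, h2] using this
    let M : Subgroup G := (K.map π).comap (invPerm.comp ω)
    have hMn : M.Normal := by
      refine ⟨fun k hk h => ?_⟩
      obtain ⟨y, hy, hyk⟩ := hk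
      refine ⟨e i h * y * (e i h)⁻¹, hKn.conj_mem _ hy _, ?_⟩
      rw [map_mul, map_mul, map_inv, hyk, he]
      simp only [MonoidHom.comp_apply]
      rw [← map_inv, ← map_mul, ← map_mul]
      congr 1
      apply Subtype.ext
      ext x v
      simp only [ω, evFun, MonoidHom.coe_mk, OneHom.coe_mk, Subgroup.coe_mul, Subgroup.coe_inv,
        Pi.mul_apply, Pi.inv_apply]
      by_cases h1 : β ((ι τ ^ i) x) v <;> by_cases h2 : β ((ι τ ^ j) x) v <;> simp [h1, h2]
    have hMg : g * h * g⁻¹ * h⁻¹ ∈ M := by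
      refine ⟨(e i g * (e j g)⁻¹) * (e i h * (e i g * (e j g)⁻¹)⁻¹ * (e i h)⁻¹),
        mul_mem hmem (hKn.conj_mem _ (inv_mem hmem) _), ?_⟩
      simp only [map_mul, map_inv, he]
      simp only [MonoidHom.comp_apply]
      simp only [← map_inv, ← map_mul]
      congr 1
      apply Subtype.ext
      ext x v
      simp only [ω, evFun, MonoidHom.coe_mk, OneHom.coe_mk, Subgroup.coe_mul, Subgroup.coe_inv,
        Pi.mul_apply, Pi.inv_apply]
      by_cases h1 : β ((ι τ ^ i) x) v <;> by_cases h2 : β ((ι τ ^ j) x) v <;>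
        simp [h1, h2, mul_assoc]
    have hMtop : M = ⊤ := by
      rcases hMn.eq_bot_or_eq_top with h0 | h0
      · rw [h0, Subgroup.mem_bot] at hMg
        exact absurd hMg hgh
      · exact h0
    apply hG
    have hsol2 : Group.IsSolvable (K.map π) :=
      Group.isSolvable_of_surjective (π.subgroupMap_surjective K)
    let q : G →* K.map π := (invPerm.comp ω).codRestrict (K.map π) (fun k => by
      have : k ∈ M := by rw [hMtop]; trivial
      exact this)
    refine Group.isSolvable_of_isSolvable_injective (f := q) ?_
    rw [injective_iff_map_eq_one]
    intro k hk
    apply hωinj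
    have := congrArg Subtype.val hk
    exact this
  · rintro ⟨K, ⟨θ⟩⟩
    let a := θ.symm (FreeGroup.of 0)
    let b := θ.symm (FreeGroup.of 1)
    let π : K →* Equiv.Perm X := (ι.comp (Subgroup.closure S).subtype).comp K.subtype
    have hπ : Function.Injective π :=
      (hι.comp (Subgroup.closure S).subtype_injective).comp K.subtype_injective
    have hmap : ∀ y : K, π y ∈ Subgroup.closure (ι '' S) := by
      intro y
      rw [← MonoidHom.map_closure]
      exact ⟨_, y.1.2, rfl⟩
    have h1 := commutator_mem_range (ι τ) hτ (ι '' S) (by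
      rintro _ ⟨s, hs, rfl⟩
      rcases hs with rfl | ⟨g, rfl⟩
      · exact Or.inl rfl
      · exact Or.inr ⟨_, (hf g).symm⟩) (π a) (π b) (hmap a) (hmap b)
    have h2 := range_pow_eq_one _ h1
    have h3 : (a * b * a⁻¹ * b⁻¹) ^ Nat.card G = 1 := hπ (by
      rw [map_one, ← h2]; simp only [map_pow, map_mul, map_inv])
    have h4 := congrArg θ h3
    simp only [map_pow, map_mul, map_inv, map_one, a, b, MulEquiv.apply_symm_apply] at h4
    exact freeGroup_comm_ne ((pow_eq_one_iff_left (Nat.card_pos.ne')).1 h4)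

end GroupPart
section MarkerPart

/-- Marker patterns `P a` (`a : A`) on the shape `D`, which differ only on `core`, which can be
freely exchanged within `X`, and which do not overlap each other. -/
structure Marker {V Γ : Type} [AddCommGroup V] (X : Set (V → Γ)) (A : Type) where
  P : A → V → Γ
  D : Finset V
  core : Set V
  F : Finset V
  Q : Set (F → Γ)
  hXeq : ∀ x, x ∈ X ↔ ∀ v : V, (fun t : F => x (v + (t : V))) ∈ Q
  hPX : ∀ a, P a ∈ X
  hcore : ∀ u ∈ core, u ∈ D
  hS : ∀ a b, ∀ u ∈ D, u ∉ core → P a u = P b u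
  hinj : ∀ a b, (∀ u ∈ D, P a u = P b u) → a = b
  hno : ∀ a b v, v ≠ 0 → (∃ u ∈ D, u + v ∈ core) → ∃ u ∈ D, u + v ∈ D ∧ P b (u + v) ≠ P a u
  hF : ∀ t, (∃ f ∈ F, t + f ∈ core) → ∀ f ∈ F, t + f ∈ D

namespace Marker

variable {V Γ : Type} [AddCommGroup V] {X : Set (V → Γ)} {A : Type} (m : Marker X A)

/-- The marker `P a` occurs in `x` at position `v`. -/
def SiteA (x : V → Γ) (v : V) (a : A) : Prop := ∀ u ∈ m.D, x (v + u) = m.P a u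

/-- Some marker occurs in `x` at `v`. -/
def Site (x : V → Γ) (v : V) : Prop := ∃ a, m.SiteA x v a

variable {m} in
theorem SiteA.unique {x : V → Γ} {v : V} {a b : A} (ha : m.SiteA x v a) (hb : m.SiteA x v b) :
    a = b := m.hinj a b fun u hu => by rw [← ha u hu, ← hb u hu]

variable {m} in
theorem Site.eq_of_overlap {x : V → Γ} {v v' u : V} (h : m.Site x v) (h' : m.Site x v')
    (hu : u ∈ m.D) (hc : v + u - v' ∈ m.core) : v = v' := by
  by_contra hne
  obtain ⟨a, ha⟩ := h
  obtain ⟨b, hb⟩ := h'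
  obtain ⟨w, hw, hw', hne'⟩ := m.hno a b (v - v') (sub_ne_zero.2 hne)
    ⟨u, hu, by rwa [show u + (v - v') = v + u - v' by abel]⟩
  apply hne'
  rw [← hb _ hw', ← ha _ hw]
  congr 1
  abel

variable {m} in
theorem Site.eq_of_core {x : V → Γ} {v v' u : V} (h : m.Site x v) (h' : m.Site x v')
    (hu : u - v ∈ m.core) (hc : u - v' ∈ m.core) : v = v' :=
  Site.eq_of_overlap (u := u - v) h h' (m.hcore _ hu)
    (by rwa [show v + (u - v) - v' = u - v' by abel])

open Classical in
/-- The state of `x` at the site `v`. -/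
noncomputable def st [Inhabited A] (x : V → Γ) (v : V) : A :=
  if h : m.Site x v then h.choose else default

variable {m} in
theorem SiteA.st_eq [Inhabited A] {x : V → Γ} {v : V} {a : A} (h : m.SiteA x v a) :
    m.st x v = a := by
  have h' : m.Site x v := ⟨a, h⟩
  rw [st, dif_pos h']
  exact h'.choose_spec.unique h

variable {m} in
theorem Site.siteA_st [Inhabited A] {x : V → Γ} {v : V} (h : m.Site x v) :
    m.SiteA x v (m.st x v) := by
  obtain ⟨a, ha⟩ := h
  rwa [ha.st_eq]

theorem st_of_not [Inhabited A] {x : V → Γ} {v : V} (h : ¬ m.Site x v) :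
    m.st x v = default := by
  rw [st, dif_neg h]

open Classical in
/-- Replace the states of all sites of `x` according to `s`. -/
noncomputable def put (x : V → Γ) (s : V → A) : V → Γ := fun u =>
  if h : ∃ v, m.Site x v ∧ u - v ∈ m.core then m.P (s h.choose) (u - h.choose) else x u

theorem put_core {x : V → Γ} {s : V → A} {u v : V} (h : m.Site x v) (hu : u - v ∈ m.core) :
    m.put x s u = m.P (s v) (u - v) := by
  have h' : ∃ v, m.Site x v ∧ u - v ∈ m.core := ⟨v, h, hu⟩
  rw [put, dif_pos h']
  rw [h'.choose_spec.1.eq_of_core h h'.choose_spec.2 hu]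

theorem put_not {x : V → Γ} {s : V → A} {u : V} (h : ∀ v, m.Site x v → u - v ∉ m.core) :
    m.put x s u = x u := by
  rw [put, dif_neg]
  rintro ⟨v, h1, h2⟩
  exact h v h1 h2

variable {m} in
theorem Site.put_siteA {x : V → Γ} {v : V} (h : m.Site x v) (s : V → A) :
    m.SiteA (m.put x s) v (s v) := by
  intro u hu
  by_cases hc : u ∈ m.core
  · rw [m.put_core h (by simpa using hc)]; simp
  · rw [m.put_not]
    · obtain ⟨a, ha⟩ := h
      rw [ha u hu]
      exact m.hS _ _ u hu hc
    · intro v' hv' hc'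
      have := h.eq_of_overlap hv' hu hc'
      subst this
      apply hc
      simpa using hc'

theorem site_put_iff {x : V → Γ} {v : V} (s : V → A) : m.Site (m.put x s) v ↔ m.Site x v := by
  refine ⟨fun h => ?_, fun h => ⟨_, h.put_siteA s⟩⟩
  by_contra hx
  by_cases hex : ∃ u ∈ m.D, ∃ v', m.Site x v' ∧ v + u - v' ∈ m.core
  · obtain ⟨u, hu, v', hv', hc⟩ := hex
    have := h.eq_of_overlap ⟨_, hv'.put_siteA s⟩ hu hc
    subst this
    exact hx hv'
  · push Not at hex
    obtain ⟨a, ha⟩ := h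
    apply hx
    refine ⟨a, fun u hu => ?_⟩
    rw [← ha u hu, m.put_not]
    intro v' hv'
    exact hex u hu v' hv'

theorem put_mem {x : V → Γ} (hx : x ∈ X) (s : V → A) : m.put x s ∈ X := by
  have hx' := hx
  rw [m.hXeq] at hx' ⊢
  intro v
  by_cases hex : ∃ f ∈ m.F, ∃ t, m.Site x t ∧ v + f - t ∈ m.core
  · obtain ⟨f, hf, t, ht, hc⟩ := hex
    have h1 := m.hF (v - t) ⟨f, hf, by rwa [show v - t + f = v + f - t by abel]⟩
    have h2 := m.hPX (s t)
    rw [m.hXeq] at h2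
    have h3 := h2 (v - t)
    convert h3 using 2 with f'
    rw [← ht.put_siteA s _ (h1 f' f'.2)]
    congr 1
    abel
  · push Not at hex
    convert hx' v using 2 with f
    exact m.put_not fun t ht => hex f f.2 t ht

theorem st_put [Inhabited A] {x : V → Γ} {v : V} (h : m.Site x v) (s : V → A) :
    m.st (m.put x s) v = s v := (h.put_siteA s).st_eq

theorem put_congr {x : V → Γ} {s s' : V → A} (h : ∀ v, m.Site x v → s v = s' v) :
    m.put x s = m.put x s' := by
  ext u
  by_cases hex : ∃ v, m.Site x v ∧ u - v ∈ m.core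
  · obtain ⟨v, hv, hc⟩ := hex
    rw [m.put_core hv hc, m.put_core hv hc, h v hv]
  · push Not at hex
    rw [m.put_not hex, m.put_not hex]

theorem put_put (x : V → Γ) (s s' : V → A) : m.put (m.put x s) s' = m.put x s' := by
  ext u
  by_cases hex : ∃ v, m.Site x v ∧ u - v ∈ m.core
  · obtain ⟨v, hv, hc⟩ := hex
    rw [m.put_core ((m.site_put_iff s).2 hv) hc, m.put_core hv hc]
  · push Not at hex
    rw [m.put_not hex, m.put_not, m.put_not hex]
    intro v hv
    exact hex v ((m.site_put_iff s).1 hv)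

theorem put_st [Inhabited A] (x : V → Γ) : m.put x (m.st x) = x := by
  ext u
  by_cases hex : ∃ v, m.Site x v ∧ u - v ∈ m.core
  · obtain ⟨v, hv, hc⟩ := hex
    rw [m.put_core hv hc, ← hv.siteA_st _ (m.hcore _ hc)]
    congr 1; abel
  · push Not at hex
    rw [m.put_not hex]

/-! Equivariance. -/

/-- Shift. -/
def sh (t : V) (x : V → Γ) : V → Γ := fun u => x (u + t)

theorem siteA_sh {x : V → Γ} {v t : V} {a : A} : m.SiteA (sh t x) v a ↔ m.SiteA x (v + t) a := by
  unfold SiteA sh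
  refine forall₂_congr fun u _ => ?_
  rw [show v + u + t = v + t + u by abel]

theorem site_sh {x : V → Γ} {v t : V} : m.Site (sh t x) v ↔ m.Site x (v + t) :=
  exists_congr fun _ => m.siteA_sh

theorem st_sh [Inhabited A] (x : V → Γ) (v t : V) : m.st (sh t x) v = m.st x (v + t) := by
  by_cases h : m.Site x (v + t)
  · exact (m.siteA_sh.2 h.siteA_st).st_eq
  · rw [m.st_of_not h, m.st_of_not]
    rwa [m.site_sh]

theorem put_sh (x : V → Γ) (t : V) (s : V → A) :
    m.put (sh t x) (fun v => s (v + t)) = sh t (m.put x s) := by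
  ext u
  by_cases hex : ∃ v, m.Site (sh t x) v ∧ u - v ∈ m.core
  · obtain ⟨v, hv, hc⟩ := hex
    rw [m.put_core hv hc]
    rw [m.site_sh] at hv
    unfold sh
    rw [m.put_core hv]
    · congr 1; abel
    · rwa [show u + t - (v + t) = u - v by abel]
  · push Not at hex
    rw [m.put_not hex]
    unfold sh
    rw [m.put_not]
    intro v hv
    have := hex (v - t) (by rw [m.site_sh]; simpa using hv)
    rwa [show u + t - v = u - (v - t) by abel]

/-! Locality. -/

/-- `g` depends on finitely many coordinates. -/
def LocDep {V Γ α : Type} (g : (V → Γ) → α) : Prop :=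
  ∃ W : Finset V, ∀ x y, (∀ u ∈ W, x u = y u) → g x = g y

theorem site_congr {x y : V → Γ} {v : V} (h : ∀ u ∈ m.D, x (v + u) = y (v + u)) :
    m.Site x v ↔ m.Site y v :=
  exists_congr fun a => forall₂_congr fun u hu => by rw [h u hu]

theorem st_congr [Inhabited A] {x y : V → Γ} {v : V} (h : ∀ u ∈ m.D, x (v + u) = y (v + u)) :
    m.st x v = m.st y v := by
  by_cases hs : m.Site y v
  · obtain ⟨a, ha⟩ := hs
    rw [ha.st_eq]
    apply SiteA.st_eq
    intro u hu
    rw [h u hu, ha u hu]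
  · rw [m.st_of_not hs, m.st_of_not]
    rwa [m.site_congr h]

theorem locDep_put (R : (V → Γ) → V → A) (hR : ∀ v, LocDep fun x => R x v) (u : V) :
    LocDep fun x => m.put x (R x) u := by
  classical
  choose W hW using hR
  refine ⟨insert u ((m.D.biUnion fun c => W (u - c)) ∪
    m.D.biUnion fun c => m.D.image fun e => u - c + e), fun x y h => ?_⟩
  have hsite : ∀ v, u - v ∈ m.core → (m.Site x v ↔ m.Site y v) := by
    intro v hv
    apply m.site_congr
    intro e he
    apply h
    simp only [Finset.mem_insert, Finset.mem_union, Finset.mem_biUnion, Finset.mem_image]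
    exact Or.inr (Or.inr ⟨u - v, m.hcore _ hv, e, he, by abel⟩)
  dsimp only
  by_cases hex : ∃ v, m.Site x v ∧ u - v ∈ m.core
  · obtain ⟨v, hv, hc⟩ := hex
    rw [m.put_core hv hc, m.put_core ((hsite v hc).1 hv) hc]
    have : R x v = R y v := by
      apply hW v
      intro w hw
      apply h
      simp only [Finset.mem_insert, Finset.mem_union, Finset.mem_biUnion, Finset.mem_image]
      refine Or.inr (Or.inl ⟨u - v, m.hcore _ hc, ?_⟩)
      rwa [show u - (u - v) = v by abel]
    rw [this]
  · push Not at hex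
    rw [m.put_not hex, m.put_not]
    · exact h u (by simp)
    · intro v hv hc
      exact hex v ((hsite v hc).2 hv) hc

theorem LocDep.continuous [TopologicalSpace Γ] [DiscreteTopology Γ] {g : (V → Γ) → Γ}
    (hg : LocDep g) : Continuous g := by
  obtain ⟨W, hW⟩ := hg
  rw [continuous_iff_continuousAt]
  intro x
  unfold ContinuousAt
  rw [nhds_discrete Γ, Filter.tendsto_pure]
  have : ∀ u ∈ W, ∀ᶠ y : V → Γ in nhds x, y u = x u := by
    intro u _
    have h1 : Filter.Tendsto (fun y : V → Γ => y u) (nhds x) (nhds (x u)) :=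
      (continuous_apply u).tendsto x
    rwa [nhds_discrete Γ, Filter.tendsto_pure] at h1
  have h2 := (Filter.eventually_all_finset W).2 this
  filter_upwards [h2] with y hy
  exact hW y x hy

theorem locDep_st [Inhabited A] {α : Type} (v : V) (f : A → α) :
    LocDep fun x => f (m.st x v) := by
  classical
  refine ⟨m.D.image fun u => v + u, fun x y h => ?_⟩
  dsimp only
  rw [m.st_congr]
  intro u hu
  exact h _ (Finset.mem_image_of_mem _ hu)

/-! Links along a direction `e`, with gaps at most `R`. -/

/-- The site `v + k e` is the successor of the site `v`. -/
def Link (e : V) (R : ℕ) (x : V → Γ) (v : V) (k : ℕ) : Prop :=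
  m.Site x v ∧ m.Site x (v + k • e) ∧ 0 < k ∧ k ≤ R ∧ ∀ j, 0 < j → j < k → ¬ m.Site x (v + j • e)

variable {m} in
theorem Link.unique {e : V} {R : ℕ} {x : V → Γ} {v : V} {k l : ℕ} (hk : m.Link e R x v k)
    (hl : m.Link e R x v l) : k = l := by
  obtain ⟨_, h1, h2, _, h3⟩ := hk
  obtain ⟨_, g1, g2, _, g3⟩ := hl
  rcases lt_trichotomy k l with h | h | h
  · exact absurd h1 (g3 k h2 h)
  · exact h
  · exact absurd g1 (h3 l g2 h)

variable {m} in
theorem Link.unique' {e : V} {R : ℕ} {x : V → Γ} {v : V} {k l : ℕ}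
    (hk : m.Link e R x (v - k • e) k) (hl : m.Link e R x (v - l • e) l) : k = l := by
  obtain ⟨h1, _, h2, _, h3⟩ := hk
  obtain ⟨g1, _, g2, _, g3⟩ := hl
  rcases lt_trichotomy k l with h | h | h
  · refine absurd h1 ?_
    have := g3 (l - k) (by omega) (by omega)
    rwa [sub_nsmul _ h.le, show v - l • e + (l • e + -(k • e)) = v - k • e by abel] at this
  · exact h
  · refine absurd g1 ?_
    have := h3 (k - l) (by omega) (by omega)
    rwa [sub_nsmul _ h.le, show v - k • e + (k • e + -(l • e)) = v - l • e by abel] at this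

theorem link_put {e : V} {R : ℕ} {x : V → Γ} {v : V} {k : ℕ} (s : V → A) :
    m.Link e R (m.put x s) v k ↔ m.Link e R x v k := by
  simp only [Link, site_put_iff]

theorem link_sh {e : V} {R : ℕ} {x : V → Γ} {v t : V} {k : ℕ} :
    m.Link e R (sh t x) v k ↔ m.Link e R x (v + t) k := by
  have : ∀ j : ℕ, v + j • e + t = v + t + j • e := fun j => by abel
  simp only [Link, site_sh, this]

open Classical in
/-- Value received at `v` from the predecessor. -/
noncomputable def fromPrev {α : Type} (e : V) (R : ℕ) (x : V → Γ) (v : V) (f : V → α) (a : α) :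
    α := if h : ∃ k, m.Link e R x (v - k • e) k then f (v - h.choose • e) else a

open Classical in
/-- Value received at `v` from the successor. -/
noncomputable def fromNext {α : Type} (e : V) (R : ℕ) (x : V → Γ) (v : V) (f : V → α) (a : α) :
    α := if h : ∃ k, m.Link e R x v k then f (v + h.choose • e) else a

theorem fromPrev_link {α : Type} {e : V} {R : ℕ} {x : V → Γ} {v : V} (f : V → α) (a : α) {k : ℕ}
    (h : m.Link e R x (v - k • e) k) : m.fromPrev e R x v f a = f (v - k • e) := by
  have h' : ∃ k, m.Link e R x (v - k • e) k := ⟨k, h⟩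
  rw [fromPrev, dif_pos h', Link.unique' h'.choose_spec h]

theorem fromNext_link {α : Type} {e : V} {R : ℕ} {x : V → Γ} {v : V} (f : V → α) (a : α) {k : ℕ}
    (h : m.Link e R x v k) : m.fromNext e R x v f a = f (v + k • e) := by
  have h' : ∃ k, m.Link e R x v k := ⟨k, h⟩
  rw [fromNext, dif_pos h', Link.unique h'.choose_spec h]

theorem fromPrev_not {α : Type} {e : V} {R : ℕ} {x : V → Γ} {v : V} (f : V → α) (a : α)
    (h : ¬ ∃ k, m.Link e R x (v - k • e) k) : m.fromPrev e R x v f a = a := by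
  rw [fromPrev, dif_neg h]

theorem fromNext_not {α : Type} {e : V} {R : ℕ} {x : V → Γ} {v : V} (f : V → α) (a : α)
    (h : ¬ ∃ k, m.Link e R x v k) : m.fromNext e R x v f a = a := by
  rw [fromNext, dif_neg h]

/-- `fromPrev` depends only on the links and the values at linked places. -/
theorem fromPrev_congr {α : Type} {e : V} {R : ℕ} {x y : V → Γ} {v w : V} {f g : V → α} {a b : α}
    (hl : ∀ k, k ≤ R → (m.Link e R x (v - k • e) k ↔ m.Link e R y (w - k • e) k))
    (hf : ∀ k, k ≤ R → m.Site x (v - k • e) → f (v - k • e) = g (w - k • e)) (hab : a = b) :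
    m.fromPrev e R x v f a = m.fromPrev e R y w g b := by
  by_cases h : ∃ k, m.Link e R x (v - k • e) k
  · obtain ⟨k, hk⟩ := h
    have hkR : k ≤ R := hk.2.2.2.1
    rw [m.fromPrev_link _ _ hk, m.fromPrev_link _ _ ((hl k hkR).1 hk), hf k hkR hk.1]
  · rw [m.fromPrev_not _ _ h, m.fromPrev_not, hab]
    rintro ⟨k, hk⟩
    exact h ⟨k, (hl k hk.2.2.2.1).2 hk⟩

theorem fromNext_congr {α : Type} {e : V} {R : ℕ} {x y : V → Γ} {v w : V} {f g : V → α} {a b : α}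
    (hl : ∀ k, k ≤ R → (m.Link e R x v k ↔ m.Link e R y w k))
    (hf : ∀ k, k ≤ R → m.Site x (v + k • e) → f (v + k • e) = g (w + k • e)) (hab : a = b) :
    m.fromNext e R x v f a = m.fromNext e R y w g b := by
  by_cases h : ∃ k, m.Link e R x v k
  · obtain ⟨k, hk⟩ := h
    have hkR : k ≤ R := hk.2.2.2.1
    rw [m.fromNext_link _ _ hk, m.fromNext_link _ _ ((hl k hkR).1 hk), hf k hkR hk.2.1]
  · rw [m.fromNext_not _ _ h, m.fromNext_not, hab]
    rintro ⟨k, hk⟩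
    exact h ⟨k, (hl k hk.2.2.2.1).2 hk⟩

theorem link_congr {e : V} {R : ℕ} {x y : V → Γ} {v : V} {k : ℕ}
    (h : ∀ j, j ≤ k → ∀ u ∈ m.D, x (v + j • e + u) = y (v + j • e + u)) :
    m.Link e R x v k ↔ m.Link e R y v k := by
  have h1 : ∀ j, j ≤ k → (m.Site x (v + j • e) ↔ m.Site y (v + j • e)) :=
    fun j hj => m.site_congr (h j hj)
  have h0 := h1 0 (Nat.zero_le _)
  simp only [zero_smul, add_zero] at h0
  unfold Link
  rw [h0, h1 k le_rfl]
  refine and_congr_right fun _ => and_congr_right fun _ => and_congr_right fun _ =>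
    and_congr_right fun _ => forall_congr' fun j => forall_congr' fun _ => ?_
  refine forall_congr' fun hj => ?_
  rw [h1 j hj.le]

end Marker

end MarkerPart
section AutPart

namespace Marker

variable {d : ℕ} {Γ : Type} {X : Set ((Fin d → ℤ) → Γ)}

theorem goodPerm_of_rule [TopologicalSpace Γ] [DiscreteTopology Γ] {A : Type} (m : Marker X A)
    (f : Equiv.Perm X) (R : ((Fin d → ℤ) → Γ) → (Fin d → ℤ) → A)
    (hloc : ∀ v, LocDep fun x => R x v) (heq : ∀ x t v, R (sh t x) v = R x (v + t))
    (hf : ∀ x, (f x).1 = m.put x.1 (R x.1)) : GoodPerm (Set.range (shiftV Γ)) f := by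
  constructor
  · rw [continuous_induced_rng, continuous_pi_iff]
    intro u
    have h1 := (m.locDep_put R hloc u).continuous.comp (continuous_subtype_val (p := (· ∈ X)))
    refine h1.congr fun x => ?_
    simp [hf]
  · rintro _ ⟨t, rfl⟩ x y hxy
    rw [hf, hf, ← hxy]
    have h1 : R (shiftV Γ t x.1) = fun v => R x.1 (v + t) := by
      ext v; exact heq x.1 t v
    rw [h1]
    exact (m.put_sh x.1 t (R x.1)).symm

variable {G : Type} [Group G] (m : Marker X (Bool × Bool × G))

instance stateInhabited (G : Type) [Group G] : Inhabited (Bool × Bool × G) := ⟨(false, false, 1)⟩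

/-- Action of `V → G` on states. -/
noncomputable def gst (γ : (Fin d → ℤ) → G) (x : (Fin d → ℤ) → Γ) (v : Fin d → ℤ) :
    Bool × Bool × G :=
  ((m.st x v).1, (m.st x v).2.1, γ v * (m.st x v).2.2)

/-- Action of `V → G` on `X`. -/
@[reducible]
noncomputable def act : MulAction ((Fin d → ℤ) → G) X where
  smul γ x := ⟨m.put x.1 (m.gst γ x.1), m.put_mem x.2 _⟩
  one_smul x := by
    apply Subtype.ext
    change m.put x.1 (m.gst 1 x.1) = x.1
    conv_rhs => rw [← m.put_st x.1]
    apply m.put_congr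
    intro v _
    simp [gst]
  mul_smul γ δ x := by
    apply Subtype.ext
    change m.put x.1 (m.gst (γ * δ) x.1) = m.put (m.put x.1 (m.gst δ x.1)) (m.gst γ (m.put x.1 (m.gst δ x.1)))
    rw [m.put_put]
    apply m.put_congr
    intro v hv
    simp [gst, m.st_put hv, mul_assoc]

/-- Swap the two bits at every site. -/
noncomputable def rSwap (x : (Fin d → ℤ) → Γ) (v : Fin d → ℤ) : Bool × Bool × G :=
  ((m.st x v).2.1, (m.st x v).1, (m.st x v).2.2)

/-- Swap the second bit of every site with the first bit of its successor. -/
noncomputable def rLink (e : Fin d → ℤ) (R : ℕ) (x : (Fin d → ℤ) → Γ) (v : Fin d → ℤ) :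
    Bool × Bool × G :=
  (m.fromPrev e R x v (fun w => (m.st x w).2.1) (m.st x v).1,
   m.fromNext e R x v (fun w => (m.st x w).1) (m.st x v).2.1, (m.st x v).2.2)

theorem rLink_fst (e : Fin d → ℤ) (R : ℕ) (x : (Fin d → ℤ) → Γ) (v : Fin d → ℤ) :
    (m.rLink e R x v).1 = m.fromPrev e R x v (fun w => (m.st x w).2.1) (m.st x v).1 := rfl

theorem rLink_snd (e : Fin d → ℤ) (R : ℕ) (x : (Fin d → ℤ) → Γ) (v : Fin d → ℤ) :
    (m.rLink e R x v).2.1 = m.fromNext e R x v (fun w => (m.st x w).1) (m.st x v).2.1 := rfl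

/-- A rule as a map on `X`. -/
noncomputable def app (ρ : ((Fin d → ℤ) → Γ) → (Fin d → ℤ) → Bool × Bool × G) (x : X) : X :=
  ⟨m.put x.1 (ρ x.1), m.put_mem x.2 _⟩

theorem swap_inv : Function.Involutive (m.app m.rSwap) := by
  intro x
  apply Subtype.ext
  change m.put (m.put x.1 (m.rSwap x.1)) (m.rSwap (m.put x.1 (m.rSwap x.1))) = x.1
  rw [m.put_put]
  conv_rhs => rw [← m.put_st x.1]
  apply m.put_congr
  intro v hv
  simp [rSwap, m.st_put hv]

theorem link_inv (e : Fin d → ℤ) (R : ℕ) : Function.Involutive (m.app (m.rLink e R)) := by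
  intro x
  apply Subtype.ext
  change m.put (m.put x.1 (m.rLink e R x.1)) (m.rLink e R (m.put x.1 (m.rLink e R x.1))) = x.1
  rw [m.put_put]
  conv_rhs => rw [← m.put_st x.1]
  apply m.put_congr
  intro v hv
  have h3 : m.st (m.put x.1 (m.rLink e R x.1)) v = m.rLink e R x.1 v := m.st_put hv _
  refine Prod.ext ?_ (Prod.ext ?_ ?_)
  · rw [rLink_fst]
    by_cases h : ∃ k, m.Link e R x.1 (v - k • e) k
    · obtain ⟨k, hk⟩ := h
      rw [m.fromPrev_link _ _ ((m.link_put _).2 hk), m.st_put hk.1]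
      rw [rLink_snd, m.fromNext_link _ _ hk]
      simp
    · rw [m.fromPrev_not _ _ (by simpa only [m.link_put] using h), h3]
      rw [rLink_fst]
      exact m.fromPrev_not _ _ h
  · rw [rLink_snd]
    by_cases h : ∃ k, m.Link e R x.1 v k
    · obtain ⟨k, hk⟩ := h
      rw [m.fromNext_link _ _ ((m.link_put _).2 hk), m.st_put hk.2.1]
      rw [rLink_fst, m.fromPrev_link (k := k) _ _ (by simpa using hk)]
      simp
    · rw [m.fromNext_not _ _ (by simpa only [m.link_put] using h), h3]
      rw [rLink_snd]
      exact m.fromNext_not _ _ h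
  · change (m.st _ v).2.2 = _
    rw [h3]
    rfl

theorem st_gst_fst (γ : (Fin d → ℤ) → G) (x : (Fin d → ℤ) → Γ) (v : Fin d → ℤ) :
    (m.st (m.put x (m.gst γ x)) v).1 = (m.st x v).1 := by
  by_cases h : m.Site x v
  · rw [m.st_put h]; rfl
  · rw [m.st_of_not h, m.st_of_not]; rwa [m.site_put_iff]

theorem st_gst_snd (γ : (Fin d → ℤ) → G) (x : (Fin d → ℤ) → Γ) (v : Fin d → ℤ) :
    (m.st (m.put x (m.gst γ x)) v).2.1 = (m.st x v).2.1 := by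
  by_cases h : m.Site x v
  · rw [m.st_put h]; rfl
  · rw [m.st_of_not h, m.st_of_not]; rwa [m.site_put_iff]

theorem app_comm (ρ : ((Fin d → ℤ) → Γ) → (Fin d → ℤ) → Bool × Bool × G)
    (h : ∀ (γ : (Fin d → ℤ) → G) x v, m.Site x v → ρ (m.put x (m.gst γ x)) v =
      ((ρ x v).1, (ρ x v).2.1, γ v * (ρ x v).2.2)) (γ : (Fin d → ℤ) → G) (x : X) :
    m.app ρ (m.act.smul γ x) = m.act.smul γ (m.app ρ x) := by
  apply Subtype.ext
  change m.put (m.put x.1 (m.gst γ x.1)) (ρ (m.put x.1 (m.gst γ x.1))) =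
    m.put (m.put x.1 (ρ x.1)) (m.gst γ (m.put x.1 (ρ x.1)))
  rw [m.put_put, m.put_put]
  apply m.put_congr
  intro v hv
  rw [h γ x.1 v hv]
  simp [gst, m.st_put hv]

theorem swap_comm (γ : (Fin d → ℤ) → G) (x : X) :
    m.app m.rSwap (m.act.smul γ x) = m.act.smul γ (m.app m.rSwap x) := by
  apply m.app_comm
  intro γ x v hv
  simp [rSwap, m.st_put hv, gst]

theorem link_comm (e : Fin d → ℤ) (R : ℕ) (γ : (Fin d → ℤ) → G) (x : X) :
    m.app (m.rLink e R) (m.act.smul γ x) = m.act.smul γ (m.app (m.rLink e R) x) := by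
  apply m.app_comm
  intro γ x v hv
  refine Prod.ext ?_ (Prod.ext ?_ ?_)
  · simp only [rLink_fst]
    exact m.fromPrev_congr (fun _ _ => m.link_put _) (fun _ _ _ => m.st_gst_snd _ _ _)
      (m.st_gst_fst _ _ _)
  · simp only [rLink_snd]
    exact m.fromNext_congr (fun _ _ => m.link_put _) (fun _ _ _ => m.st_gst_fst _ _ _)
      (m.st_gst_snd _ _ _)
  · simp [rLink, m.st_put hv, gst]

variable [TopologicalSpace Γ] [DiscreteTopology Γ]

theorem swap_good : GoodPerm (Set.range (shiftV Γ)) (m.swap_inv.toPerm) := by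
  refine m.goodPerm_of_rule _ m.rSwap (fun v => m.locDep_st v fun a => (a.2.1, a.1, a.2.2))
    (fun x t v => ?_) (fun x => rfl)
  simp only [rSwap, m.st_sh]

theorem link_good (e : Fin d → ℤ) (R : ℕ) :
    GoodPerm (Set.range (shiftV Γ)) ((m.link_inv e R).toPerm) := by
  classical
  refine m.goodPerm_of_rule _ (m.rLink e R) (fun v => ?_) (fun x t v => ?_) (fun x => rfl)
  · refine ⟨(Finset.range (2 * R + 1)).biUnion fun j => m.D.image fun u =>
      v - R • e + j • e + u, fun x y h => ?_⟩
    have key : ∀ j ≤ 2 * R, ∀ u ∈ m.D,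
        x (v - R • e + j • e + u) = y (v - R • e + j • e + u) := by
      intro j hj u hu
      apply h
      simp only [Finset.mem_biUnion, Finset.mem_image, Finset.mem_range]
      exact ⟨j, by omega, u, hu, rfl⟩
    have keyp : ∀ j ≤ R, ∀ u ∈ m.D, x (v + j • e + u) = y (v + j • e + u) := by
      intro j hj u hu
      have := key (R + j) (by omega) u hu
      rwa [add_smul, show v - R • e + (R • e + j • e) + u = v + j • e + u by abel] at this
    have keym : ∀ k ≤ R, ∀ j ≤ k, ∀ u ∈ m.D,
        x (v - k • e + j • e + u) = y (v - k • e + j • e + u) := by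
      intro k hk j hj u hu
      have := key (R - k + j) (by omega) u hu
      rwa [add_smul, sub_nsmul _ hk,
        show v - R • e + (R • e + -(k • e) + j • e) + u = v - k • e + j • e + u by abel] at this
    have hv0 : m.st x v = m.st y v := m.st_congr fun u hu => by
      simpa using keyp 0 (Nat.zero_le _) u hu
    refine Prod.ext ?_ (Prod.ext ?_ ?_)
    · simp only [rLink_fst]
      refine m.fromPrev_congr (fun k hk => m.link_congr (keym k hk)) (fun k hk _ => ?_) (by rw [hv0])
      rw [m.st_congr]
      intro u hu
      simpa using keym k hk 0 (Nat.zero_le _) u hu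
    · simp only [rLink_snd]
      refine m.fromNext_congr (fun k hk => m.link_congr fun j hj => keyp j (hj.trans hk))
        (fun k hk _ => ?_) (by rw [hv0])
      rw [m.st_congr]
      exact keyp k hk
    · change (m.st x v).2.2 = (m.st y v).2.2
      rw [hv0]
  · refine Prod.ext ?_ (Prod.ext ?_ ?_)
    · simp only [rLink_fst]
      refine m.fromPrev_congr (fun k hk => ?_) (fun k hk _ => ?_) (by rw [m.st_sh])
      · rw [m.link_sh, show v - k • e + t = v + t - k • e by abel]
      · rw [m.st_sh, show v - k • e + t = v + t - k • e by abel]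
    · simp only [rLink_snd]
      refine m.fromNext_congr (fun k hk => ?_) (fun k hk _ => ?_) (by rw [m.st_sh])
      · rw [m.link_sh]
      · rw [m.st_sh, show v + k • e + t = v + t + k • e by abel]
    · change (m.st _ v).2.2 = (m.st _ _).2.2
      rw [m.st_sh]

theorem involutive_mem {f : X → X} (hf : Function.Involutive f)
    (h : GoodPerm (Set.range (shiftV Γ)) hf.toPerm) :
    hf.toPerm ∈ SubAut X (Set.range (shiftV Γ)) := by
  refine ⟨h, ?_⟩
  have : (hf.toPerm)⁻¹ = hf.toPerm := by
    rw [inv_eq_iff_mul_eq_one]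
    ext1 x
    exact hf x
  rwa [this]

/-- A descending chain of sites. -/
theorem exists_chain (e : Fin d → ℤ) (R : ℕ) (y : (Fin d → ℤ) → Γ) (v₀ : Fin d → ℤ)
    (h0 : m.Site y v₀)
    (hch : ∀ k : ℕ, ∃ j, 0 < j ∧ j ≤ R ∧ m.Site y (v₀ - (k + j) • e)) :
    ∃ K : ℕ → ℕ, K 0 = 0 ∧ StrictMono K ∧ ∀ n, ∃ k,
      v₀ - K (n + 1) • e = v₀ - K n • e - k • e ∧ m.Link e R y (v₀ - K n • e - k • e) k := by
  classical
  have hch' : ∀ k : ℕ, ∃ j, 0 < j ∧ m.Site y (v₀ - (k + j) • e) := fun k => by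
    obtain ⟨j, h1, _, h3⟩ := hch k
    exact ⟨j, h1, h3⟩
  let K : ℕ → ℕ := fun n => Nat.rec 0 (fun _ k => k + Nat.find (hch' k)) n
  have hK : ∀ n, K (n + 1) = K n + Nat.find (hch' (K n)) := fun n => rfl
  have hsite : ∀ n, m.Site y (v₀ - K n • e) := by
    intro n
    cases n with
    | zero => simpa [K] using h0
    | succ n =>
      rw [hK]
      exact (Nat.find_spec (hch' (K n))).2
  refine ⟨K, rfl, strictMono_nat_of_lt_succ fun n => ?_, fun n => ?_⟩
  · rw [hK]
    have := (Nat.find_spec (hch' (K n))).1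
    omega
  · refine ⟨Nat.find (hch' (K n)), ?_, ?_, ?_, ?_, ?_, ?_⟩
    · rw [hK, add_smul]; abel
    · have := hsite (n + 1)
      rw [hK, add_smul] at this
      rwa [sub_sub]
    · simpa using hsite n
    · exact (Nat.find_spec (hch' (K n))).1
    · obtain ⟨j, h1, h2, h3⟩ := hch (K n)
      exact (Nat.find_min' (hch' (K n)) ⟨h1, h3⟩).trans h2
    · intro j hj hj' hs
      have := Nat.find_min (hch' (K n)) (m := Nat.find (hch' (K n)) - j) (by omega)
      apply this
      refine ⟨by omega, ?_⟩
      rw [add_smul, sub_nsmul _ hj'.le]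
      convert hs using 1
      abel

theorem exists_subgroup [Finite G] [IsSimpleGroup G] (hG : ¬ Group.IsSolvable G)
    (e : Fin d → ℤ) (he : Function.Injective fun n : ℕ => n • e) (R : ℕ)
    (y : (Fin d → ℤ) → Γ) (hy : y ∈ X)
    (v₀ : Fin d → ℤ) (h0 : m.Site y v₀)
    (hch : ∀ k : ℕ, ∃ j, 0 < j ∧ j ≤ R ∧ m.Site y (v₀ - (k + j) • e)) :
    ∃ H : Subgroup (SubAut X (Set.range (shiftV Γ))), H.FG ∧
      (¬∃ K : Subgroup H, K.FiniteIndex ∧ Group.IsSolvable K) ∧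
      ¬∃ K : Subgroup H, Nonempty (K ≃* FreeGroup (Fin 2)) := by
  classical
  let _ : MulAction ((Fin d → ℤ) → G) X := m.act
  let i1 : SubAut X (Set.range (shiftV Γ)) := ⟨_, involutive_mem m.swap_inv m.swap_good⟩
  let i2 : SubAut X (Set.range (shiftV Γ)) :=
    ⟨_, involutive_mem (m.link_inv e R) (m.link_good e R)⟩
  let β : X → (Fin d → ℤ) → Prop := fun x v => (m.st x.1 v).1 = true
  have hβ : ∀ (γ : (Fin d → ℤ) → G) (x : X), β (γ • x) = β x := by
    intro γ x
    ext v
    change (m.st (m.put x.1 (m.gst γ x.1)) v).1 = true ↔ _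
    rw [m.st_gst_fst]
  have hgood : ∀ g : G, GoodPerm (Set.range (shiftV Γ)) (invPerm (evFun β hβ g)) := by
    intro g
    refine m.goodPerm_of_rule _ (fun x v => ((m.st x v).1, (m.st x v).2.1,
      (if (m.st x v).1 = true then g else 1) * (m.st x v).2.2)) (fun v => ?_) (fun x t v => ?_)
      (fun x => ?_)
    · exact m.locDep_st v fun a => (a.1, a.2.1, (if a.1 = true then g else 1) * a.2.2)
    · simp only [m.st_sh]
    · rw [invPerm_apply]
      change m.put x.1 (m.gst _ x.1) = _
      apply m.put_congr
      intro v _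
      simp only [gst, evFun, MonoidHom.coe_mk, OneHom.coe_mk, β]
      congr
  let f : G → SubAut X (Set.range (shiftV Γ)) := fun g =>
    ⟨invPerm (evFun β hβ g), hgood g, by rw [← map_inv, ← map_inv]; exact hgood g⁻¹⟩
  refine groupPart (G := G) (V := Fin d → ℤ) hG (SubAut X (Set.range (shiftV Γ))).subtype
    (Subgroup.subtype_injective _) (i2 * i1) ?_ β hβ f (fun g => rfl) ?_
  · intro γ x
    change m.app (m.rLink e R) (m.app m.rSwap (m.act.smul γ x)) =
      m.act.smul γ (m.app (m.rLink e R) (m.app m.rSwap x))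
    rw [m.swap_comm, m.link_comm]
  · obtain ⟨K, hK0, hKm, hK⟩ := m.exists_chain e R y v₀ h0 hch
    have happ : ∀ x : X, (SubAut X (Set.range (shiftV Γ))).subtype (i2 * i1) x =
      m.app (m.rLink e R) (m.app m.rSwap x) := fun x => rfl
    generalize (SubAut X (Set.range (shiftV Γ))).subtype (i2 * i1) = τ at happ
    have hskel : ∀ x : X, ∀ v, m.Site (τ x).1 v ↔ m.Site x.1 v := by
      intro x v
      rw [happ]
      change m.Site (m.put (m.put x.1 _) _) v ↔ _
      rw [m.site_put_iff, m.site_put_iff]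
    have hstep : ∀ x : X, (∀ v, m.Site x.1 v ↔ m.Site y v) → ∀ n,
        (m.st (τ x).1 (v₀ - K n • e)).1 = (m.st x.1 (v₀ - K (n + 1) • e)).1 := by
      intro x hx n
      obtain ⟨k, hk1, hk2⟩ := hK n
      rw [hk1, happ]
      have hk3 : m.Link e R x.1 (v₀ - K n • e - k • e) k := by
        unfold Link at hk2 ⊢
        simpa only [hx] using hk2
      change (m.st (m.put (m.put x.1 (m.rSwap x.1)) (m.rLink e R (m.put x.1 (m.rSwap x.1)))) _).1 = _
      rw [m.st_put]
      · rw [rLink_fst]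
        rw [m.fromPrev_link _ _ ((m.link_put _).2 hk3)]
        rw [m.st_put hk3.1]
        rfl
      · rw [m.site_put_iff]
        simpa using hk3.2.1
    have hpow : ∀ n l : ℕ, ∀ x : X, (∀ v, m.Site x.1 v ↔ m.Site y v) →
        (m.st ((τ ^ n) x).1 (v₀ - K l • e)).1 = (m.st x.1 (v₀ - K (l + n) • e)).1 := by
      intro n
      induction n with
      | zero => intro l x _; rfl
      | succ n ih =>
        intro l x hx
        rw [pow_succ, Equiv.Perm.mul_apply, ih l (τ x) (fun v => by rw [hskel, hx]), hstep x hx]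
        rfl
    intro i j hij
    let s : (Fin d → ℤ) → Bool × Bool × G := fun v => (decide (v = v₀ - K i • e), false, 1)
    have hxs : ∀ v, m.Site (m.put y s) v ↔ m.Site y v := fun v => m.site_put_iff s
    have hsite : ∀ n, m.Site y (v₀ - K n • e) := by
      intro n
      cases n with
      | zero => simpa [hK0] using h0
      | succ n =>
        obtain ⟨k, hk1, hk2⟩ := hK n
        rw [hk1]; exact hk2.1
    have hp : ∀ n, (m.st ((τ ^ n) ⟨m.put y s, m.put_mem hy s⟩).1 v₀).1 =
        decide (v₀ - K n • e = v₀ - K i • e) := by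
      intro n
      have := hpow n 0 ⟨m.put y s, m.put_mem hy s⟩ hxs
      rw [hK0, zero_smul, sub_zero, zero_add] at this
      rw [this]
      change (m.st (m.put y s) _).1 = _
      rw [m.st_put (hsite n)]
    refine ⟨⟨m.put y s, m.put_mem hy s⟩, v₀, ?_, ?_, ?_⟩
    · change (m.st _ _).1 = true
      rw [hp]; simp
    · change ¬ (m.st _ _).1 = true
      rw [hp, decide_eq_true_iff, sub_right_inj]
      intro h
      exact hij (hKm.injective (he h)).symm
    · intro γ hγ
      have h1 : m.put (m.put y s) (m.gst γ (m.put y s)) = m.put y s := congrArg Subtype.val hγ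
      have h2 := congrArg (fun z => (m.st z v₀).2.2) h1
      rw [m.st_put ((hxs v₀).2 h0)] at h2
      simpa [gst] using h2

end Marker

end AutPart
section RecurrencePart

theorem exists_minimal_forward {Z : Type*} [TopologicalSpace Z] [CompactSpace Z] (T : Z → Z)
    (Y : Set Z) (hYc : IsClosed Y) (hYn : Y.Nonempty) (hYT : Set.MapsTo T Y Y) :
    ∃ M ⊆ Y, IsClosed M ∧ M.Nonempty ∧ Set.MapsTo T M M ∧
      ∀ C ⊆ M, IsClosed C → C.Nonempty → Set.MapsTo T C C → C = M := by
  let S : Set (Set Z) := {C | IsClosed C ∧ C.Nonempty ∧ Set.MapsTo T C C}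
  obtain ⟨M, hMY, hM⟩ := zorn_superset_nonempty S (by
    intro c hcS hc hne
    refine ⟨⋂₀ c, ⟨isClosed_sInter fun t ht => (hcS ht).1, ?_, ?_⟩, fun s hs =>
      Set.sInter_subset_of_mem hs⟩
    · have : Nonempty c := hne.to_subtype
      refine IsCompact.nonempty_sInter_of_directed_nonempty_isCompact_isClosed 
        (fun a ha b hb => (hc.total ha hb).elim (fun h => ⟨a, ha, subset_rfl, h⟩)
          fun h => ⟨b, hb, h, subset_rfl⟩)
        (fun t ht => (hcS ht).2.1) (fun t ht => (hcS ht).1.isCompact) (fun t ht => (hcS ht).1)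
    · intro x hx t ht
      exact (hcS ht).2.2 (hx t ht)) Y ⟨hYc, hYn, hYT⟩
  refine ⟨M, hMY, hM.prop.1, hM.prop.2.1, hM.prop.2.2, ?_⟩
  intro C hC h1 h2 h3
  exact hM.eq_of_subset ⟨h1, h2, h3⟩ hC

theorem exists_return_bound {Z : Type*} [TopologicalSpace Z] [CompactSpace Z] (T : Z → Z)
    (hT : Continuous T) (M : Set Z) (hMc : IsClosed M) (hMT : Set.MapsTo T M M)
    (hmin : ∀ C ⊆ M, IsClosed C → C.Nonempty → Set.MapsTo T C C → C = M)
    (U : Set Z) (hU : IsOpen U) (hUM : (U ∩ M).Nonempty) :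
    ∃ R : ℕ, ∀ x ∈ M, ∃ j, 0 < j ∧ j ≤ R ∧ T^[j] x ∈ U := by
  have hit : ∀ x ∈ M, ∃ j : ℕ, T^[j + 1] x ∈ U := by
    intro x hx
    have hC : closure (Set.range fun j : ℕ => T^[j + 1] x) = M := by
      apply hmin
      · apply closure_minimal _ hMc
        rintro _ ⟨j, rfl⟩
        exact hMT.iterate (j + 1) hx
      · exact isClosed_closure
      · exact (Set.range_nonempty _).closure
      · refine Set.MapsTo.closure ?_ hT
        rintro _ ⟨j, rfl⟩
        exact ⟨j + 1, Function.iterate_succ_apply' T (j + 1) x⟩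
    obtain ⟨z, hzU, hzM⟩ := hUM
    rw [← hC] at hzM
    obtain ⟨_, hw, j, rfl⟩ := mem_closure_iff.1 hzM U hU hzU
    exact ⟨j, hw⟩
  obtain ⟨t, ht⟩ := hMc.isCompact.elim_finite_subcover (fun j : ℕ => T^[j + 1] ⁻¹' U)
    (fun j => hU.preimage (hT.iterate _)) (fun x hx => by
      obtain ⟨j, hj⟩ := hit x hx
      exact Set.mem_iUnion.2 ⟨j, hj⟩)
  refine ⟨t.sup id + 1, fun x hx => ?_⟩
  obtain ⟨j, hj, hxj⟩ := Set.mem_iUnion₂.1 (ht hx)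
  exact ⟨j + 1, Nat.succ_pos _, Nat.succ_le_succ (Finset.le_sup (f := id) hj), hxj⟩

theorem continuous_shiftV {d : ℕ} {Γ : Type} [TopologicalSpace Γ] (v : Fin d → ℤ) :
    Continuous (shiftV Γ v) := continuous_pi fun u => continuous_apply (u + v)

theorem shiftV_shiftV {d : ℕ} {Γ : Type} (v w : Fin d → ℤ) (x : (Fin d → ℤ) → Γ) :
    shiftV Γ v (shiftV Γ w x) = shiftV Γ (v + w) x := by
  funext u; simp [shiftV, add_assoc]

theorem shiftV_iterate {d : ℕ} {Γ : Type} (v : Fin d → ℤ) (x : (Fin d → ℤ) → Γ) (n : ℕ) :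
    (shiftV Γ v)^[n] x = shiftV Γ (n • v) x := by
  induction n with
  | zero => funext u; simp [shiftV]
  | succ n ih => rw [Function.iterate_succ_apply', ih, shiftV_shiftV, succ_nsmul']

namespace Marker

variable {d : ℕ} {Γ A : Type} {X : Set ((Fin d → ℤ) → Γ)} (m : Marker X A)

theorem shift_mem (m : Marker X A) {x : (Fin d → ℤ) → Γ} (hx : x ∈ X) (v : Fin d → ℤ) : shiftV Γ v x ∈ X := by
  rw [m.hXeq] at hx ⊢
  intro w
  have := hx (w + v)
  convert this using 2
  simp only [shiftV]
  congr 1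
  abel

theorem site_shift {x : (Fin d → ℤ) → Γ} {v w : Fin d → ℤ} :
    m.Site (shiftV Γ w x) v ↔ m.Site x (v + w) := by
  unfold Site SiteA shiftV
  simp only [add_right_comm]

variable [TopologicalSpace Γ] [DiscreteTopology Γ]

theorem isOpen_siteA (v : Fin d → ℤ) (a : A) : IsOpen {x | m.SiteA x v a} := by
  have : {x | m.SiteA x v a} = ⋂ u ∈ m.D, {x : (Fin d → ℤ) → Γ | x (v + u) = m.P a u} := by
    ext x; simp [SiteA]
  rw [this]
  refine isOpen_biInter_finset fun u _ => ?_
  have h : Continuous fun x : (Fin d → ℤ) → Γ => x (v + u) := continuous_apply (v + u)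
  exact (isOpen_discrete ({m.P a u} : Set Γ)).preimage h

theorem isOpen_site (v : Fin d → ℤ) : IsOpen {x | m.Site x v} := by
  have : {x | m.Site x v} = ⋃ a, {x | m.SiteA x v a} := by
    ext x; simp [Site]
  rw [this]
  exact isOpen_iUnion fun a => m.isOpen_siteA v a

theorem isClosed_X (m : Marker X A) [Finite Γ] : IsClosed X := by
  have : X = ⋂ v : Fin d → ℤ,
      (fun (x : (Fin d → ℤ) → Γ) (t : m.F) => x (v + (t : Fin d → ℤ))) ⁻¹' m.Q := by
    ext x; simp [m.hXeq]
  rw [this]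
  exact isClosed_iInter fun v => (isClosed_discrete m.Q).preimage
    (continuous_pi fun t => continuous_apply _)

theorem exists_recurrent [Finite Γ] [Nonempty A]
    (hmin : X ⊆ closure {x | x ∈ X ∧ IsMinimalPt x}) (e : Fin d → ℤ) :
    ∃ (R : ℕ) (y : (Fin d → ℤ) → Γ) (v₀ : Fin d → ℤ), y ∈ X ∧ m.Site y v₀ ∧
      ∀ k : ℕ, ∃ j, 0 < j ∧ j ≤ R ∧ m.Site y (v₀ - (k + j) • e) := by
  obtain ⟨a⟩ := ‹Nonempty A›
  obtain ⟨x, hx0, hxX, hxm⟩ := mem_closure_iff.1 (hmin (m.hPX a)) _ (m.isOpen_site 0)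
    ⟨a, fun u _ => by rw [zero_add]⟩
  set Y := closure {y | ∃ v, y = shiftV Γ v x} with hY
  have hmaps : ∀ (z : (Fin d → ℤ) → Γ) (w : Fin d → ℤ), Set.MapsTo (shiftV Γ w)
      (closure {y | ∃ v, y = shiftV Γ v z}) (closure {y | ∃ v, y = shiftV Γ v z}) := by
    intro z w
    refine Set.MapsTo.closure ?_ (continuous_shiftV w)
    rintro _ ⟨v, rfl⟩
    exact ⟨w + v, shiftV_shiftV _ _ _⟩
  have hxY : x ∈ Y := subset_closure ⟨0, by funext u; simp [shiftV]⟩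
  have hYX : Y ⊆ X := by
    refine closure_minimal ?_ m.isClosed_X
    rintro _ ⟨v, rfl⟩
    exact m.shift_mem hxX v
  obtain ⟨M, hMY, hMc, ⟨z, hz⟩, hMT, hMm⟩ := exists_minimal_forward (shiftV Γ (-e)) Y
    isClosed_closure ⟨x, hxY⟩ (hmaps x _)
  have hzY : closure {y | ∃ v, y = shiftV Γ v z} = Y := by
    apply hxm
    · refine closure_minimal ?_ isClosed_closure
      rintro _ ⟨v, rfl⟩
      exact hmaps x v (hMY hz)
    · exact isClosed_closure
    · intro v
      apply Set.Subset.antisymm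
      · exact (hmaps z v).image_subset
      · intro w hw
        exact ⟨shiftV Γ (-v) w, hmaps z _ hw, by rw [shiftV_shiftV]; funext u; simp [shiftV]⟩
    · exact ⟨z, subset_closure ⟨0, by funext u; simp [shiftV]⟩⟩
  have hxz := hxY
  rw [← hzY] at hxz
  obtain ⟨_, hv, v, rfl⟩ := mem_closure_iff.1 hxz _ (m.isOpen_site 0) hx0
  have hv' : m.Site z v := by
    have := m.site_shift.1 hv
    rwa [zero_add] at this
  obtain ⟨R, hR⟩ := exists_return_bound _ (continuous_shiftV (-e)) M hMc hMT hMm _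
    (m.isOpen_site v) ⟨z, hv', hz⟩
  refine ⟨R, z, v, hYX (hMY hz), hv', fun k => ?_⟩
  obtain ⟨j, hj, hjR, hs⟩ := hR _ (hMT.iterate k hz)
  refine ⟨j, hj, hjR, ?_⟩
  rw [shiftV_iterate, shiftV_iterate, shiftV_shiftV] at hs
  have := m.site_shift.1 hs
  rwa [← add_smul, smul_neg, ← sub_eq_add_neg, add_comm j k] at this

end Marker

end RecurrencePart
section CountingPart

theorem ncard_le_mul_of_fibers {α β γ : Type*} [Finite β] [Finite γ] (f : α → β) (h : α → γ)
    (T : Set α) (K : ℕ) (hK : ∀ x ∈ T, (f '' {y | y ∈ T ∧ h y = h x}).ncard ≤ K) :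
    (f '' T).ncard ≤ K * (h '' T).ncard := by
  classical
  have hfin : (h '' T).Finite := Set.toFinite _
  have hcov : f '' T ⊆ ⋃ z ∈ hfin.toFinset, f '' {y | y ∈ T ∧ h y = z} := by
    rintro _ ⟨x, hx, rfl⟩
    simp only [Set.mem_iUnion]
    exact ⟨h x, hfin.mem_toFinset.2 ⟨x, hx, rfl⟩, x, ⟨hx, rfl⟩, rfl⟩
  calc (f '' T).ncard ≤ _ := Set.ncard_le_ncard hcov (Set.toFinite _)
    _ ≤ ∑ z ∈ hfin.toFinset, (f '' {y | y ∈ T ∧ h y = z}).ncard :=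
      Finset.set_ncard_biUnion_le _ _
    _ ≤ ∑ z ∈ hfin.toFinset, K := by
      refine Finset.sum_le_sum fun z hz => ?_
      obtain ⟨x, hx, rfl⟩ := hfin.mem_toFinset.1 hz
      exact hK x hx
    _ = K * (h '' T).ncard := by
      rw [Finset.sum_const, smul_eq_mul, mul_comm, Set.ncard_eq_toFinset_card _ hfin]

/-- The restriction of `x` to the box `{0, …, n - 1}^d`. -/
def pat {d : ℕ} {Γ : Type} (n : ℕ) (x : (Fin d → ℤ) → Γ) (u : Fin d → Fin n) : Γ :=
  x fun i => ((u i : ℕ) : ℤ)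

theorem pat_image {d : ℕ} {Γ : Type} (X : Set ((Fin d → ℤ) → Γ)) (n : ℕ) :
    pat n '' X = boxPatterns X n := by
  ext p
  constructor
  · rintro ⟨x, hx, rfl⟩
    exact ⟨x, hx, fun u => rfl⟩
  · rintro ⟨x, hx, h⟩
    exact ⟨x, hx, (funext h).symm⟩

/-- The restriction of `x` to all the cells other than `c₀`. -/
def cellPat {d : ℕ} {Γ : Type} (g : ℕ) (c₀ : Fin d → Fin 11) (x : (Fin d → ℤ) → Γ)
    (c : {c : Fin d → Fin 11 // c ≠ c₀}) (r : Fin d → Fin g) : Γ :=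
  x fun i => (g : ℤ) * ((c.1 i : ℕ) : ℤ) + ((r i : ℕ) : ℤ)

theorem cellPat_ncard {d : ℕ} {Γ : Type} [Finite Γ] {X : Set ((Fin d → ℤ) → Γ)}
    (hsh : ∀ x ∈ X, ∀ v, shiftV Γ v x ∈ X) (g : ℕ) (c₀ : Fin d → Fin 11)
    {T : Set ((Fin d → ℤ) → Γ)} (hT : T ⊆ X) :
    (cellPat g c₀ '' T).ncard ≤ (boxPatterns X g).ncard ^ (11 ^ d - 1) := by
  classical
  have hmem : ∀ q ∈ cellPat g c₀ '' T, ∀ c, q c ∈ boxPatterns X g := by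
    rintro _ ⟨x, hx, rfl⟩ c
    refine ⟨shiftV Γ (fun i => (g : ℤ) * ((c.1 i : ℕ) : ℤ)) x, hsh x (hT hx) _, fun u => ?_⟩
    simp only [cellPat, shiftV]
    congr 1
    funext i
    simp [add_comm]
  let φ : (cellPat g c₀ '' T) → ({c : Fin d → Fin 11 // c ≠ c₀} → boxPatterns X g) :=
    fun q c => ⟨q.1 c, hmem q.1 q.2 c⟩
  have hφ : Function.Injective φ := by
    intro p q hpq
    ext c r
    have := congrArg (fun f => (f c).1 r) hpq
    exact this
  have := Nat.card_le_card_of_injective φ hφ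
  rw [Nat.card_fun] at this
  simpa [Nat.card_coe_set_eq, Nat.card_eq_fintype_card, Fintype.card_subtype_compl] using this

theorem exists_cell {d g : ℕ} {c₀ : Fin d → Fin 11} {u : Fin d → ℤ}
    (hu : ∀ i, 0 ≤ u i ∧ u i < 11 * (g : ℤ))
    (hc : ¬ ∀ i, (g : ℤ) * ((c₀ i : ℕ) : ℤ) ≤ u i ∧
      u i < (g : ℤ) * ((c₀ i : ℕ) : ℤ) + g) :
    ∃ (c : {c : Fin d → Fin 11 // c ≠ c₀}) (r : Fin d → Fin g),
      u = fun i => (g : ℤ) * ((c.1 i : ℕ) : ℤ) + ((r i : ℕ) : ℤ) := by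
  have key : ∀ i, ∃ (k : Fin 11) (r : Fin g), u i = (g : ℤ) * ((k : ℕ) : ℤ) + ((r : ℕ) : ℤ) := by
    intro i
    obtain ⟨h0, h1⟩ := hu i
    have hg : (0 : ℤ) < g := by omega
    have e1 := Int.mul_ediv_add_emod (u i) g
    have e2 := Int.emod_nonneg (u i) hg.ne'
    have e3 := Int.emod_lt_of_pos (u i) hg
    have e4 : 0 ≤ u i / g := Int.ediv_nonneg h0 hg.le
    have e5 : u i / g < 11 := Int.ediv_lt_of_lt_mul hg h1
    refine ⟨⟨(u i / g).toNat, by omega⟩, ⟨(u i % g).toNat, by omega⟩, ?_⟩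
    simp only [Int.toNat_of_nonneg e4, Int.toNat_of_nonneg e2]
    exact e1.symm
  choose c r h using key
  refine ⟨⟨c, ?_⟩, r, funext h⟩
  rintro rfl
  apply hc
  intro i
  rw [h i]
  have := (r i).2
  constructor <;> omega

theorem eq_of_cellPat_eq {d g : ℕ} {Γ : Type} {c₀ : Fin d → Fin 11} {x y : (Fin d → ℤ) → Γ}
    (h : cellPat g c₀ x = cellPat g c₀ y) {u : Fin d → ℤ}
    (hu : ∀ i, 0 ≤ u i ∧ u i < 11 * (g : ℤ))
    (hc : ¬ ∀ i, (g : ℤ) * ((c₀ i : ℕ) : ℤ) ≤ u i ∧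
      u i < (g : ℤ) * ((c₀ i : ℕ) : ℤ) + g) : x u = y u := by
  obtain ⟨c, r, rfl⟩ := exists_cell hu hc
  exact congrFun (congrFun h c) r

/-- The big box. -/
def InD {d : ℕ} (g : ℕ) (u : Fin d → ℤ) : Prop := ∀ i, 0 ≤ u i ∧ u i < 11 * (g : ℤ)

/-- The central cell. -/
def InC {d : ℕ} (g : ℕ) (u : Fin d → ℤ) : Prop := ∀ i, 5 * (g : ℤ) ≤ u i ∧ u i < 6 * (g : ℤ)

/-- The points with the self-overlap `v` outside the central cell. -/
def Overlap {d : ℕ} {Γ : Type} (X : Set ((Fin d → ℤ) → Γ)) (g : ℕ) (v : Fin d → ℤ) :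
    Set ((Fin d → ℤ) → Γ) :=
  {x | x ∈ X ∧ ∀ u, InD g u → ¬ InC g u → InD g (u + v) → ¬ InC g (u + v) → x (u + v) = x u}

theorem overlap_neg {d : ℕ} {Γ : Type} (X : Set ((Fin d → ℤ) → Γ)) (g : ℕ) (v : Fin d → ℤ) :
    Overlap X g v ⊆ Overlap X g (-v) := by
  rintro x ⟨hx, h⟩
  refine ⟨hx, fun u h1 h2 h3 h4 => ?_⟩
  have := h (u + -v) h3 h4 (by simpa using h1) (by simpa using h2)
  simpa using this.symm

theorem overlap_ncard_aux {d : ℕ} {Γ : Type} [Finite Γ] {X : Set ((Fin d → ℤ) → Γ)}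
    (hsh : ∀ x ∈ X, ∀ v, shiftV Γ v x ∈ X) (g : ℕ) (v : Fin d → ℤ)
    (hv6 : ∀ i, -(6 * (g : ℤ)) < v i ∧ v i < 6 * (g : ℤ)) (i₀ : Fin d) (hi : 0 < v i₀) :
    (pat (11 * g) '' Overlap X g v).ncard ≤ (boxPatterns X g).ncard ^ (11 ^ d - 1) := by
  classical
  let c₀ : Fin d → Fin 11 := fun i =>
    if i = i₀ ∧ v i ≤ 3 * (g : ℤ) then 3 else if 0 ≤ v i then 6 else 0
  have hW : ∀ u : Fin d → ℤ, (∀ i, (g : ℤ) * ((c₀ i : ℕ) : ℤ) ≤ u i ∧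
      u i < (g : ℤ) * ((c₀ i : ℕ) : ℤ) + g) →
      InD g u ∧ ¬ InC g u ∧ InD g (u - v) ∧ ¬ InC g (u - v) := by
    intro u hu
    have hD : ∀ i, (0 ≤ u i ∧ u i < 11 * (g : ℤ)) ∧
        (0 ≤ u i - v i ∧ u i - v i < 11 * (g : ℤ)) := by
      intro i
      have h1 := hu i
      have h2 := hv6 i
      simp only [c₀] at h1
      split_ifs at h1 with h3 h4
      · obtain ⟨rfl, h3⟩ := h3
        norm_num at h1
        omega
      · norm_num at h1
        omega
      · norm_num at h1
        omega
    have hC : (u i₀ < 5 * (g : ℤ) ∨ 6 * (g : ℤ) ≤ u i₀) ∧ u i₀ - v i₀ < 5 * (g : ℤ) := by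
      have h1 := hu i₀
      have h2 := hv6 i₀
      simp only [c₀] at h1
      split_ifs at h1 with h3 h4
      · norm_num at h1
        omega
      · norm_num at h1
        simp only [true_and] at h3
        omega
      · omega
    refine ⟨fun i => (hD i).1, fun h => ?_, fun i => (hD i).2, fun h => ?_⟩
    · have := h i₀
      omega
    · have := h i₀
      simp only [Pi.sub_apply] at this
      omega
  refine (ncard_le_mul_of_fibers (pat (11 * g)) (cellPat g c₀) _ 1 ?_).trans ?_
  · intro x hx
    refine (Set.ncard_le_one_iff_eq (Set.toFinite _)).2 (Or.inr ⟨pat (11 * g) x, ?_⟩)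
    have key : ∀ y ∈ Overlap X g v, cellPat g c₀ y = cellPat g c₀ x →
        ∀ (n : ℕ) (u : Fin d → ℤ), InD g u → (u i₀).toNat = n → y u = x u := by
      intro y hy hyx n
      induction n using Nat.strong_induction_on with
      | _ n ih =>
        intro u hu hn
        by_cases hc : ∀ i, (g : ℤ) * ((c₀ i : ℕ) : ℤ) ≤ u i ∧
            u i < (g : ℤ) * ((c₀ i : ℕ) : ℤ) + g
        · obtain ⟨h1, h2, h3, h4⟩ := hW u hc
          have e1 := hy.2 (u - v) h3 h4 (by simpa using h1) (by simpa using h2)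
          have e2 := hx.2 (u - v) h3 h4 (by simpa using h1) (by simpa using h2)
          rw [sub_add_cancel] at e1 e2
          rw [e1, e2]
          have h5 := h3 i₀
          have h6 := h1 i₀
          simp only [Pi.sub_apply] at h5
          exact ih ((u - v) i₀).toNat (by simp only [Pi.sub_apply]; omega) _ h3 rfl
        · exact eq_of_cellPat_eq hyx hu hc
    ext p
    constructor
    · rintro ⟨y, ⟨hy, hyx⟩, rfl⟩
      rw [Set.mem_singleton_iff]
      funext u
      refine key y hy hyx _ _ (fun i => ?_) rfl
      have := (u i).2
      omega
    · rintro rfl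
      exact ⟨x, ⟨hx, rfl⟩, rfl⟩
  · rw [one_mul]
    exact cellPat_ncard hsh g c₀ fun x hx => hx.1

theorem overlap_ncard {d : ℕ} {Γ : Type} [Finite Γ] {X : Set ((Fin d → ℤ) → Γ)}
    (hsh : ∀ x ∈ X, ∀ v, shiftV Γ v x ∈ X) (g : ℕ) (v : Fin d → ℤ) (hv : v ≠ 0)
    (hv6 : ∀ i, -(6 * (g : ℤ)) < v i ∧ v i < 6 * (g : ℤ)) :
    (pat (11 * g) '' Overlap X g v).ncard ≤ (boxPatterns X g).ncard ^ (11 ^ d - 1) := by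
  obtain ⟨i₀, hi⟩ := Function.ne_iff.1 hv
  rcases lt_or_gt_of_ne hi with h | h
  · refine (Set.ncard_le_ncard (Set.image_mono (overlap_neg X g v)) (Set.toFinite _)).trans ?_
    refine overlap_ncard_aux hsh g (-v) (fun i => ?_) i₀ ?_
    · have := hv6 i
      simp only [Pi.neg_apply]
      omega
    · simp only [Pi.neg_apply, Pi.zero_apply] at h ⊢
      omega
  · exact overlap_ncard_aux hsh g v hv6 i₀ h

/-- The fillings of the border pattern of `x`. -/
def Fillings {d : ℕ} {Γ : Type} (X : Set ((Fin d → ℤ) → Γ)) (g : ℕ) (x : (Fin d → ℤ) → Γ) :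
    Set ((Fin d → Fin (11 * g)) → Γ) :=
  pat (11 * g) '' {y | y ∈ X ∧ ∀ u, InD g u → ¬ InC g u → y u = x u}

theorem few_ncard {d : ℕ} {Γ : Type} [Finite Γ] {X : Set ((Fin d → ℤ) → Γ)}
    (hsh : ∀ x ∈ X, ∀ v, shiftV Γ v x ∈ X) (g K : ℕ) :
    (pat (11 * g) '' {x | x ∈ X ∧ (Fillings X g x).ncard < K}).ncard ≤
      K * (boxPatterns X g).ncard ^ (11 ^ d - 1) := by
  refine (ncard_le_mul_of_fibers (pat (11 * g)) (cellPat g fun _ => 5) _ K ?_).trans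
    (Nat.mul_le_mul_left _ (cellPat_ncard hsh g _ fun x hx => hx.1))
  rintro x ⟨hx, hK⟩
  refine (Set.ncard_le_ncard (Set.image_mono ?_) (Set.toFinite _)).trans hK.le
  rintro y ⟨⟨hy, -⟩, hyx⟩
  refine ⟨hy, fun u hu hc => eq_of_cellPat_eq hyx hu fun h => hc fun i => ?_⟩
  have := h i
  norm_num at this
  constructor <;> linarith

theorem exists_good {d : ℕ} {Γ : Type} [Finite Γ] {X : Set ((Fin d → ℤ) → Γ)}
    (hsh : ∀ x ∈ X, ∀ v, shiftV Γ v x ∈ X) (g K : ℕ)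
    (hbig : (K + (12 * g) ^ d) * (boxPatterns X g).ncard ^ (11 ^ d - 1) <
      (boxPatterns X (11 * g)).ncard) :
    ∃ x ∈ X, K ≤ (Fillings X g x).ncard ∧ ∀ v : Fin d → ℤ, v ≠ 0 →
      (∀ i, -(6 * (g : ℤ)) < v i ∧ v i < 6 * (g : ℤ)) → x ∉ Overlap X g v := by
  classical
  by_contra hcon
  push Not at hcon
  let Vs : Finset (Fin d → ℤ) :=
    (Fintype.piFinset fun _ => Finset.Ioo (-(6 * (g : ℤ))) (6 * (g : ℤ))).erase 0
  have hVs : Vs.card ≤ (12 * g) ^ d := by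
    refine (Finset.card_le_card (Finset.erase_subset _ _)).trans ?_
    rw [Fintype.card_piFinset_const, Int.card_Ioo]
    apply Nat.pow_le_pow_left
    omega
  have hcov : boxPatterns X (11 * g) ⊆
      pat (11 * g) '' {x | x ∈ X ∧ (Fillings X g x).ncard < K} ∪
        ⋃ v ∈ Vs, pat (11 * g) '' Overlap X g v := by
    rw [← pat_image]
    rintro _ ⟨x, hx, rfl⟩
    by_cases h : K ≤ (Fillings X g x).ncard
    · right
      obtain ⟨v, hv0, hv6, hv⟩ := hcon x hx h
      simp only [Set.mem_iUnion]
      refine ⟨v, ?_, x, hv, rfl⟩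
      simp only [Vs, Finset.mem_erase, Fintype.mem_piFinset, Finset.mem_Ioo]
      exact ⟨hv0, hv6⟩
    · exact Or.inl ⟨x, ⟨hx, not_le.1 h⟩, rfl⟩
  have h1 := (Set.ncard_le_ncard hcov (Set.toFinite _)).trans (Set.ncard_union_le _ _)
  have h2 : (⋃ v ∈ Vs, pat (11 * g) '' Overlap X g v).ncard ≤
      (12 * g) ^ d * (boxPatterns X g).ncard ^ (11 ^ d - 1) := by
    refine (Finset.set_ncard_biUnion_le _ _).trans ?_
    refine (Finset.sum_le_card_nsmul _ _ ((boxPatterns X g).ncard ^ (11 ^ d - 1)) ?_).trans ?_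
    · intro v hv
      simp only [Vs, Finset.mem_erase, Fintype.mem_piFinset, Finset.mem_Ioo] at hv
      exact overlap_ncard hsh g v hv.1 hv.2
    · rw [smul_eq_mul]
      exact Nat.mul_le_mul_right _ hVs
  have h3 := few_ncard hsh g K
  rw [add_mul] at hbig
  omega

theorem exists_scale (d : ℕ) (hd : 1 ≤ d) (N : ℕ → ℕ) (c : ℝ) (hc : 0 < c)
    (hN : ∀ n : ℕ, 1 ≤ n → Real.exp (c * (n : ℝ) ^ d) ≤ N n) (K n₁ : ℕ) :
    ∃ g ≥ n₁, 1 ≤ g ∧ (K + (12 * g) ^ d) * N g ^ (11 ^ d - 1) < N (11 * g) := by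
  obtain ⟨n₂, hn₂⟩ : ∃ n₂ : ℕ, ∀ g : ℕ, n₂ ≤ g →
      (K : ℝ) + (12 * g) ^ d ≤ Real.exp (c / 2 * (g : ℝ) ^ d) := by
    obtain ⟨n₂, hn₂⟩ := exists_nat_ge (8 * ((K : ℝ) + 12 ^ d) / c ^ 2)
    refine ⟨max n₂ 1, fun g hg => ?_⟩
    have hg1 : (1 : ℝ) ≤ g := by exact_mod_cast (le_max_right _ _).trans hg
    have hg2 : (n₂ : ℝ) ≤ g := by exact_mod_cast (le_max_left _ _).trans hg
    have hgt : (g : ℝ) ≤ (g : ℝ) ^ d := le_self_pow₀ hg1 (by omega)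
    rw [mul_pow]
    set t := (g : ℝ) ^ d
    have ht1 : 1 ≤ t := hg1.trans hgt
    have ht2 : 8 * ((K : ℝ) + 12 ^ d) ≤ t * c ^ 2 := by
      rw [← div_le_iff₀ (by positivity)]
      linarith
    have hq := Real.quadratic_le_exp_of_nonneg (x := c / 2 * t) (by positivity)
    have h1 : (K : ℝ) + 12 ^ d * t ≤ ((K : ℝ) + 12 ^ d) * t := by
      have : (K : ℝ) ≤ K * t := le_mul_of_one_le_right (Nat.cast_nonneg _) ht1
      linarith
    have h2 := mul_le_mul_of_nonneg_right ht2 (by linarith : 0 ≤ t)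
    have h3 : 0 ≤ c / 2 * t := by positivity
    nlinarith
  by_contra hcon
  push Not at hcon
  set n₀ := max (max n₁ n₂) 1 with hn₀
  have hM : (1 : ℝ) ≤ (11 : ℝ) ^ d := one_le_pow₀ (by norm_num)
  have hn0 : 1 ≤ n₀ := le_max_right _ _
  let G : ℕ → ℕ := fun k => 11 ^ k * n₀
  have hG : ∀ k, n₀ ≤ G k := fun k => Nat.le_mul_of_pos_left _ (by positivity)
  let a : ℕ → ℝ := fun k => Real.log (N (G k)) / (G k : ℝ) ^ d
  have hGpos : ∀ k, (0 : ℝ) < (G k : ℝ) ^ d := by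
    intro k
    have : 0 < G k := lt_of_lt_of_le hn0 (hG k)
    positivity
  have hNpos : ∀ k, (0 : ℝ) < N (G k) := fun k =>
    lt_of_lt_of_le (Real.exp_pos _) (hN _ (hn0.trans (hG k)))
  have hac : ∀ k, c ≤ a k := by
    intro k
    rw [le_div_iff₀ (hGpos k), Real.le_log_iff_exp_le (hNpos k)]
    exact hN _ (hn0.trans (hG k))
  have hrec : ∀ k, a (k + 1) - c / 2 ≤ (1 - 1 / (11 : ℝ) ^ d) * (a k - c / 2) := by
    intro k
    have h1 := hcon (G k) ((le_max_left _ _).trans ((le_max_left _ _).trans (hG k)))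
      (hn0.trans (hG k))
    have h2 := hn₂ (G k) ((le_max_right _ _).trans ((le_max_left _ _).trans (hG k)))
    have hG1 : G (k + 1) = 11 * G k := by simp only [G]; ring
    have h3 : (N (G (k + 1)) : ℝ) ≤ Real.exp (c / 2 * (G k : ℝ) ^ d) *
        (N (G k) : ℝ) ^ (11 ^ d - 1) := by
      rw [hG1]
      calc (N (11 * G k) : ℝ) ≤
          (((K + (12 * G k) ^ d) * N (G k) ^ (11 ^ d - 1) : ℕ) : ℝ) := by exact_mod_cast h1
        _ ≤ _ := by
          push_cast
          gcongr
    have h4 : Real.log (N (G (k + 1))) ≤ c / 2 * (G k : ℝ) ^ d +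
        ((11 : ℝ) ^ d - 1) * Real.log (N (G k)) := by
      have := Real.log_le_log (hNpos (k + 1)) h3
      rw [Real.log_mul (Real.exp_pos _).ne' (pow_pos (hNpos k) _).ne', Real.log_exp,
        Real.log_pow] at this
      rw [Nat.cast_sub (Nat.one_le_pow _ _ (by norm_num))] at this
      push_cast at this
      exact this
    have h5 : a (k + 1) * ((11 : ℝ) ^ d * (G k : ℝ) ^ d) = Real.log (N (G (k + 1))) := by
      simp only [a]
      rw [hG1]
      push_cast
      rw [mul_pow]
      field_simp [(hGpos k).ne']
    have h6 : a k * (G k : ℝ) ^ d = Real.log (N (G k)) := div_mul_cancel₀ _ (hGpos k).ne'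
    rw [← h5, ← h6] at h4
    have h7 : a (k + 1) * (11 : ℝ) ^ d ≤ c / 2 + ((11 : ℝ) ^ d - 1) * a k := by
      have := hGpos k
      by_contra hh
      push Not at hh
      nlinarith [mul_lt_mul_of_pos_right hh this]
    have h8 : (1 - 1 / (11 : ℝ) ^ d) * (a k - c / 2) =
        (((11 : ℝ) ^ d - 1) * (a k - c / 2)) / (11 : ℝ) ^ d := by
      field_simp
    rw [h8, le_div_iff₀ (by positivity)]
    linarith
  have hq0 : 0 ≤ 1 - 1 / (11 : ℝ) ^ d := by
    rw [sub_nonneg, div_le_one (by positivity)]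
    exact hM
  have hq1 : 1 - 1 / (11 : ℝ) ^ d < 1 := by
    have : 0 < 1 / (11 : ℝ) ^ d := by positivity
    linarith
  have hpow : ∀ k, a k - c / 2 ≤ (1 - 1 / (11 : ℝ) ^ d) ^ k * (a 0 - c / 2) := by
    intro k
    induction k with
    | zero => simp
    | succ k ih =>
      rw [pow_succ', mul_assoc]
      exact (hrec k).trans (mul_le_mul_of_nonneg_left ih hq0)
  have hlim := (tendsto_pow_atTop_nhds_zero_of_lt_one hq0 hq1).mul_const (a 0 - c / 2)
  rw [zero_mul] at hlim
  obtain ⟨k, hk⟩ := (hlim.eventually_lt_const (half_pos hc)).exists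
  have := hpow k
  have := hac k
  linarith

theorem exists_marker {d : ℕ} (hd : 1 ≤ d) {Γ : Type} [Finite Γ] {X : Set ((Fin d → ℤ) → Γ)}
    (hX : IsSFT X) (hent : PosEntropy X) (A : Type) [Finite A] : Nonempty (Marker X A) := by
  classical
  obtain ⟨F, Q, hXeq⟩ := hX
  obtain ⟨c, hc, hN⟩ := hent
  have hsh : ∀ x ∈ X, ∀ v, shiftV Γ v x ∈ X := by
    intro x hx v
    rw [hXeq] at hx ⊢
    intro w
    have := hx (w + v)
    convert this using 2
    simp only [shiftV]
    congr 1
    abel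
  let n₁ : ℕ := ∑ f ∈ F, ∑ i, (f i).natAbs
  have hn₁ : ∀ f ∈ F, ∀ i, (f i).natAbs ≤ n₁ := fun f hf i =>
    (Finset.single_le_sum (f := fun i => (f i).natAbs) (fun _ _ => Nat.zero_le _)
      (Finset.mem_univ i)).trans
      (Finset.single_le_sum (f := fun f : Fin d → ℤ => ∑ i, (f i).natAbs)
        (fun _ _ => Nat.zero_le _) hf)
  obtain ⟨g, hg1, hg0, hg⟩ := exists_scale d hd (fun n => (boxPatterns X n).ncard) c hc hN
    (Nat.card A) n₁
  obtain ⟨x, hx, hxK, hxO⟩ := exists_good hsh g (Nat.card A) hg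
  obtain ⟨φ⟩ : Nonempty (A ↪ Fillings X g x) := by
    have := Fintype.ofFinite A
    have := Fintype.ofFinite (Fillings X g x)
    apply Function.Embedding.nonempty_of_card_le
    rwa [← Nat.card_eq_fintype_card, ← Nat.card_eq_fintype_card, Nat.card_coe_set_eq]
  choose P hP hPφ using fun a => (φ a).2
  have hDmem : ∀ u : Fin d → ℤ,
      u ∈ (Fintype.piFinset fun _ => Finset.Ico (0 : ℤ) (11 * (g : ℤ))) ↔ InD g u := by
    intro u
    simp [InD, Fintype.mem_piFinset]
  have hCD : ∀ u : Fin d → ℤ, InC g u → InD g u := by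
    intro u hu i
    have := hu i
    omega
  refine ⟨{
    P := P
    D := Fintype.piFinset fun _ => Finset.Ico (0 : ℤ) (11 * (g : ℤ))
    core := {u | InC g u}
    F := F
    Q := Q
    hXeq := fun y => by rw [hXeq]; rfl
    hPX := fun a => (hP a).1
    hcore := fun u hu => (hDmem u).2 (hCD u hu)
    hS := fun a b u hu hc => by
      rw [(hP a).2 u ((hDmem u).1 hu) hc, (hP b).2 u ((hDmem u).1 hu) hc]
    hinj := fun a b h => by
      apply φ.injective
      apply Subtype.ext
      rw [← hPφ a, ← hPφ b]
      funext u
      apply h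
      rw [hDmem]
      intro i
      have := (u i).2
      dsimp only
      omega
    hno := ?_
    hF := ?_ }⟩
  · rintro a b v hv ⟨u, hu, huv⟩
    rw [hDmem] at hu
    have hv6 : ∀ i, -(6 * (g : ℤ)) < v i ∧ v i < 6 * (g : ℤ) := by
      intro i
      have h1 := hu i
      have h2 := huv i
      simp only [Pi.add_apply] at h2
      omega
    have h := hxO v hv hv6
    simp only [Overlap, Set.mem_ofPred_eq, hx, true_and] at h
    push Not at h
    obtain ⟨w, w1, w2, w3, w4, hne⟩ := h
    refine ⟨w, (hDmem _).2 w1, (hDmem _).2 w3, ?_⟩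
    rwa [(hP b).2 _ w3 w4, (hP a).2 _ w1 w2]
  · rintro t ⟨f, hf, hc⟩ f' hf'
    rw [hDmem]
    intro i
    have h1 := hn₁ f hf i
    have h2 := hn₁ f' hf' i
    have h3 := hc i
    simp only [Pi.add_apply] at h3 ⊢
    omega

end CountingPart

theorem not_solvable_a5 : ¬ Group.IsSolvable (alternatingGroup (Fin 5)) := by
  have : IsSimpleGroup (alternatingGroup (Fin 5)) := alternatingGroup.isSimpleGroup_five
  intro h
  have hc := IsSimpleGroup.comm_iff_isSolvable.2 h
  let a : alternatingGroup (Fin 5) := ⟨Equiv.swap 0 1 * Equiv.swap 1 2, by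
    rw [Equiv.Perm.mem_alternatingGroup]; decide⟩
  let b : alternatingGroup (Fin 5) := ⟨Equiv.swap 2 3 * Equiv.swap 3 4, by
    rw [Equiv.Perm.mem_alternatingGroup]; decide⟩
  have hab := hc a b
  revert hab
  decide

theorem stmt12 (d : ℕ) (hd : 1 ≤ d) (Γ : Type) [Fintype Γ] [TopologicalSpace Γ]
    [DiscreteTopology Γ] (X : Set ((Fin d → ℤ) → Γ)) (hX : IsSFT X)
    (hent : PosEntropy X) (hmin : X ⊆ closure {x | x ∈ X ∧ IsMinimalPt x}) :
    ∃ H : Subgroup (SubAut X (Set.range (shiftV Γ))), H.FG ∧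
      (¬∃ K : Subgroup H, K.FiniteIndex ∧ IsSolvable K) ∧
      ¬∃ K : Subgroup H, Nonempty (K ≃* FreeGroup (Fin 2)) := by
  have : IsSimpleGroup (alternatingGroup (Fin 5)) := alternatingGroup.isSimpleGroup_five
  obtain ⟨m⟩ := exists_marker hd hX hent (Bool × Bool × alternatingGroup (Fin 5))
  let e : Fin d → ℤ := Pi.single ⟨0, hd⟩ 1
  obtain ⟨R, y, v₀, hy, h0, hch⟩ := m.exists_recurrent hmin e
  refine m.exists_subgroup not_solvable_a5 e ?_ R y hy v₀ h0 hch
  intro a b hab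
  have := congrFun hab ⟨0, hd⟩
  simpa [e] using this
end

section
/- Let G be a group containing an element of infinite order, and let A be a finite alphabet with at least two elements. Then there is an injective group homomorphism from Aut(A^ℤ) into Aut(A^G), where Aut(A^G) is the group of homeomorphisms of the full shift A^G commuting with all translations. -/
def shiftMapZ (A : Type*) : (ℤ → A) → (ℤ → A) := fun x i => x (i + 1)

def CommCont {X : Type*} [TopologicalSpace X] (S : Set (X → X)) (f : Equiv.Perm X) : Prop :=
  Continuous ⇑f ∧ ∀ s ∈ S, ∀ x, f (s x) = s (f x)

theorem CommCont.mul {X : Type*} [TopologicalSpace X] {S : Set (X → X)}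
    {f g : Equiv.Perm X} (hf : CommCont S f) (hg : CommCont S g) : CommCont S (f * g) := by
  refine ⟨by simpa [Equiv.Perm.coe_mul] using hf.1.comp hg.1, fun s hs x => ?_⟩
  rw [Equiv.Perm.mul_apply, hg.2 s hs, hf.2 s hs, ← Equiv.Perm.mul_apply]

theorem CommCont.one {X : Type*} [TopologicalSpace X] {S : Set (X → X)} :
    CommCont S (1 : Equiv.Perm X) :=
  ⟨by simpa [Equiv.Perm.coe_one] using continuous_id, fun _ _ _ => rfl⟩

/-- The automorphism group: continuous bijections (with continuous inverse) commuting with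
every map in `S`. -/
def CAut {X : Type*} [TopologicalSpace X] (S : Set (X → X)) : Subgroup (Equiv.Perm X) where
  carrier := {f | CommCont S f ∧ CommCont S f⁻¹}
  one_mem' := ⟨CommCont.one, by rw [inv_one]; exact CommCont.one⟩
  mul_mem' := fun hf hg => ⟨hf.1.mul hg.1, by rw [mul_inv_rev]; exact hg.2.mul hf.2⟩
  inv_mem' := fun hf => ⟨hf.2, by rw [inv_inv]; exact hf.1⟩

/-- The translation by `h ∈ G` on the full shift `A^G`: `T_h(x)(k) = x(h·k)`. -/
def transMap (G A : Type*) [Group G] (h : G) : (G → A) → (G → A) := fun x k => x (h * k)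

theorem comm_shift_int {A : Type*} (f : (ℤ → A) → (ℤ → A))
    (hf : ∀ x, f (shiftMapZ A x) = shiftMapZ A (f x)) (n : ℤ) :
    ∀ (y : ℤ → A) (j : ℤ), f (fun i => y (i + n)) j = f y (j + n) := by
  induction n using Int.induction_on with
  | zero => intro y j; simp
  | succ n ih =>
    intro y j
    have h1 : (fun i : ℤ => y (i + (n + 1))) = shiftMapZ A (fun i => y (i + n)) := by
      funext i; simp only [shiftMapZ]; congr 1; ring
    rw [h1, hf]
    simp only [shiftMapZ]
    rw [ih]; congr 1; ring
  | pred n ih =>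
    intro y j
    have h1 : (fun i : ℤ => y (i + -(n : ℤ))) = shiftMapZ A (fun i => y (i + (-(n : ℤ) - 1))) := by
      funext i; simp only [shiftMapZ]; congr 1; ring
    have h2 := ih y (j - 1)
    rw [h1, hf] at h2
    simp only [shiftMapZ, sub_add_cancel] at h2
    rw [h2]; congr 1; ring

/-- Apply `f` along every left coset of the powers of `g`. -/
def cosetMap {G A : Type*} [Group G] (g : G) (f : (ℤ → A) → (ℤ → A)) : (G → A) → (G → A) :=
  fun x k => f (fun i => x (k * g ^ i)) 0

theorem cosetMap_line {G A : Type*} [Group G] (g : G) (f : (ℤ → A) → (ℤ → A))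
    (hf : ∀ x, f (shiftMapZ A x) = shiftMapZ A (f x)) (x : G → A) (k : G) :
    (fun i : ℤ => cosetMap g f x (k * g ^ i)) = f (fun i => x (k * g ^ i)) := by
  funext n
  have h := comm_shift_int f hf n (fun i => x (k * g ^ i)) 0
  rw [zero_add] at h
  rw [← h]
  simp only [cosetMap]
  congr 1
  funext i
  rw [mul_assoc, ← zpow_add, add_comm]

theorem cosetMap_comp {G A : Type*} [Group G] (g : G) (f f' : (ℤ → A) → (ℤ → A))
    (hf' : ∀ x, f' (shiftMapZ A x) = shiftMapZ A (f' x)) (x : G → A) :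
    cosetMap g f (cosetMap g f' x) = cosetMap g (fun y => f (f' y)) x := by
  funext k
  show f (fun i : ℤ => cosetMap g f' x (k * g ^ i)) 0 = f (f' _) 0
  rw [cosetMap_line g f' hf']

theorem cosetMap_id {G A : Type*} [Group G] (g : G) (x : G → A) :
    cosetMap g (fun y => y) x = x := by
  funext k
  simp [cosetMap]

theorem cosetMap_continuous {G A : Type*} [Group G] [TopologicalSpace A] (g : G)
    (f : (ℤ → A) → (ℤ → A)) (hf : Continuous f) : Continuous (cosetMap (G := G) g f) := by
  refine continuous_pi fun k => ?_
  exact (continuous_apply (0 : ℤ)).comp (hf.comp (continuous_pi fun i => continuous_apply _))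

/-- The permutation of `A^G` induced by an automorphism of `A^ℤ`. -/
def cosetPerm {G A : Type*} [Group G] [TopologicalSpace A] (g : G)
    (f : CAut {shiftMapZ A}) : Equiv.Perm (G → A) where
  toFun := cosetMap g f.1
  invFun := cosetMap g (f.1⁻¹ : Equiv.Perm (ℤ → A))
  left_inv x := by
    rw [cosetMap_comp g _ _ (f.2.1.2 _ rfl)]
    simpa using cosetMap_id g x
  right_inv x := by
    rw [cosetMap_comp g _ _ (f.2.2.2 _ rfl)]
    simpa using cosetMap_id g x

theorem stmt13 (G : Type*) [Group G] (hG : ∃ g : G, ¬IsOfFinOrder g)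
    (A : Type) [Fintype A] [TopologicalSpace A] [DiscreteTopology A]
    (hA : 2 ≤ Fintype.card A) :
    ∃ φ : CAut {shiftMapZ A} →* CAut (Set.range (transMap G A)),
      Function.Injective φ := by
  obtain ⟨g, hg⟩ := hG
  have hinj : Function.Injective (fun n : ℤ => g ^ n) :=
    injective_zpow_iff_not_isOfFinOrder.2 hg
  have key : ∀ f : (ℤ → A) → (ℤ → A), ∀ s ∈ Set.range (transMap G A), ∀ x,
      cosetMap g f (s x) = s (cosetMap g f x) := by
    rintro f _ ⟨h, rfl⟩ x
    funext k
    simp only [cosetMap, transMap, mul_assoc]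
  refine ⟨MonoidHom.mk' (fun f => ⟨cosetPerm g f,
    ⟨cosetMap_continuous g _ f.2.1.1, key _⟩, ⟨cosetMap_continuous g _ f.2.2.1, key _⟩⟩) ?_, ?_⟩
  · intro a b
    apply Subtype.ext
    apply Equiv.ext
    intro x
    exact (cosetMap_comp g a.1 b.1 (b.2.1.2 _ rfl) x).symm
  · intro a b hab
    apply Subtype.ext
    apply Equiv.ext
    intro y
    have h1 : ∀ x, cosetMap g a.1 x = cosetMap g b.1 x := fun x =>
      congrArg (fun t : CAut (Set.range (transMap G A)) => t.1 x) hab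
    let x : G → A := Function.extend (fun n : ℤ => g ^ n) y (fun _ => y 0)
    have hx : (fun i : ℤ => x (1 * g ^ i)) = y := by
      funext i
      rw [one_mul]
      exact hinj.extend_apply y _ i
    have ha := cosetMap_line g a.1 (a.2.1.2 _ rfl) x 1
    have hb := cosetMap_line g b.1 (b.2.1.2 _ rfl) x 1
    rw [hx] at ha hb
    rw [← ha, ← hb, h1]
end

section
/- Let Σ be a finite alphabet and X ⊆ Σ^ℤ an uncountable sofic shift, and let σ_X ∈ Aut(X) denote the restriction of the shift to X. The cyclic subgroup ⟨σ_X⟩ generated by σ_X is central, hence normal, in Aut(X), and for every finite alphabet A there is an injective group homomorphism from Aut(A^ℤ) into the quotient group Aut(X)/⟨σ_X⟩. -/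
/-- `X` is a sofic shift: a closed shift-invariant subset of the full shift defined by
forbidding the words of a regular language `L`. -/
def IsSoficShift {Γ : Type} [TopologicalSpace Γ] (X : Set (ℤ → Γ)) : Prop :=
  IsClosed X ∧ shiftMapZ Γ '' X = X ∧
    ∃ L : Language Γ, L.IsRegular ∧
      X = {x | ∀ (i : ℤ) (k : ℕ), ((List.range (k + 1)).map fun t => x (i + t)) ∉ L}

namespace SoficEmb

open Filter Topology

/-- The word of length `k` starting at position `i`. -/
def win {Γ : Type*} (x : ℤ → Γ) (i : ℤ) (k : ℕ) : List Γ :=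
  (List.range k).map fun t : ℕ => x (i + t)

theorem win_length {Γ : Type*} (x : ℤ → Γ) (i : ℤ) (k : ℕ) : (win x i k).length = k := by
  simp [win]

theorem win_add {Γ : Type*} (x : ℤ → Γ) (i : ℤ) (k l : ℕ) :
    win x i (k + l) = win x i k ++ win x (i + k) l := by
  simp only [win, List.range_add, List.map_append, List.map_map]
  congr 1
  apply List.map_congr_left
  intro t _
  simp only [Function.comp]
  congr 1
  push_cast
  ring

theorem win_succ {Γ : Type*} (x : ℤ → Γ) (i : ℤ) (k : ℕ) :
    win x i (k + 1) = win x i k ++ [x (i + k)] := by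
  rw [win_add]
  simp [win]

theorem win_congr {Γ : Type*} (x y : ℤ → Γ) (i i' : ℤ) (k : ℕ)
    (h : ∀ t : ℕ, t < k → x (i + t) = y (i' + t)) : win x i k = win y i' k := by
  apply List.map_congr_left
  intro t ht
  exact h t (List.mem_range.1 ht)

open Classical in
/-- Subset automaton for the words with no nonempty factor in the language of `M`. -/
noncomputable def pstep {Γ Q : Type} (M : DFA Γ Q) : Option (Set Q) → Γ → Option (Set Q)
  | none, _ => none
  | some S, c => if ∃ q ∈ insert M.start S, M.step q c ∈ M.accept then none
      else some ((fun q => M.step q c) '' (insert M.start S))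

open Classical in
theorem pstep_win {Γ Q : Type} (M : DFA Γ Q) (x : ℤ → Γ) (i : ℤ) (k : ℕ) :
    (win x i k).foldl (pstep M) (some ∅) =
      if ∃ s t : ℕ, s + (t + 1) ≤ k ∧ win x (i + s) (t + 1) ∈ M.accepts then none
      else some {q | ∃ s t : ℕ, s + (t + 1) = k ∧ q = M.eval (win x (i + s) (t + 1))} := by
  induction k with
  | zero =>
    simp [win]
  | succ k ih =>
    rw [win_succ, List.foldl_append, ih]
    by_cases hb : ∃ s t : ℕ, s + (t + 1) ≤ k ∧ win x (i + s) (t + 1) ∈ M.accepts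
    · have hb' : ∃ s t : ℕ, s + (t + 1) ≤ k + 1 ∧ win x (i + s) (t + 1) ∈ M.accepts := by
        obtain ⟨s, t, h1, h2⟩ := hb
        exact ⟨s, t, by omega, h2⟩
      rw [if_pos hb, if_pos hb']
      rfl
    · rw [if_neg hb]
      have hS : insert M.start {q | ∃ s t : ℕ, s + (t + 1) = k ∧
          q = M.eval (win x (i + s) (t + 1))} =
          {q | ∃ s t : ℕ, s + t = k ∧ q = M.eval (win x (i + s) t)} := by
        ext q
        simp only [Set.mem_insert_iff, Set.mem_ofPred_eq]
        constructor
        · rintro (h | ⟨s, t, h1, h2⟩)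
          · exact ⟨k, 0, by omega, by simpa [win] using h⟩
          · exact ⟨s, t + 1, h1, h2⟩
        · rintro ⟨s, t, h1, h2⟩
          cases t with
          | zero => left; simpa [win] using h2
          | succ t => right; exact ⟨s, t, h1, h2⟩
      have key : ∀ s t : ℕ, s + t = k →
          M.step (M.eval (win x (i + s) t)) (x (i + k)) = M.eval (win x (i + s) (t + 1)) := by
        intro s t hst
        rw [win_succ, DFA.eval_append_singleton]
        congr 2
        subst hst
        push_cast
        ring
      simp only [List.foldl_cons, List.foldl_nil, pstep]
      rw [hS]
      have e1 : (∃ q ∈ {q | ∃ s t : ℕ, s + t = k ∧ q = M.eval (win x (i + s) t)},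
          M.step q (x (i + k)) ∈ M.accept) ↔
          ∃ s t : ℕ, s + (t + 1) ≤ k + 1 ∧ win x (i + s) (t + 1) ∈ M.accepts := by
        constructor
        · rintro ⟨q, ⟨s, t, h1, rfl⟩, h2⟩
          rw [key s t h1] at h2
          exact ⟨s, t, by omega, h2⟩
        · rintro ⟨s, t, h1, h2⟩
          have h3 : s + t = k := by
            by_contra h3
            exact hb ⟨s, t, by omega, h2⟩
          refine ⟨_, ⟨s, t, h3, rfl⟩, ?_⟩
          rw [key s t h3]
          exact h2
      by_cases hc : ∃ s t : ℕ, s + (t + 1) ≤ k + 1 ∧ win x (i + s) (t + 1) ∈ M.accepts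
      · rw [if_pos hc, if_pos (e1.2 hc)]
      · rw [if_neg hc, if_neg (fun h => hc (e1.1 h))]
        congr 1
        ext q
        constructor
        · rintro ⟨_, ⟨s, t, h1, rfl⟩, rfl⟩
          exact ⟨s, t, by omega, key s t h1⟩
        · rintro ⟨s, t, h1, rfl⟩
          exact ⟨_, ⟨s, t, by omega, rfl⟩, key s t (by omega)⟩

theorem sofic_package {Γ : Type} [TopologicalSpace Γ] (X : Set (ℤ → Γ))
    (hX : IsSoficShift X) :
    ∃ (T : Type) (_ : Monoid T) (_ : Finite T) (h : List Γ → T) (P : T → Prop),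
      (∀ u v, h (u ++ v) = h u * h v) ∧
      (∀ x, x ∈ X ↔ ∀ i k, P (h (win x i k))) ∧
      (∀ x i k, P (h (win x i k)) → ∀ (i' : ℤ) (k' : ℕ), i ≤ i' → i' + k' ≤ i + k →
        P (h (win x i' k'))) := by
  classical
  obtain ⟨-, -, L, ⟨Q, hQ, M, rfl⟩, rfl⟩ := hX
  have hgood : ∀ x i k, ((win x i k).foldl (pstep M) (some ∅) ≠ none) ↔
      ¬ ∃ s t : ℕ, s + (t + 1) ≤ k ∧ win x (i + s) (t + 1) ∈ M.accepts := by
    intro x i k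
    rw [pstep_win]
    split_ifs with h <;> simp [h]
  refine ⟨(Function.End (Option (Set Q)))ᵐᵒᵖ, inferInstance, ?_,
    fun w => MulOpposite.op (fun q => w.foldl (pstep M) q),
    fun t => t.unop (some ∅) ≠ none, ?_, ?_, ?_⟩
  · have : Finite (Function.End (Option (Set Q))) :=
      inferInstanceAs (Finite (Option (Set Q) → Option (Set Q)))
    exact Finite.of_equiv _ MulOpposite.opEquiv
  · intro u v
    apply MulOpposite.unop_injective
    funext q
    exact List.foldl_append
  · intro x
    constructor
    · intro hx i k
      refine (hgood x i k).2 ?_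
      rintro ⟨s, t, -, h2⟩
      exact hx (i + s) t h2
    · intro hx i k hk
      refine (hgood x i (k + 1)).1 (hx i (k + 1)) ⟨0, k, by omega, ?_⟩
      simpa [win] using hk
  · intro x i k hP i' k' h1 h2
    refine (hgood x i' k').2 ?_
    rintro ⟨s, t, h3, h4⟩
    refine (hgood x i k).1 hP ⟨(i' - i).toNat + s, t, by omega, ?_⟩
    have : i + (((i' - i).toNat + s : ℕ) : ℤ) = i' + s := by
      push_cast
      omega
    rw [this]
    exact h4

theorem ultra_const {T : Type*} [Finite T] (U : Ultrafilter ℕ) (f : ℕ → T) :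
    ∃ t, ∀ᶠ j in (U : Filter ℕ), f j = t := by
  obtain ⟨t, ht⟩ := Ultrafilter.eq_pure_of_finite (U.map f)
  refine ⟨t, ?_⟩
  have h1 : {t} ∈ U.map f := by rw [ht]; simp
  exact h1

theorem ramsey {T : Type*} [Monoid T] [Finite T] (c : ℕ → ℕ → T)
    (hc : ∀ i j k, i ≤ j → j ≤ k → c i k = c i j * c j k) :
    ∃ i e, e * e = e ∧ ∀ J, ∃ j, J ≤ j ∧ i < j ∧ c i j = e := by
  set U : Ultrafilter ℕ := hyperfilter ℕ
  choose t ht using fun i => ultra_const U (c i)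
  obtain ⟨e, he⟩ := ultra_const U t
  have hge : ∀ J, ∀ᶠ j in (U : Filter ℕ), J ≤ j := by
    intro J
    have h1 : ∀ᶠ j in atTop, J ≤ j := eventually_ge_atTop J
    rw [← Nat.cofinite_eq_atTop] at h1
    exact hyperfilter_le_cofinite h1
  obtain ⟨i, hi⟩ := he.exists
  have hi' := ht i
  rw [hi] at hi'
  refine ⟨i, e, ?_, ?_⟩
  · obtain ⟨j, h1, h2, h3⟩ := (hi'.and (he.and (hge i))).exists
    have hj := ht j
    rw [h2] at hj
    obtain ⟨k, h4, h5, h6⟩ := (hi'.and (hj.and (hge j))).exists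
    rw [hc i j k h3 h6, h1, h5] at h4
    exact h4
  · intro J
    obtain ⟨j, h1, h2, h3⟩ := (hi'.and ((hge J).and (hge (i + 1)))).exists
    exact ⟨j, h2, h3, h1⟩

/-- The word of a one-sided sequence. -/
def nwin {Γ : Type*} (y : ℕ → Γ) (i k : ℕ) : List Γ := (List.range k).map fun t => y (i + t)

theorem nwin_add {Γ : Type*} (x : ℕ → Γ) (i : ℕ) (k l : ℕ) :
    nwin x i (k + l) = nwin x i k ++ nwin x (i + k) l := by
  simp only [nwin, List.range_add, List.map_append, List.map_map]
  congr 1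
  apply List.map_congr_left
  intro t _
  simp only [Function.comp]
  congr 1
  ring

theorem nwin_get {Γ : Type*} (y : ℕ → Γ) (i j k : ℕ) (hk : k < j) :
    (nwin y i j)[k]? = some (y (i + k)) := by
  simp [nwin, List.getElem?_range hk]

theorem periodic_of_comm {Γ : Type*} (y : ℕ → Γ) (i : ℕ) (u : List Γ) (hu : u ≠ [])
    (h : ∀ J, ∃ j, J ≤ j ∧ u ++ nwin y i j = nwin y i j ++ u) (k : ℕ) :
    some (y (i + k)) = u[k % u.length]? := by
  induction k using Nat.strong_induction_on with
  | _ k ih =>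
    have hpos : 0 < u.length := List.length_pos_iff.2 hu
    obtain ⟨j, hj, he⟩ := h (k + 1)
    have h1 : (nwin y i j ++ u)[k]? = some (y (i + k)) := by
      rw [List.getElem?_append_left (by simp [nwin]; omega)]
      exact nwin_get y i j k (by omega)
    rw [← h1, ← he]
    by_cases hk : k < u.length
    · rw [List.getElem?_append_left hk, Nat.mod_eq_of_lt hk]
    · have hk' : u.length ≤ k := by omega
      rw [List.getElem?_append_right hk', Nat.mod_eq_sub_mod hk', ← ih _ (by omega)]
      exact nwin_get y i j _ (by omega)

theorem countable_tails {Γ : Type*} [Finite Γ] {T : Type*} [Monoid T] [Finite T]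
    (h : List Γ → T) (hh : ∀ u v, h (u ++ v) = h u * h v) (P : T → Prop)
    (hcomm : ∀ e, e * e = e → P e → ∀ u v, h u = e → h v = e → u ++ v = v ++ u) :
    {y : ℕ → Γ | ∀ i k, P (h (nwin y i k))}.Countable := by
  classical
  rcases isEmpty_or_nonempty Γ with hΓ | hΓ
  · exact Set.Subsingleton.countable (fun y _ => (hΓ.false (y 0)).elim)
  let Good : T → (ℕ → Γ) → Prop := fun e z =>
    e * e = e ∧ P e ∧ ∀ J, ∃ j, J ≤ j ∧ 0 < j ∧ h (nwin z 0 j) = e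
  have huniq : ∀ e z z', Good e z → Good e z' → z = z' := by
    rintro e z z' ⟨he, hP, hz⟩ ⟨-, -, hz'⟩
    obtain ⟨j0, -, hj0, hu⟩ := hz 0
    set u := nwin z 0 j0 with hudef
    have hne : u ≠ [] := by
      rw [← List.length_pos_iff]
      simp [hudef, nwin, hj0]
    have hy : ∀ w, (∀ J, ∃ j, J ≤ j ∧ 0 < j ∧ h (nwin w 0 j) = e) →
        ∀ k, some (w (0 + k)) = u[k % u.length]? := by
      intro w hw
      apply periodic_of_comm w 0 u hne
      intro J
      obtain ⟨j, h1, h2, h3⟩ := hw J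
      exact ⟨j, h1, hcomm e he hP _ _ hu h3⟩
    funext k
    have h1 := (hy z hz k).trans (hy z' hz' k).symm
    simpa using h1
  let p : T → ℕ → Γ := fun e => if hx : ∃ z, Good e z then hx.choose else fun _ => Classical.choice hΓ
  have hp : ∀ e z, Good e z → z = p e := by
    intro e z hz
    have hx : ∃ z, Good e z := ⟨z, hz⟩
    have : p e = hx.choose := dif_pos hx
    rw [this]
    exact huniq e _ _ hz hx.choose_spec
  let F : List Γ × T → ℕ → Γ := fun q n => (q.1[n]?).getD (p q.2 (n - q.1.length))
  have hcount : Countable T := Finite.to_countable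
  refine (Set.countable_range F).mono ?_
  intro y hy
  obtain ⟨i, e, he, hj⟩ := ramsey (fun i j => h (nwin y i (j - i))) (by
    intro i j k hij hjk
    have : k - i = (j - i) + (k - j) := by omega
    rw [this, nwin_add, hh]
    congr 3
    omega)
  have hG : Good e (fun n => y (i + n)) := by
    have hw : ∀ k, nwin (fun n => y (i + n)) 0 k = nwin y i k := by
      intro k
      simp [nwin]
    refine ⟨he, ?_, ?_⟩
    · obtain ⟨j, -, -, h1⟩ := hj 0
      rw [← h1]
      exact hy _ _
    · intro J
      obtain ⟨j, h1, h2, h3⟩ := hj (J + i)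
      exact ⟨j - i, by omega, by omega, by rw [hw]; exact h3⟩
  refine ⟨(nwin y 0 i, e), ?_⟩
  funext n
  simp only [F]
  rw [← hp e _ hG]
  by_cases hn : n < i
  · rw [List.getElem?_eq_getElem (by simpa [nwin] using hn)]
    simp [nwin]
  · rw [List.getElem?_eq_none (by simpa [nwin] using hn)]
    simp [nwin]
    congr 1
    omega

theorem exists_words {Γ : Type} [Finite Γ] (X : Set (ℤ → Γ)) (hunc : ¬ X.Countable)
    {T : Type} [Monoid T] [Finite T] (h : List Γ → T) (P : T → Prop)
    (hh : ∀ u v, h (u ++ v) = h u * h v)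
    (hX : ∀ x, x ∈ X ↔ ∀ i k, P (h (win x i k))) :
    ∃ (e : T) (a b : List Γ), e * e = e ∧ P e ∧ h a = e ∧ h b = e ∧ a.length = b.length ∧ a ≠ b := by
  by_contra hcon
  have hcomm : ∀ e, e * e = e → P e → ∀ u v, h u = e → h v = e → u ++ v = v ++ u := by
    intro e he hP u v hu hv
    by_contra hne
    exact hcon ⟨e, u ++ v, v ++ u, he, hP, by rw [hh, hu, hv, he], by rw [hh, hu, hv, he],
      by simp [add_comm], hne⟩
  have h1 := countable_tails h hh P hcomm
  have hfin : Finite Tᵐᵒᵖ := Finite.of_equiv _ MulOpposite.opEquiv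
  have h2 := countable_tails (T := Tᵐᵒᵖ) (fun w => MulOpposite.op (h w.reverse))
    (by intro u v; rw [List.reverse_append, hh]; rfl) (fun t => P t.unop) (by
      intro e he hP u v hu hv
      have h3 := hcomm e.unop (by rw [← MulOpposite.unop_mul, he]) hP v.reverse u.reverse
        (by rw [← hv]; rfl) (by rw [← hu]; rfl)
      rw [← List.reverse_append, ← List.reverse_append] at h3
      exact List.reverse_injective h3)
  apply hunc
  have h4 := h1.prod h2
  refine Set.MapsTo.countable_of_injOn (f := fun x : ℤ → Γ =>
    ((fun n : ℕ => x n), (fun n : ℕ => x (-1 - n)))) ?_ ?_ h4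
  · intro x hx
    rw [hX] at hx
    refine ⟨?_, ?_⟩
    · intro i k
      have h5 := hx i k
      have : nwin (fun n : ℕ => x n) i k = win x i k := by simp [nwin, win]
      show P (h (nwin (fun n : ℕ => x n) i k))
      rw [this]
      exact h5
    · intro i k
      have h5 := hx (-i - k) k
      have : (nwin (fun n : ℕ => x (-1 - n)) i k).reverse = win x (-i - k) k := by
        apply List.ext_getElem
        · simp [nwin, win]
        · intro j hj1 hj2
          have hj : j < k := by simpa [win] using hj2
          simp [nwin, win]
          congr 1
          have : k - 1 - j = k - (1 + j) := by omega
          rw [this, Nat.cast_sub (by omega)]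
          push_cast
          ring
      show P (h (nwin (fun n : ℕ => x (-1 - n)) i k).reverse)
      rw [this]
      exact h5
  · intro x _ y _ hxy
    simp only [Prod.mk.injEq] at hxy
    funext i
    rcases le_or_gt 0 i with hi | hi
    · have := congrFun hxy.1 i.toNat
      simpa [Int.toNat_of_nonneg hi] using this
    · have := congrFun hxy.2 (-1 - i).toNat
      simpa [Int.toNat_of_nonneg (show 0 ≤ -1 - i by omega)] using this

/-- Concatenation of blocks of length `m` chosen by `g`. -/
def cfg {Γ : Type*} (m : ℤ) (bl : Bool → ℤ → Γ) (g : ℤ → Bool) (i : ℤ) : Γ :=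
  bl (g (i / m)) (i % m)

theorem cfg_mul {Γ : Type*} (m : ℤ) (bl : Bool → ℤ → Γ) (g : ℤ → Bool) (k r : ℤ)
    (h0 : 0 ≤ r) (h1 : r < m) : cfg m bl g (k * m + r) = bl (g k) r := by
  have hm : m ≠ 0 := by omega
  unfold cfg
  rw [show k * m + r = r + k * m by ring, Int.add_mul_ediv_right _ _ hm,
    Int.add_mul_emod_self_right, Int.ediv_eq_zero_of_lt h0 h1, Int.emod_eq_of_lt h0 h1, zero_add]

theorem cfg_shift {Γ : Type*} (m : ℤ) (hm : 0 < m) (bl : Bool → ℤ → Γ) (g : ℤ → Bool) (k j : ℤ) :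
    cfg m bl g (k * m + j) = cfg m bl (fun q => g (k + q)) j := by
  unfold cfg
  rw [show k * m + j = j + k * m by ring, Int.add_mul_ediv_right _ _ hm.ne',
    Int.add_mul_emod_self_right, add_comm]

/-- The replacement property of the set `X` with respect to the block family. -/
def Replaceable {Γ : Type*} (X : Set (ℤ → Γ)) (m : ℤ) (bl : Bool → ℤ → Γ) : Prop :=
  ∀ (l : ℕ) (I : Set ℤ), 0 < l → (∀ p ∈ I, ∀ q ∈ I, p < q → p + l * m ≤ q) →
    ∀ x ∈ X, ∀ x' : ℤ → Γ,
      (∀ p ∈ I, ∃ g, ∀ j, 0 ≤ j → j < l * m → x (p + j) = cfg m bl g j) →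
      (∀ p ∈ I, ∃ g, ∀ j, 0 ≤ j → j < l * m → x' (p + j) = cfg m bl g j) →
      (∀ j, (¬ ∃ p ∈ I, p ≤ j ∧ j < p + l * m) → x' j = x j) → x' ∈ X

theorem h_blocks {Γ T : Type*} [Monoid T] (h : List Γ → T)
    (hh : ∀ u v, h (u ++ v) = h u * h v) (e : T) (he : e * e = e) (m : ℕ) (hm : 0 < m)
    (bl : Bool → ℤ → Γ) (hbl : ∀ s, h (win (bl s) 0 m) = e) (l : ℕ) (hl : 0 < l)
    (x : ℤ → Γ) (p : ℤ) (g : ℤ → Bool)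
    (hx : ∀ j, 0 ≤ j → j < l * (m : ℤ) → x (p + j) = cfg m bl g j) :
    h (win x p (l * m)) = e := by
  induction l with
  | zero => omega
  | succ l ih =>
    have hmZ : (0 : ℤ) < m := by exact_mod_cast hm
    have hlast : h (win x (p + (l * m : ℕ)) m) = e := by
      rw [← hbl (g l)]
      congr 1
      apply win_congr
      intro t ht
      have htZ : (t : ℤ) < m := by exact_mod_cast ht
      have h1 := hx ((l : ℤ) * m + t) (by positivity) (by push_cast; linarith)
      rw [cfg_mul _ _ _ _ _ (by positivity) htZ] at h1
      rw [zero_add, ← h1]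
      congr 1
      push_cast
      ring
    rw [Nat.succ_mul, win_add, hh, hlast]
    rcases Nat.eq_zero_or_pos l with h0 | h0
    · subst h0
      have h2 := hh [] (win x (p + ((0 * m : ℕ) : ℤ)) m)
      rw [List.nil_append, hlast] at h2
      simpa [win] using h2.symm
    · rw [ih h0 (fun j h1 h2 => hx j h1 (by push_cast; linarith)), he]

theorem exists_blocks {Γ : Type} [Fintype Γ] [TopologicalSpace Γ] (X : Set (ℤ → Γ))
    (hX : IsSoficShift X) (hunc : ¬ X.Countable) :
    ∃ (m : ℤ) (bl : Bool → ℤ → Γ) (d : ℤ), 0 < m ∧ 0 ≤ d ∧ d < m ∧ bl false d ≠ bl true d ∧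
      (∀ r, 0 ≤ r → r < d → bl false r = bl true r) ∧
      (∀ g, cfg m bl g ∈ X) ∧ Replaceable X m bl := by
  classical
  obtain ⟨T, _, _, h, P, hh, hP, hfac⟩ := sofic_package X hX
  obtain ⟨e, a, b, he, hPe, ha, hb, hlen, hab⟩ := exists_words X hunc h P hh hP
  have hne : X.Nonempty := by
    by_contra hne
    rw [Set.not_nonempty_iff_eq_empty] at hne
    exact hunc (hne ▸ Set.countable_empty)
  obtain ⟨x0, hx0⟩ := hne
  set m := a.length with hm
  let bl : Bool → ℤ → Γ := fun s j => (if s then b else a).getD j.toNat (x0 0)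
  have hblw : ∀ s, win (bl s) 0 m = if s then b else a := by
    intro s
    apply List.ext_getElem
    · cases s <;> simp [win] <;> omega
    · intro j h1 h2
      simp only [win, bl, List.getElem_map, List.getElem_range, zero_add, Int.toNat_natCast]
      rw [List.getD_eq_getElem _ _ h2]
  have hbl : ∀ s, h (win (bl s) 0 m) = e := by
    intro s
    rw [hblw]
    cases s <;> simp [ha, hb]
  have hex : ∃ d : ℕ, bl false d ≠ bl true d := by
    by_contra hcon
    push Not at hcon
    apply hab
    have h1 := hblw false
    have h2 := hblw true
    simp only [Bool.false_eq_true, if_false, if_true] at h1 h2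
    rw [← h1, ← h2]
    apply win_congr
    intro t _
    rw [zero_add]
    exact hcon t
  have hd := Nat.find_spec hex
  have hmin := fun r => Nat.find_min hex (m := r)
  set d := Nat.find hex
  have hdm : d < m := by
    by_contra hcon
    apply hd
    simp only [bl, Bool.false_eq_true, if_false, if_true, Int.toNat_natCast]
    rw [List.getD_eq_default _ _ (by omega), List.getD_eq_default _ _ (by omega)]
  have hm0 : 0 < m := by omega
  have hmZ : (0 : ℤ) < m := by exact_mod_cast hm0
  refine ⟨m, bl, d, hmZ, by positivity, by exact_mod_cast hdm, hd, ?_, ?_, ?_⟩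
  · intro r h0 h1
    have h2 := hmin r.toNat (by omega)
    rw [Int.toNat_of_nonneg h0] at h2
    exact not_not.1 h2
  · intro g
    rw [hP]
    intro i k
    have hq : (m : ℤ) * (i / m) + i % m = i := Int.mul_ediv_add_emod i m
    have hr0 := Int.emod_nonneg i hmZ.ne'
    have hr1 := Int.emod_lt_of_pos i hmZ
    have h1 := h_blocks h hh e he m hm0 bl hbl (k + 1) (by omega) (cfg m bl g) ((i / m) * m)
      (fun q => g (i / m + q)) (fun j _ _ => cfg_shift _ hmZ _ _ _ _)
    apply hfac (cfg m bl g) ((i / m) * m) ((k + 1) * m)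
    · rw [h1]
      exact hPe
    · nlinarith
    · push_cast
      nlinarith
  · intro l I hl hsep x hx x' hxI hx'I hout
    set len : ℤ := l * m with hlenZ
    have hlenpos : 0 < len := by positivity
    let U : ℤ → Prop := fun c => ∀ p ∈ I, ¬ (p < c ∧ c < p + len)
    have key : ∀ k : ℕ, ∀ s, U s → U (s + k) → h (win x s k) = h (win x' s k) := by
      intro k
      induction k using Nat.strong_induction_on with
      | _ k ih =>
        intro s hs hk
        rcases Nat.eq_zero_or_pos k with h0 | h0
        · subst h0
          simp [win]
        by_cases hp : ∃ p ∈ I, p ≤ s + k - 1 ∧ s + k - 1 < p + len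
        · obtain ⟨p, hpI, hp1, hp2⟩ := hp
          have h1 := hk p hpI
          have h2 := hs p hpI
          have h3 : s + k = p + len := by omega
          have h4 : s ≤ p := by omega
          have h5 : U p := by
            intro q hq h6
            have := hsep q hq p hpI h6.1
            omega
          obtain ⟨k', hk'⟩ := Int.eq_ofNat_of_zero_le (show 0 ≤ p - s by omega)
          have hkk : k = k' + l * m := by
            have : (k : ℤ) = k' + l * m := by omega
            exact_mod_cast this
          have hlm : 0 < l * m := Nat.mul_pos hl hm0
          have hps : p = s + k' := by omega
          obtain ⟨g, hg⟩ := hxI p hpI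
          obtain ⟨g', hg'⟩ := hx'I p hpI
          rw [hkk, win_add, win_add, hh, hh, ih k' (by omega) s hs (by rw [← hps]; exact h5),
            ← hps, h_blocks h hh e he m hm0 bl hbl l hl x p g hg,
            h_blocks h hh e he m hm0 bl hbl l hl x' p g' hg']
        · obtain ⟨k', rfl⟩ : ∃ k', k = k' + 1 := ⟨k - 1, by omega⟩
          have h1 : s + ((k' + 1 : ℕ) : ℤ) - 1 = s + k' := by push_cast; ring
          rw [h1] at hp
          have h2 : U (s + k') := by
            intro q hq h6
            exact hp ⟨q, hq, by omega, by omega⟩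
          rw [win_succ, win_succ, hh, hh, ih k' (by omega) s hs h2, hout _ hp]
    rw [hP]
    intro i k
    obtain ⟨s, hs, hsi⟩ : ∃ s, U s ∧ s ≤ i := by
      by_cases hc : ∃ p ∈ I, p < i ∧ i < p + len
      · obtain ⟨p, hpI, h1, h2⟩ := hc
        refine ⟨p, ?_, h1.le⟩
        intro q hq h6
        have := hsep q hq p hpI h6.1
        omega
      · refine ⟨i, ?_, le_rfl⟩
        intro q hq h6
        exact hc ⟨q, hq, h6⟩
    obtain ⟨t, ht, hti⟩ : ∃ t, U t ∧ i + k ≤ t := by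
      by_cases hc : ∃ p ∈ I, p < i + k ∧ i + k < p + len
      · obtain ⟨p, hpI, h1, h2⟩ := hc
        refine ⟨p + len, ?_, h2.le⟩
        intro q hq h6
        rcases lt_trichotomy q p with h7 | h7 | h7
        · have := hsep q hq p hpI h7
          omega
        · omega
        · have := hsep p hpI q hq h7
          omega
      · refine ⟨i + k, ?_, le_rfl⟩
        intro q hq h6
        exact hc ⟨q, hq, h6⟩
    obtain ⟨n, hn⟩ := Int.eq_ofNat_of_zero_le (show 0 ≤ t - s by omega)
    have htn : t = s + n := by omega
    have h1 := key n s hs (htn ▸ ht)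
    apply hfac x' s n
    · rw [← h1]
      exact (hP x).1 hx s n
    · exact hsi
    · omega

/-- Parameters of the construction. -/
structure Par (Γ B : Type) where
  m : ℤ
  d : ℤ
  bl : Bool → ℤ → Γ
  hm : 0 < m
  hd0 : 0 ≤ d
  hdm : d < m
  hne : bl false d ≠ bl true d
  heq : ∀ r, 0 ≤ r → r < d → bl false r = bl true r
  N : ℕ
  enc : B → ℕ
  henc : ∀ c, enc c < N
  hinj : Function.Injective enc

namespace Par

variable {Γ B : Type} (S : Par Γ B)

/-- Total size of the varying part, up to the factor three. -/
def M : ℤ := S.N * S.m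

/-- Length of the data words. -/
def n : ℤ := 3 * S.M + 30 * S.m

theorem M_nonneg : 0 ≤ S.M := mul_nonneg (by positivity) S.hm.le

/-- Block pattern of the data word with data `c`. -/
def gw (c : B) (k : ℤ) : Bool := decide (10 ≤ k ∧ (k % 3 = 1 ∨ k = 14 + 3 * S.enc c))

/-- The data word with data `c`. -/
def w (c : B) (j : ℤ) : Γ := cfg S.m S.bl (S.gw c) j

/-- The data word with data `c` occurs at `i`. -/
def occ (x : ℤ → Γ) (i : ℤ) (c : B) : Prop := ∀ j, 0 ≤ j → j < S.n → x (i + j) = S.w c j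

theorem w_mul (c : B) (k r : ℤ) (h0 : 0 ≤ r) (h1 : r < S.m) :
    S.w c (k * S.m + r) = S.bl (S.gw c k) r := cfg_mul _ _ _ _ _ h0 h1

theorem decomp (j : ℤ) : ∃ k r, j = k * S.m + r ∧ 0 ≤ r ∧ r < S.m :=
  ⟨j / S.m, j % S.m, (Int.ediv_mul_add_emod j S.m).symm, Int.emod_nonneg j S.hm.ne',
    Int.emod_lt_of_pos j S.hm⟩

theorem w_per (c : B) (q : ℤ) (h1 : q < 9 * S.m + S.d) : S.w c q = S.w c (q + S.m) := by
  obtain ⟨k, r, rfl, hr0, hr1⟩ := S.decomp q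
  have hm := S.hm
  have hdm := S.hdm
  rw [show k * S.m + r + S.m = (k + 1) * S.m + r by ring, S.w_mul _ _ _ hr0 hr1,
    S.w_mul _ _ _ hr0 hr1]
  have hk : k < 10 := by
    by_contra hk
    have : 10 * S.m ≤ k * S.m := mul_le_mul_of_nonneg_right (by omega) hm.le
    omega
  have e1 : S.gw c k = false := by
    simp only [gw, decide_eq_false_iff_not]
    omega
  rw [e1]
  rcases (show k < 9 ∨ k = 9 by omega) with hk9 | hk9
  · have e2 : S.gw c (k + 1) = false := by
      simp only [gw, decide_eq_false_iff_not]
      omega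
    rw [e2]
  · have e2 : S.gw c (k + 1) = true := by
      simp only [gw, decide_eq_true_eq]
      omega
    rw [e2]
    apply S.heq r hr0
    subst hk9
    omega

theorem w_mis (c : B) (k : ℤ) (hk : k = 9 ∨ (10 ≤ k ∧ k % 3 = 0)) :
    S.w c (k * S.m + S.d) ≠ S.w c (k * S.m + S.d + S.m) := by
  rw [show k * S.m + S.d + S.m = (k + 1) * S.m + S.d by ring, S.w_mul _ _ _ S.hd0 S.hdm,
    S.w_mul _ _ _ S.hd0 S.hdm]
  have e1 : S.gw c k = false := by
    simp only [gw, decide_eq_false_iff_not]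
    omega
  have e2 : S.gw c (k + 1) = true := by
    simp only [gw, decide_eq_true_eq]
    omega
  rw [e1, e2]
  exact S.hne

theorem occ_sep {x : ℤ → Γ} {i i' : ℤ} {c c' : B} (h : S.occ x i c) (h' : S.occ x i' c')
    (hlt : i < i') : i + S.n - 8 * S.m ≤ i' := by
  by_contra hcon
  have hm := S.hm
  have hdm := S.hdm
  have hd0 := S.hd0
  have hM := S.M_nonneg
  have hn : S.n = 3 * S.M + 30 * S.m := rfl
  -- a mismatch at `q` inside the first word is impossible early in the second
  have main : ∀ q, 0 ≤ q → q + S.m < S.n → S.w c q ≠ S.w c (q + S.m) → 0 ≤ i + q - i' →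
      i + q - i' + S.m < S.n → i + q - i' < 9 * S.m + S.d → False := by
    intro q h0 h1 h2 h3 h4 h5
    apply h2
    rw [← h q h0 (by omega), ← h (q + S.m) (by omega) h1]
    have e1 := h' (i + q - i') h3 (by omega)
    have e2 := h' (i + q - i' + S.m) (by omega) h4
    rw [show i' + (i + q - i') = i + q by ring] at e1
    rw [show i' + (i + q - i' + S.m) = i + (q + S.m) by ring] at e2
    rw [e1, e2]
    exact S.w_per c' _ h5
  rcases le_or_gt (i' - i) (9 * S.m + S.d) with hj | hj
  · exact main (9 * S.m + S.d) (by omega) (by omega) (S.w_mis c 9 (Or.inl rfl)) (by omega)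
      (by omega) (by omega)
  · obtain ⟨k0, r, hk0, hr0, hr1⟩ := S.decomp (i' - i)
    have hk9 : 9 ≤ k0 := by
      by_contra hk
      have : k0 * S.m ≤ 8 * S.m := mul_le_mul_of_nonneg_right (by omega) hm.le
      omega
    obtain ⟨k, hk1, hk2, hk3⟩ : ∃ k, k0 + 1 ≤ k ∧ k ≤ k0 + 3 ∧ k % 3 = 0 :=
      ⟨k0 + 3 - k0 % 3, by omega, by omega, by omega⟩
    have hu : k * S.m ≤ (k0 + 3) * S.m := mul_le_mul_of_nonneg_right hk2 hm.le
    have hl : (k0 + 1) * S.m ≤ k * S.m := mul_le_mul_of_nonneg_right hk1 hm.le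
    rw [add_mul] at hu hl
    exact main (k * S.m + S.d) (by omega) (by omega) (S.w_mis c k (Or.inr ⟨by omega, hk3⟩))
      (by omega) (by omega) (by omega)

theorem occ_sep' {x : ℤ → Γ} {i i' : ℤ} {c c' : B} (h : S.occ x i c) (h' : S.occ x i' c')
    (h1 : i' < i + S.n - 8 * S.m) (h2 : i < i' + S.n - 8 * S.m) : i = i' := by
  rcases lt_trichotomy i i' with h3 | h3 | h3
  · have := S.occ_sep h h' h3
    omega
  · exact h3
  · have := S.occ_sep h' h h3
    omega

theorem enc_bound (c : B) : ((S.enc c : ℤ) + 1) * S.m ≤ S.M :=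
  mul_le_mul_of_nonneg_right (by have := S.henc c; omega) S.hm.le

theorem occ_unique {x : ℤ → Γ} {i : ℤ} {c c' : B} (h : S.occ x i c) (h' : S.occ x i c') :
    c = c' := by
  have hm := S.hm
  have hdm := S.hdm
  have hd0 := S.hd0
  have hb := S.enc_bound c
  have hn : S.n = 3 * S.M + 30 * S.m := rfl
  rw [add_mul] at hb
  have hpos : 0 ≤ (S.enc c : ℤ) * S.m := by positivity
  have e0 : (14 + 3 * (S.enc c : ℤ)) * S.m + S.d = 14 * S.m + 3 * (S.enc c * S.m) + S.d := by ring
  have e1 := h ((14 + 3 * (S.enc c : ℤ)) * S.m + S.d) (by omega) (by omega)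
  have e2 := h' ((14 + 3 * (S.enc c : ℤ)) * S.m + S.d) (by omega) (by omega)
  rw [e1, S.w_mul _ _ _ hd0 hdm, S.w_mul _ _ _ hd0 hdm] at e2
  have g1 : S.gw c (14 + 3 * (S.enc c : ℤ)) = true := by
    simp only [gw, decide_eq_true_eq]
    exact ⟨by omega, Or.inr trivial⟩
  rw [g1] at e2
  have g2 : S.gw c' (14 + 3 * (S.enc c : ℤ)) = true := by
    by_contra hcon
    rw [Bool.not_eq_true] at hcon
    rw [hcon] at e2
    exact S.hne e2.symm
  simp only [gw, decide_eq_true_eq] at g2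
  apply S.hinj
  omega

/-- Outside of the core, the data words agree. -/
theorem w_common (c c' : B) (j : ℤ) (h : j < 14 * S.m ∨ 14 * S.m + 3 * S.M ≤ j) :
    S.w c j = S.w c' j := by
  obtain ⟨k, r, rfl, hr0, hr1⟩ := S.decomp j
  rw [S.w_mul _ _ _ hr0 hr1, S.w_mul _ _ _ hr0 hr1]
  have hm := S.hm
  have hg : ∀ c, k ≠ 14 + 3 * (S.enc c : ℤ) := by
    intro c hk
    have hb := S.enc_bound c
    rw [add_mul] at hb
    have hpos : 0 ≤ (S.enc c : ℤ) * S.m := by positivity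
    have : k * S.m = 14 * S.m + 3 * (S.enc c * S.m) := by rw [hk]; ring
    omega
  have : S.gw c k = S.gw c' k := by
    simp only [gw, hg c, hg c']
  rw [this]

open Classical in
/-- The track of data read from `x`. -/
noncomputable def v (x : ℤ → Γ) (i : ℤ) : Option B :=
  if h : ∃ c, S.occ x i c then some h.choose else none

theorem v_eq_some {x : ℤ → Γ} {i : ℤ} {c : B} : S.v x i = some c ↔ S.occ x i c := by
  unfold v
  split_ifs with h
  · constructor
    · intro h1
      rw [← Option.some.inj h1]
      exact h.choose_spec
    · intro h1
      rw [S.occ_unique h1 h.choose_spec]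
  · simp only [false_iff]
    exact fun h1 => h ⟨c, h1⟩

theorem v_sep {x : ℤ → Γ} {i i' : ℤ} (h : (S.v x i).isSome) (h' : (S.v x i').isSome)
    (h1 : i' < i + S.n - 8 * S.m) (h2 : i < i' + S.n - 8 * S.m) : i = i' := by
  obtain ⟨c, hc⟩ := Option.isSome_iff_exists.1 h
  obtain ⟨c', hc'⟩ := Option.isSome_iff_exists.1 h'
  exact S.occ_sep' (S.v_eq_some.1 hc) (S.v_eq_some.1 hc') h1 h2

/-- `j` lies in the core of the data word at `i`. -/
def core (i j : ℤ) : Prop := i + 14 * S.m ≤ j ∧ j < i + 14 * S.m + 3 * S.M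

open Classical in
/-- Replace the data track of `x` by `u`. -/
noncomputable def put (x : ℤ → Γ) (u : ℤ → Option B) (j : ℤ) : Γ :=
  if h : ∃ p : ℤ × B, S.core p.1 j ∧ u p.1 = some p.2 then S.w h.choose.2 (j - h.choose.1) else x j

/-- `u` has the same support as the track of `x`. -/
def Compat (x : ℤ → Γ) (u : ℤ → Option B) : Prop := ∀ i, (u i).isSome = (S.v x i).isSome

theorem put_of_core {x : ℤ → Γ} {u : ℤ → Option B} (hu : S.Compat x u) {i j : ℤ} {c : B}
    (hc : S.core i j) (hi : u i = some c) : S.put x u j = S.w c (j - i) := by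
  have h : ∃ p : ℤ × B, S.core p.1 j ∧ u p.1 = some p.2 := ⟨(i, c), hc, hi⟩
  unfold put
  rw [dif_pos h]
  obtain ⟨h1, h2⟩ := h.choose_spec
  generalize h.choose = p at h1 h2 ⊢
  obtain ⟨i', c'⟩ := p
  simp only at h1 h2 ⊢
  have hm := S.hm
  have hn : S.n = 3 * S.M + 30 * S.m := rfl
  have h3 : i' = i := by
    unfold core at h1 hc
    refine S.v_sep (x := x) ?_ ?_ (by omega) (by omega)
    · rw [← hu, h2]; rfl
    · rw [← hu, hi]; rfl
  rw [h3] at h2 ⊢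
  rw [hi] at h2
  rw [Option.some.inj h2]

theorem put_of_not {x : ℤ → Γ} {u : ℤ → Option B} {j : ℤ}
    (h : ∀ i, S.core i j → u i = none) : S.put x u j = x j := by
  unfold put
  rw [dif_neg]
  rintro ⟨p, h1, h2⟩
  rw [h p.1 h1] at h2
  cases h2

theorem put_cases (u : ℤ → Option B) (j : ℤ) :
    (∃ i c, S.core i j ∧ u i = some c) ∨ (∀ i, S.core i j → u i = none) := by
  by_cases h : ∃ i c, S.core i j ∧ u i = some c
  · exact Or.inl h
  · right
    intro i hi
    cases hu : u i with
    | none => rfl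
    | some c => exact (h ⟨i, c, hi, hu⟩).elim

theorem v_put_some {x : ℤ → Γ} {u : ℤ → Option B} (hu : S.Compat x u) {i : ℤ} {c : B}
    (hi : u i = some c) : S.occ (S.put x u) i c := by
  intro j hj0 hj1
  have hm := S.hm
  have hM := S.M_nonneg
  have hn : S.n = 3 * S.M + 30 * S.m := rfl
  have hsi : (S.v x i).isSome := by rw [← hu, hi]; rfl
  rcases S.put_cases u (i + j) with ⟨i', c', h1, h2⟩ | h
  · rw [S.put_of_core hu h1 h2]
    have h3 : i' = i := by
      unfold core at h1
      refine S.v_sep (x := x) ?_ hsi (by omega) (by omega)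
      rw [← hu, h2]; rfl
    subst h3
    rw [h2] at hi
    rw [Option.some.inj hi]
    congr 1
    ring
  · rw [S.put_of_not h]
    obtain ⟨c0, hc0⟩ := Option.isSome_iff_exists.1 hsi
    rw [S.v_eq_some.1 hc0 j hj0 hj1]
    apply S.w_common
    by_contra hcon
    have := h i (by unfold core; omega)
    rw [this] at hi
    cases hi

theorem v_put {x : ℤ → Γ} {u : ℤ → Option B} (hu : S.Compat x u) : S.v (S.put x u) = u := by
  funext i
  have hm := S.hm
  have hM := S.M_nonneg
  have hn : S.n = 3 * S.M + 30 * S.m := rfl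
  cases hi : u i with
  | some c => exact S.v_eq_some.2 (S.v_put_some hu hi)
  | none =>
    cases hv : S.v (S.put x u) i with
    | none => rfl
    | some c =>
      exfalso
      rw [S.v_eq_some] at hv
      have : S.occ x i c := by
        intro j hj0 hj1
        rw [← hv j hj0 hj1]
        rcases S.put_cases u (i + j) with ⟨i', c', h1, h2⟩ | h
        · exfalso
          have h3 : i' = i := by
            unfold core at h1
            exact S.occ_sep' (S.v_put_some hu h2) hv (by omega) (by omega)
          rw [h3, hi] at h2
          cases h2
        · exact (S.put_of_not h).symm
      rw [← S.v_eq_some] at this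
      have h4 := hu i
      rw [this, hi] at h4
      cases h4

theorem put_put {x : ℤ → Γ} {u u' : ℤ → Option B} (hu : S.Compat x u) (hu' : S.Compat x u') :
    S.put (S.put x u) u' = S.put x u' := by
  have h2 : S.Compat (S.put x u) u' := by
    intro i
    rw [S.v_put hu, hu i, hu' i]
  funext j
  rcases S.put_cases u' j with ⟨i, c, h1, h3⟩ | h
  · rw [S.put_of_core h2 h1 h3, S.put_of_core hu' h1 h3]
  · rw [S.put_of_not h, S.put_of_not h, S.put_of_not]
    intro i hi
    have h5 := hu i
    rw [← hu' i, h i hi] at h5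
    simpa using h5

theorem put_self (x : ℤ → Γ) : S.put x (S.v x) = x := by
  funext j
  have hm := S.hm
  have hM := S.M_nonneg
  have hn : S.n = 3 * S.M + 30 * S.m := rfl
  rcases S.put_cases (S.v x) j with ⟨i, c, h1, h3⟩ | h
  · rw [S.put_of_core (fun _ => rfl) h1 h3]
    unfold core at h1
    rw [← S.v_eq_some.1 h3 (j - i) (by omega) (by omega)]
    congr 1
    ring
  · exact S.put_of_not h

theorem put_mem {X : Set (ℤ → Γ)} (hN : 0 < S.N) (hX : Replaceable X S.m S.bl) {x : ℤ → Γ}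
    (hx : x ∈ X) {u : ℤ → Option B} (hu : S.Compat x u) : S.put x u ∈ X := by
  have hm := S.hm
  have hM := S.M_nonneg
  have hn : S.n = 3 * S.M + 30 * S.m := rfl
  have hl : ((3 * S.N : ℕ) : ℤ) * S.m = 3 * S.M := by
    unfold M
    push_cast
    ring
  have shape : ∀ z i, (S.v z i).isSome → ∃ g, ∀ j, 0 ≤ j → j < 3 * S.M →
      z (i + 14 * S.m + j) = cfg S.m S.bl g j := by
    intro z i hz
    obtain ⟨c, hc⟩ := Option.isSome_iff_exists.1 hz
    refine ⟨fun q => S.gw c (14 + q), fun j h0 h1 => ?_⟩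
    rw [← cfg_shift _ hm, add_assoc]
    exact S.v_eq_some.1 hc (14 * S.m + j) (by omega) (by omega)
  refine hX (3 * S.N) {p | (S.v x (p - 14 * S.m)).isSome} (by omega) ?_ x hx _ ?_ ?_ ?_
  · intro p hp q hq hpq
    rw [hl]
    by_contra hcon
    have := S.v_sep hp hq (by omega) (by omega)
    omega
  · intro p hp
    rw [hl]
    obtain ⟨g, hg⟩ := shape x _ hp
    refine ⟨g, fun j h0 h1 => ?_⟩
    rw [← hg j h0 h1]
    congr 1
    ring
  · intro p hp
    rw [hl]
    obtain ⟨g, hg⟩ := shape (S.put x u) (p - 14 * S.m) (by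
      rw [S.v_put hu, hu]
      exact hp)
    refine ⟨g, fun j h0 h1 => ?_⟩
    rw [← hg j h0 h1]
    congr 1
    ring
  · intro j hj
    rw [hl] at hj
    apply S.put_of_not
    intro i hi
    by_contra hne
    apply hj
    unfold core at hi
    refine ⟨i + 14 * S.m, ?_, by omega, by omega⟩
    show (S.v x (i + 14 * S.m - 14 * S.m)).isSome
    rw [add_sub_cancel_right, ← hu]
    exact Option.isSome_iff_ne_none.2 hne

/-! Shift equivariance -/

theorem v_shift (x : ℤ → Γ) (i : ℤ) : S.v (fun j => x (j + 1)) i = S.v x (i + 1) := by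
  apply Option.ext
  intro c
  rw [S.v_eq_some, S.v_eq_some]
  unfold occ
  have : ∀ j, i + j + 1 = i + 1 + j := fun j => by ring
  simp only [this]

theorem put_shift {x : ℤ → Γ} {u : ℤ → Option B} (hu : S.Compat x u) (j : ℤ) :
    S.put (fun j => x (j + 1)) (fun j => u (j + 1)) j = S.put x u (j + 1) := by
  have hu' : S.Compat (fun j => x (j + 1)) (fun j => u (j + 1)) := by
    intro i
    rw [S.v_shift]
    exact hu (i + 1)
  rcases S.put_cases u (j + 1) with ⟨i, c, h1, h3⟩ | h
  · rw [S.put_of_core hu h1 h3,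
      S.put_of_core (i := i - 1) (c := c) hu' (by unfold core at h1 ⊢; omega) (by
        show u (i - 1 + 1) = some c
        rw [sub_add_cancel]
        exact h3)]
    congr 1
    ring
  · rw [S.put_of_not h, S.put_of_not]
    intro i hi
    exact h (i + 1) (by unfold core at hi ⊢; omega)

/-! Continuity -/

theorem eval_ev {Γ : Type} [TopologicalSpace Γ] [DiscreteTopology Γ] (x : ℤ → Γ) (j : ℤ) :
    ∀ᶠ y in 𝓝 x, y j = x j := by
  have h : IsOpen ((fun y : ℤ → Γ => y j) ⁻¹' {x j}) :=
    (isOpen_discrete {x j}).preimage (continuous_apply j)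
  exact h.mem_nhds (Set.mem_singleton (x j))

theorem v_loc [TopologicalSpace Γ] [DiscreteTopology Γ] (i : ℤ) :
    IsLocallyConstant (fun x : ℤ → Γ => S.v x i) := by
  rw [IsLocallyConstant.iff_eventually_eq]
  intro x
  have h1 : ∀ᶠ y in 𝓝 x, ∀ j ∈ Set.Ico (0 : ℤ) S.n, y (i + j) = x (i + j) := by
    rw [eventually_all_finite (Set.finite_Ico _ _)]
    intro j _
    exact eval_ev x (i + j)
  filter_upwards [h1] with y hy
  apply Option.ext
  intro c
  rw [S.v_eq_some, S.v_eq_some]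
  unfold occ
  constructor
  · intro h j h0 h1
    rw [← hy j ⟨h0, h1⟩]
    exact h j h0 h1
  · intro h j h0 h1
    rw [hy j ⟨h0, h1⟩]
    exact h j h0 h1

theorem put_cont [TopologicalSpace Γ] [DiscreteTopology Γ] (F : (ℤ → Γ) → ℤ → Option B)
    (hF : ∀ x, S.Compat x (F x)) (hl : ∀ i, IsLocallyConstant (fun x => F x i)) :
    Continuous (fun x => S.put x (F x)) := by
  refine continuous_pi fun j => IsLocallyConstant.continuous ?_
  rw [IsLocallyConstant.iff_eventually_eq]
  intro x
  have hx : ∀ᶠ y in 𝓝 x, y j = x j := eval_ev x j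
  have h1 : ∀ᶠ y in 𝓝 x, ∀ i ∈ Set.Icc (j - 14 * S.m - 3 * S.M) (j - 14 * S.m), F y i = F x i := by
    rw [eventually_all_finite (Set.finite_Icc _ _)]
    intro i _
    exact (IsLocallyConstant.iff_eventually_eq _).1 (hl i) x
  filter_upwards [hx, h1] with y hy1 hy2
  have hy3 : ∀ i, S.core i j → F y i = F x i := by
    intro i hi
    unfold core at hi
    exact hy2 i ⟨by omega, by omega⟩
  rcases S.put_cases (F x) j with ⟨i, c, h1, h3⟩ | h
  · rw [S.put_of_core (hF x) h1 h3, S.put_of_core (hF y) h1 ((hy3 i h1).trans h3)]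
  · rw [S.put_of_not h, S.put_of_not (fun i hi => (hy3 i hi).trans (h i hi)), hy1]

end Par

/-! Conveyor belts -/

/-- The successor permutation on the belts, where `q i` says that the cells at `i` and `i + n`
are linked. -/
def tau (n : ℤ) (q : ℤ → Bool) : Equiv.Perm (ℤ × Bool) where
  toFun z := if z.2 then (if q z.1 then (z.1 + n, true) else (z.1, false))
    else (if q (z.1 - n) then (z.1 - n, false) else (z.1, true))
  invFun z := if z.2 then (if q (z.1 - n) then (z.1 - n, true) else (z.1, false))
    else (if q z.1 then (z.1 + n, false) else (z.1, true))
  left_inv := by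
    rintro ⟨i, s⟩
    cases s
    · by_cases h : q (i - n) <;> simp [h]
    · by_cases h : q i <;> simp [h]
  right_inv := by
    rintro ⟨i, s⟩
    cases s
    · by_cases h : q i <;> simp [h]
    · by_cases h : q (i - n) <;> simp [h]

/-- Links of a track. -/
def link {B : Type} (n : ℤ) (u : ℤ → Option B) (i : ℤ) : Bool :=
  (u i).isSome && (u (i + n)).isSome

/-- Data at a belt cell. -/
def dat {A : Type} [Inhabited A] (u : ℤ → Option (A × A)) (z : ℤ × Bool) : A :=
  match u z.1 with
  | none => default
  | some c => if z.2 then c.1 else c.2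

/-- The bi-infinite content of the belt, seen from the cell `z`. -/
def belt {A : Type} [Inhabited A] (n : ℤ) (u : ℤ → Option (A × A)) (z : ℤ × Bool) (k : ℤ) : A :=
  dat u ((tau n (link n u) ^ k) z)

/-- Apply `f` on all belts. -/
def act {A : Type} [Inhabited A] (n : ℤ) (f : (ℤ → A) → (ℤ → A)) (u : ℤ → Option (A × A)) (i : ℤ) :
    Option (A × A) :=
  (u i).map fun _ => (f (belt n u (i, true)) 0, f (belt n u (i, false)) 0)

section belts

variable {A : Type} [Inhabited A] (n : ℤ)

theorem act_isSome (f : (ℤ → A) → (ℤ → A)) (u : ℤ → Option (A × A)) (i : ℤ) :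
    (act n f u i).isSome = (u i).isSome := by
  simp [act]

theorem link_congr {B : Type} {u u' : ℤ → Option B} (h : ∀ i, (u i).isSome = (u' i).isSome) :
    link n u = link n u' := by
  funext i
  simp [link, h]

theorem tau_supp {B : Type} (u : ℤ → Option B) (z : ℤ × Bool) (hz : (u z.1).isSome) :
    (u (tau n (link n u) z).1).isSome := by
  obtain ⟨i, s⟩ := z
  simp only at hz
  cases s
  · by_cases h : link n u (i - n)
    · have h1 : (u (i - n)).isSome := (Bool.and_eq_true_iff.1 h).1
      simpa [tau, h] using h1
    · simpa [tau, h] using hz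
  · by_cases h : link n u i
    · have h1 : (u (i + n)).isSome := (Bool.and_eq_true_iff.1 h).2
      simpa [tau, h] using h1
    · simpa [tau, h] using hz

theorem tau_symm_supp {B : Type} (u : ℤ → Option B) (z : ℤ × Bool) (hz : (u z.1).isSome) :
    (u ((tau n (link n u))⁻¹ z).1).isSome := by
  change (u ((tau n (link n u)).symm z).1).isSome
  obtain ⟨i, s⟩ := z
  simp only at hz
  cases s
  · by_cases h : link n u i
    · have h1 : (u (i + n)).isSome := (Bool.and_eq_true_iff.1 h).2
      simpa [tau, h] using h1
    · simpa [tau, h] using hz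
  · by_cases h : link n u (i - n)
    · have h1 : (u (i - n)).isSome := (Bool.and_eq_true_iff.1 h).1
      simpa [tau, h] using h1
    · simpa [tau, h] using hz

theorem tau_zpow_supp {B : Type} (u : ℤ → Option B) (z : ℤ × Bool) (hz : (u z.1).isSome) (k : ℤ) :
    (u ((tau n (link n u) ^ k) z).1).isSome := by
  induction k using Int.induction_on with
  | zero => simpa using hz
  | succ k ih =>
    rw [add_comm, zpow_add, zpow_one, Equiv.Perm.mul_apply]
    exact tau_supp n u _ ih
  | pred k ih =>
    rw [sub_eq_add_neg, add_comm, zpow_add, zpow_neg_one, Equiv.Perm.mul_apply]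
    exact tau_symm_supp n u _ ih

theorem comm_shift {A : Type} {f : (ℤ → A) → (ℤ → A)} (hf : ∀ y, f (shiftMapZ A y) = shiftMapZ A (f y))
    (k : ℤ) (y : ℤ → A) : f (fun j => y (j + k)) = fun j => f y (j + k) := by
  induction k using Int.induction_on generalizing y with
  | zero => simp
  | succ k ih =>
    have h1 := hf (fun j => y (j + k))
    rw [ih] at h1
    have e : ∀ j : ℤ, j + ((k : ℤ) + 1) = j + 1 + k := fun j => by ring
    simp only [e]
    exact h1
  | pred k ih =>
    have h1 := hf (fun j => y (j + (-(k : ℤ) - 1)))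
    have e : ∀ j : ℤ, j + 1 + (-(k : ℤ) - 1) = j + -k := fun j => by ring
    have e2 : shiftMapZ A (fun j => y (j + (-(k : ℤ) - 1))) = fun j => y (j + -k) := by
      funext j
      simp only [shiftMapZ, e]
    rw [e2, ih] at h1
    funext j
    have h2 := congrFun h1 (j - 1)
    simp only [shiftMapZ, sub_add_cancel] at h2
    rw [← h2]
    congr 1
    ring

theorem belt_shift (u : ℤ → Option (A × A)) (z : ℤ × Bool) (k : ℤ) :
    belt n u ((tau n (link n u) ^ k) z) = fun j => belt n u z (j + k) := by
  funext j
  simp only [belt]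
  rw [zpow_add, Equiv.Perm.mul_apply]

theorem dat_act (f : (ℤ → A) → (ℤ → A)) (u : ℤ → Option (A × A)) (z : ℤ × Bool)
    (hz : (u z.1).isSome) : dat (act n f u) z = f (belt n u z) 0 := by
  obtain ⟨i, s⟩ := z
  obtain ⟨c, hc⟩ := Option.isSome_iff_exists.1 hz
  simp only at hc
  cases s <;> simp [dat, act, hc]

theorem belt_act {f : (ℤ → A) → (ℤ → A)} (hf : ∀ y, f (shiftMapZ A y) = shiftMapZ A (f y))
    (u : ℤ → Option (A × A)) (z : ℤ × Bool) (hz : (u z.1).isSome) :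
    belt n (act n f u) z = f (belt n u z) := by
  funext k
  have h1 : belt n (act n f u) z k = dat (act n f u) ((tau n (link n u) ^ k) z) := by
    simp only [belt]
    rw [link_congr n (act_isSome n f u)]
  rw [h1, dat_act n f u _ (tau_zpow_supp n u z hz k), belt_shift, comm_shift hf]
  simp

theorem act_comp {f g : (ℤ → A) → (ℤ → A)} (hf : ∀ y, f (shiftMapZ A y) = shiftMapZ A (f y))
    (u : ℤ → Option (A × A)) : act n g (act n f u) = act n (g ∘ f) u := by
  funext i
  cases hu : u i with
  | none => simp [act, hu]
  | some c =>
    have h1 : (u i).isSome := by rw [hu]; rfl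
    have h2 : act n g (act n f u) i = some (g (belt n (act n f u) (i, true)) 0,
        g (belt n (act n f u) (i, false)) 0) := by
      conv_lhs => unfold act
      rw [Option.map_eq_some_iff]
      refine ⟨(f (belt n u (i, true)) 0, f (belt n u (i, false)) 0), ?_, rfl⟩
      rw [hu]
      rfl
    rw [h2, belt_act n hf u (i, true) h1, belt_act n hf u (i, false) h1]
    simp [act, hu]

theorem act_id (u : ℤ → Option (A × A)) : act n id u = u := by
  funext i
  cases hu : u i with
  | none => simp [act, hu]
  | some c => simp [act, hu, belt, dat]

theorem tau_one_shift (q : ℤ → Bool) (z : ℤ × Bool) :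
    ((tau n (fun i => q (i + 1)) z).1 + 1, (tau n (fun i => q (i + 1)) z).2) =
      tau n q (z.1 + 1, z.2) := by
  obtain ⟨i, s⟩ := z
  have e : i - n + 1 = i + 1 - n := by ring
  cases s
  · by_cases h : q (i + 1 - n) <;> simp [tau, e, h]
  · by_cases h : q (i + 1) <;> simp [tau, h]
    ring

theorem tau_shift (q : ℤ → Bool) (k : ℤ) (z : ℤ × Bool) :
    (((tau n (fun i => q (i + 1)) ^ k) z).1 + 1, ((tau n (fun i => q (i + 1)) ^ k) z).2) =
      (tau n q ^ k) (z.1 + 1, z.2) := by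
  induction k using Int.induction_on with
  | zero => simp
  | succ k ih =>
    rw [add_comm (k : ℤ) 1, zpow_add, zpow_one, Equiv.Perm.mul_apply, tau_one_shift, ih, zpow_add,
      zpow_one, Equiv.Perm.mul_apply]
  | pred k ih =>
    have e : ∀ (T : Equiv.Perm (ℤ × Bool)) w, T (T⁻¹ w) = w := fun T w => Equiv.apply_symm_apply T w
    rw [sub_eq_add_neg, add_comm (-(k : ℤ)) (-1), zpow_add, zpow_neg_one, Equiv.Perm.mul_apply,
      zpow_add, zpow_neg_one, Equiv.Perm.mul_apply, Equiv.Perm.eq_inv_iff_eq, ← tau_one_shift,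
      e, ih]

theorem belt_track_shift (u : ℤ → Option (A × A)) (i : ℤ) (s : Bool) :
    belt n (fun j => u (j + 1)) (i, s) = belt n u (i + 1, s) := by
  funext k
  have hl : link n (fun j => u (j + 1)) = fun j => link n u (j + 1) := by
    funext j
    have e : j + n + 1 = j + 1 + n := by ring
    simp only [link, e]
  have h1 := tau_shift n (link n u) k (i, s)
  simp only [belt, hl]
  simp only at h1
  rw [← h1]
  rfl

theorem act_shift (f : (ℤ → A) → (ℤ → A)) (u : ℤ → Option (A × A)) (i : ℤ) :
    act n f (fun j => u (j + 1)) i = act n f u (i + 1) := by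
  simp only [act, belt_track_shift]

/-! Local constancy -/

theorem loc_comp {X α β : Type*} [TopologicalSpace X] {G : X → α} {F : X → α → β}
    (hG : IsLocallyConstant G) (hF : ∀ a, IsLocallyConstant (fun x => F x a)) :
    IsLocallyConstant (fun x => F x (G x)) := by
  rw [IsLocallyConstant.iff_eventually_eq]
  intro x
  filter_upwards [(IsLocallyConstant.iff_eventually_eq _).1 hG x,
    (IsLocallyConstant.iff_eventually_eq _).1 (hF (G x)) x] with y h1 h2
  rw [h1, h2]

theorem link_loc {X : Type*} {B : Type} [TopologicalSpace X] {V : X → ℤ → Option B}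
    (hV : ∀ i, IsLocallyConstant (fun x => V x i)) (i : ℤ) :
    IsLocallyConstant (fun x => link n (V x) i) := by
  rw [IsLocallyConstant.iff_eventually_eq]
  intro x
  filter_upwards [(IsLocallyConstant.iff_eventually_eq _).1 (hV i) x,
    (IsLocallyConstant.iff_eventually_eq _).1 (hV (i + n)) x] with y h1 h2
  simp only [link, h1, h2]

theorem tau_loc {X : Type*} [TopologicalSpace X] {q : X → ℤ → Bool}
    (hq : ∀ i, IsLocallyConstant (fun x => q x i)) (z : ℤ × Bool) :
    IsLocallyConstant (fun x => tau n (q x) z) ∧ IsLocallyConstant (fun x => (tau n (q x))⁻¹ z) := by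
  constructor
  · rw [IsLocallyConstant.iff_eventually_eq]
    intro x
    filter_upwards [(IsLocallyConstant.iff_eventually_eq _).1 (hq z.1) x,
      (IsLocallyConstant.iff_eventually_eq _).1 (hq (z.1 - n)) x] with y h1 h2
    simp only [tau, Equiv.coe_fn_mk, h1, h2]
  · rw [IsLocallyConstant.iff_eventually_eq]
    intro x
    filter_upwards [(IsLocallyConstant.iff_eventually_eq _).1 (hq z.1) x,
      (IsLocallyConstant.iff_eventually_eq _).1 (hq (z.1 - n)) x] with y h1 h2
    change (tau n (q y)).symm z = (tau n (q x)).symm z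
    simp only [tau, Equiv.coe_fn_symm_mk, h1, h2]

theorem tau_zpow_loc {X : Type*} [TopologicalSpace X] {q : X → ℤ → Bool}
    (hq : ∀ i, IsLocallyConstant (fun x => q x i)) (z : ℤ × Bool) (k : ℤ) :
    IsLocallyConstant (fun x => (tau n (q x) ^ k) z) := by
  induction k using Int.induction_on with
  | zero => exact IsLocallyConstant.const z
  | succ k ih =>
    have : (fun x => (tau n (q x) ^ ((k : ℤ) + 1)) z) =
        fun x => tau n (q x) ((tau n (q x) ^ (k : ℤ)) z) := by
      funext x
      rw [add_comm, zpow_add, zpow_one, Equiv.Perm.mul_apply]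
    rw [this]
    exact loc_comp ih (fun a => (tau_loc n hq a).1)
  | pred k ih =>
    have : (fun x => (tau n (q x) ^ (-(k : ℤ) - 1)) z) =
        fun x => (tau n (q x))⁻¹ ((tau n (q x) ^ (-(k : ℤ))) z) := by
      funext x
      rw [sub_eq_add_neg, add_comm, zpow_add, zpow_neg_one, Equiv.Perm.mul_apply]
    rw [this]
    exact loc_comp ih (fun a => (tau_loc n hq a).2)

theorem act_loc {X : Type*} [TopologicalSpace X] [TopologicalSpace A] [DiscreteTopology A]
    {V : X → ℤ → Option (A × A)} (hV : ∀ i, IsLocallyConstant (fun x => V x i))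
    {f : (ℤ → A) → (ℤ → A)} (hf : Continuous f) (i : ℤ) :
    IsLocallyConstant (fun x => act n f (V x) i) := by
  have hbelt : ∀ z, IsLocallyConstant (fun x => f (belt n (V x) z) 0) := by
    intro z
    have h1 : Continuous (fun x => belt n (V x) z) := by
      refine continuous_pi fun k => IsLocallyConstant.continuous ?_
      refine loc_comp (F := fun x a => dat (V x) a) (tau_zpow_loc n (link_loc n hV) z k) ?_
      intro a
      rw [IsLocallyConstant.iff_eventually_eq]
      intro x
      filter_upwards [(IsLocallyConstant.iff_eventually_eq _).1 (hV a.1) x] with y h1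
      simp only [dat, h1]
    have h2 : Continuous (fun x => f (belt n (V x) z) 0) :=
      (continuous_apply 0).comp (hf.comp h1)
    exact (IsLocallyConstant.iff_continuous _).2 h2
  rw [IsLocallyConstant.iff_eventually_eq]
  intro x
  filter_upwards [(IsLocallyConstant.iff_eventually_eq _).1 (hV i) x,
    (IsLocallyConstant.iff_eventually_eq _).1 (hbelt (i, true)) x,
    (IsLocallyConstant.iff_eventually_eq _).1 (hbelt (i, false)) x] with y h1 h2 h3
  simp only [act, h1, h2, h3]

end belts

section final

variable {Γ A : Type} [Inhabited A] (S : Par Γ (A × A))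

/-- The action of a cellular automaton `f` on `Γ^ℤ`. -/
noncomputable def Phi (f : (ℤ → A) → (ℤ → A)) (x : ℤ → Γ) : ℤ → Γ :=
  S.put x (act S.n f (S.v x))

theorem Phi_compat (f : (ℤ → A) → (ℤ → A)) (x : ℤ → Γ) : S.Compat x (act S.n f (S.v x)) :=
  fun i => act_isSome S.n f (S.v x) i

theorem v_Phi (f : (ℤ → A) → (ℤ → A)) (x : ℤ → Γ) : S.v (Phi S f x) = act S.n f (S.v x) :=
  S.v_put (Phi_compat S f x)

theorem Phi_comp {f : (ℤ → A) → (ℤ → A)} (hf : ∀ y, f (shiftMapZ A y) = shiftMapZ A (f y))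
    (g : (ℤ → A) → (ℤ → A)) (x : ℤ → Γ) : Phi S g (Phi S f x) = Phi S (g ∘ f) x := by
  have h1 : Phi S g (Phi S f x) = S.put (Phi S f x) (act S.n g (S.v (Phi S f x))) := rfl
  rw [h1, v_Phi, act_comp S.n hf]
  exact S.put_put (Phi_compat S f x) (Phi_compat S (g ∘ f) x)

theorem Phi_id (x : ℤ → Γ) : Phi S id x = x := by
  unfold Phi
  rw [act_id]
  exact S.put_self x

theorem Phi_shift (f : (ℤ → A) → (ℤ → A)) (x : ℤ → Γ) :
    Phi S f (shiftMapZ Γ x) = shiftMapZ Γ (Phi S f x) := by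
  funext j
  have h1 : act S.n f (S.v (shiftMapZ Γ x)) = fun i => act S.n f (S.v x) (i + 1) := by
    funext i
    rw [← act_shift]
    congr 1
    funext i
    exact S.v_shift x i
  unfold Phi
  rw [h1]
  exact S.put_shift (Phi_compat S f x) j

theorem Phi_cont [TopologicalSpace Γ] [DiscreteTopology Γ] [TopologicalSpace A] [DiscreteTopology A]
    {f : (ℤ → A) → (ℤ → A)} (hf : Continuous f) : Continuous (Phi S f) :=
  S.put_cont _ (Phi_compat S f) (act_loc S.n S.v_loc hf)

theorem v_shift_int (x : ℤ → Γ) (k i : ℤ) : S.v (fun j => x (j + k)) i = S.v x (i + k) := by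
  apply Option.ext
  intro c
  rw [S.v_eq_some, S.v_eq_some]
  unfold Par.occ
  have : ∀ j, i + j + k = i + k + j := fun j => by ring
  simp only [this]

/-- A point whose track is bounded to the left. -/
theorem v_w (c : A × A) : (S.v (S.w c) 0).isSome ∧ ∀ i < 0, S.v (S.w c) i = none := by
  constructor
  · have : S.v (S.w c) 0 = some c := by
      rw [S.v_eq_some]
      intro j _ _
      rw [zero_add]
    rw [this]
    rfl
  · intro i hi
    cases hv : S.v (S.w c) i with
    | none => rfl
    | some c' =>
      exfalso
      rw [S.v_eq_some] at hv
      have hm := S.hm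
      have hdm := S.hdm
      have hd0 := S.hd0
      have hM := S.M_nonneg
      have hn : S.n = 3 * S.M + 30 * S.m := rfl
      apply S.w_mis c' 9 (Or.inl rfl)
      rw [← hv _ (by omega) (by omega), ← hv _ (by omega) (by omega), S.w_per c _ (by omega)]
      congr 1
      ring

/-- The point of `Γ^ℤ` carrying `y` on its upper belt. -/
def carry (y : ℤ → A) : ℤ → Γ :=
  cfg S.m S.bl fun k => S.gw (y (k / (3 * S.N + 30)), default) (k % (3 * S.N + 30))

theorem v_carry (y : ℤ → A) (k : ℤ) : S.v (carry S y) (k * S.n) = some (y k, default) := by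
  rw [S.v_eq_some]
  intro j h0 h1
  have hm := S.hm
  set R : ℤ := 3 * S.N + 30 with hR
  have hRpos : 0 < R := by positivity
  have hn : S.n = R * S.m := by
    unfold Par.n Par.M
    rw [hR]
    ring
  unfold carry
  rw [hn, ← mul_assoc, cfg_shift _ hm]
  unfold Par.w cfg
  have hj0 : 0 ≤ j / S.m := Int.ediv_nonneg h0 hm.le
  have hj1 : j / S.m < R := Int.ediv_lt_of_lt_mul hm (by rw [← hn]; exact h1)
  show S.bl (S.gw (y ((k * R + j / S.m) / R), default) ((k * R + j / S.m) % R)) (j % S.m) = _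
  rw [show k * R + j / S.m = j / S.m + k * R by ring, Int.add_mul_ediv_right _ _ hRpos.ne',
    Int.add_mul_emod_self_right, Int.ediv_eq_zero_of_lt hj0 hj1, Int.emod_eq_of_lt hj0 hj1,
    zero_add]

theorem tau_carry (y : ℤ → A) (k : ℤ) :
    (tau S.n (link S.n (S.v (carry S y))) ^ k) (0, true) = (k * S.n, true) := by
  have hstep : ∀ k : ℤ, tau S.n (link S.n (S.v (carry S y))) (k * S.n, true) =
      ((k + 1) * S.n, true) := by
    intro k
    have hl : link S.n (S.v (carry S y)) (k * S.n) = true := by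
      unfold link
      rw [v_carry, show k * S.n + S.n = (k + 1) * S.n by ring, v_carry]
      rfl
    simp [tau, hl]
    ring
  induction k using Int.induction_on with
  | zero => simp
  | succ k ih =>
    rw [add_comm (k : ℤ) 1, zpow_add, zpow_one, Equiv.Perm.mul_apply, ih, hstep, add_comm]
  | pred k ih =>
    rw [sub_eq_add_neg, add_comm, zpow_add, zpow_neg_one, Equiv.Perm.mul_apply, ih,
      Equiv.Perm.inv_eq_iff_eq, hstep]
    congr 2
    ring

theorem belt_carry (y : ℤ → A) : belt S.n (S.v (carry S y)) (0, true) = y := by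
  funext k
  unfold belt
  rw [tau_carry]
  simp [dat, v_carry]

theorem fix_of_Phi_fix {f : (ℤ → A) → (ℤ → A)}
    (hf : ∀ y, f (shiftMapZ A y) = shiftMapZ A (f y))
    (h : ∀ y, Phi S f (carry S y) = carry S y) (y : ℤ → A) : f y = y := by
  have h0 : ∀ y, f y 0 = y 0 := by
    intro y
    have h1 := v_Phi S f (carry S y)
    rw [h] at h1
    have h2 := congrFun h1 0
    have h3 := v_carry S y 0
    rw [zero_mul] at h3
    unfold act at h2
    rw [h3, belt_carry] at h2
    simp only [Option.map_some, Option.some.injEq, Prod.mk.injEq] at h2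
    exact h2.1.symm
  funext k
  have h1 := h0 (fun j => y (j + k))
  rw [comm_shift hf] at h1
  simpa using h1

theorem shift_zero {f : (ℤ → A) → (ℤ → A)} (k : ℤ) (c : A × A)
    (h : Phi S f (S.w c) = fun j => S.w c (j + k)) : k = 0 := by
  obtain ⟨h1, h2⟩ := v_w S c
  have h3 : ∀ i, (S.v (S.w c) (i + k)).isSome = (S.v (S.w c) i).isSome := by
    intro i
    rw [← v_shift_int, ← h, v_Phi, act_isSome]
  rcases lt_trichotomy k 0 with hk | hk | hk
  · have h4 := h3 0
    rw [h1, zero_add, h2 k hk] at h4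
    cases h4
  · exact hk
  · have h4 := h3 (-k)
    rw [neg_add_cancel, h1, h2 (-k) (by omega)] at h4
    cases h4

end final

theorem sigma_zpow {Γ : Type} [TopologicalSpace Γ] {X : Set (ℤ → Γ)}
    (σX : SubAut X {shiftMapZ Γ})
    (hσ : ∀ x : X, ((σX : Equiv.Perm X) x : ℤ → Γ) = shiftMapZ Γ ↑x) (k : ℤ) (x : X) :
    (((σX ^ k : SubAut X {shiftMapZ Γ}) : Equiv.Perm X) x : ℤ → Γ) = fun j => (x : ℤ → Γ) (j + k) := by
  rw [Subgroup.coe_zpow]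
  induction k using Int.induction_on with
  | zero => simp
  | succ k ih =>
    rw [add_comm (k : ℤ) 1, zpow_add, zpow_one, Equiv.Perm.mul_apply, hσ, ih]
    funext j
    simp only [shiftMapZ]
    congr 1
    ring
  | pred k ih =>
    rw [sub_eq_add_neg, add_comm, zpow_add, zpow_neg_one, Equiv.Perm.mul_apply]
    have h1 := hσ ((σX : Equiv.Perm X)⁻¹ (((σX : Equiv.Perm X) ^ (-(k : ℤ))) x))
    have e : ∀ (T : Equiv.Perm X) w, T (T⁻¹ w) = w := fun T w => Equiv.apply_symm_apply T w
    rw [e, ih] at h1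
    funext j
    have h2 := congrFun h1 (j - 1)
    simp only [shiftMapZ, sub_add_cancel] at h2
    rw [← h2]
    congr 1
    ring

theorem exists_hom {Γ : Type} [TopologicalSpace Γ] [DiscreteTopology Γ]
    (X : Set (ℤ → Γ)) {A : Type} [Inhabited A] [TopologicalSpace A] [DiscreteTopology A]
    (S : Par Γ (A × A)) (hN : 0 < S.N) (hrep : Replaceable X S.m S.bl) :
    ∃ ψ : CAut {shiftMapZ A} →* SubAut X {shiftMapZ Γ},
      ∀ f (x : X), ((ψ f : Equiv.Perm X) x : ℤ → Γ) = Phi S (f : Equiv.Perm (ℤ → A)) x := by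
  have hcomm : ∀ f : CAut {shiftMapZ A}, ∀ y,
      (f : Equiv.Perm (ℤ → A)) (shiftMapZ A y) = shiftMapZ A ((f : Equiv.Perm (ℤ → A)) y) :=
    fun f y => f.2.1.2 _ rfl y
  have hmem : ∀ (f : CAut {shiftMapZ A}) (x : X), Phi S (f : Equiv.Perm (ℤ → A)) x ∈ X :=
    fun f x => S.put_mem hN hrep x.2 (Phi_compat S _ _)
  let F : CAut {shiftMapZ A} → X → X := fun f x => ⟨Phi S (f : Equiv.Perm (ℤ → A)) x, hmem f x⟩
  have hmul : ∀ f g x, F (f * g) x = F f (F g x) := by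
    intro f g x
    apply Subtype.ext
    exact (Phi_comp S (hcomm g) _ _).symm
  have hone : ∀ x, F 1 x = x := by
    intro x
    apply Subtype.ext
    exact Phi_id S _
  have hgood : ∀ (f : CAut {shiftMapZ A}) (e : Equiv.Perm X), (∀ x, e x = F f x) →
      GoodPerm {shiftMapZ Γ} e := by
    intro f e he
    have he' : ⇑e = F f := funext he
    refine ⟨?_, ?_⟩
    · rw [he']
      exact ((Phi_cont S f.2.1.1).comp continuous_subtype_val).subtype_mk _
    · rintro s rfl x y hxy
      rw [he']
      show shiftMapZ Γ (Phi S _ x) = Phi S _ y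
      rw [← Phi_shift, hxy]
  let E : CAut {shiftMapZ A} → Equiv.Perm X := fun f =>
    { toFun := F f
      invFun := F f⁻¹
      left_inv := fun x => by rw [← hmul, inv_mul_cancel, hone]
      right_inv := fun x => by rw [← hmul, mul_inv_cancel, hone] }
  refine ⟨{ toFun := fun f => ⟨E f, hgood f (E f) (fun _ => rfl), hgood f⁻¹ (E f)⁻¹ (fun _ => rfl)⟩
            map_one' := ?_
            map_mul' := ?_ }, fun f x => rfl⟩
  · apply Subtype.ext
    apply Equiv.ext
    exact hone
  · intro f g
    apply Subtype.ext
    apply Equiv.ext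
    exact hmul f g

theorem main_embed {Γ : Type} [Fintype Γ] [TopologicalSpace Γ] [DiscreteTopology Γ]
    (X : Set (ℤ → Γ)) (hX : IsSoficShift X) (hunc : ¬X.Countable)
    (σX : SubAut X {shiftMapZ Γ})
    (hσ : ∀ x : X, ((σX : Equiv.Perm X) x : ℤ → Γ) = shiftMapZ Γ ↑x)
    (A : Type) [Fintype A] [Inhabited A] [TopologicalSpace A] [DiscreteTopology A] :
    ∃ ψ : CAut {shiftMapZ A} →* SubAut X {shiftMapZ Γ},
      ∀ f, ψ f ∈ Subgroup.zpowers σX → f = 1 := by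
  obtain ⟨m, bl, d, hm, hd0, hdm, hne, heq, hcfg, hrep⟩ := exists_blocks X hX hunc
  let S : Par Γ (A × A) :=
    { m := m, d := d, bl := bl, hm := hm, hd0 := hd0, hdm := hdm, hne := hne, heq := heq
      N := Fintype.card (A × A)
      enc := fun c => Fintype.equivFin (A × A) c
      henc := fun c => (Fintype.equivFin (A × A) c).2
      hinj := fun c c' h => (Fintype.equivFin (A × A)).injective (Fin.ext h) }
  have hN : 0 < S.N := Fintype.card_pos
  obtain ⟨ψ, hψ⟩ := exists_hom X S hN hrep
  refine ⟨ψ, ?_⟩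
  intro f hf
  obtain ⟨k, hk⟩ := Subgroup.mem_zpowers_iff.1 hf
  have hPhi : ∀ x ∈ X, Phi S (f : Equiv.Perm (ℤ → A)) x = fun j => x (j + k) := by
    intro x hx
    rw [← sigma_zpow σX hσ k ⟨x, hx⟩, hk, hψ f ⟨x, hx⟩]
  have hk0 : k = 0 := shift_zero S k default (hPhi _ (hcfg _))
  apply Subtype.ext
  apply Equiv.ext
  intro y
  refine fix_of_Phi_fix S (fun y => f.2.1.2 _ rfl y) ?_ y
  intro y
  have h1 := hPhi (carry S y) (hcfg _)
  rw [h1, hk0]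
  simp

end SoficEmb

theorem stmt14 (Γ : Type) [Fintype Γ] [TopologicalSpace Γ] [DiscreteTopology Γ]
    (X : Set (ℤ → Γ)) (hX : IsSoficShift X) (hunc : ¬X.Countable)
    (σX : SubAut X {shiftMapZ Γ})
    (hσ : ∀ x : X, ((σX : Equiv.Perm X) x : ℤ → Γ) = shiftMapZ Γ ↑x) :
    σX ∈ Subgroup.center (SubAut X {shiftMapZ Γ}) ∧
      (Subgroup.zpowers σX).Normal ∧
      ∀ (A : Type) [Fintype A] [TopologicalSpace A] [DiscreteTopology A],
        ∃ (_ : (Subgroup.zpowers σX).Normal)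
          (φ : CAut {shiftMapZ A} →* (SubAut X {shiftMapZ Γ}) ⧸ Subgroup.zpowers σX),
          Function.Injective φ := by
  have hcen : σX ∈ Subgroup.center (SubAut X {shiftMapZ Γ}) := by
    rw [Subgroup.mem_center_iff]
    intro g
    apply Subtype.ext
    apply Equiv.ext
    intro x
    apply Subtype.ext
    show (((g : Equiv.Perm X) ((σX : Equiv.Perm X) x) : X) : ℤ → Γ) =
      (((σX : Equiv.Perm X) ((g : Equiv.Perm X) x) : X) : ℤ → Γ)
    rw [hσ]
    exact (g.2.1.2 _ rfl x ((σX : Equiv.Perm X) x) (hσ x).symm).symm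
  have hnor : (Subgroup.zpowers σX).Normal := by
    refine ⟨fun a ha g => ?_⟩
    have h1 : a ∈ Subgroup.center (SubAut X {shiftMapZ Γ}) :=
      (Subgroup.zpowers_le.2 hcen) ha
    rw [Subgroup.mem_center_iff.1 h1 g, mul_inv_cancel_right]
    exact ha
  refine ⟨hcen, hnor, ?_⟩
  intro A _ _ _
  refine ⟨hnor, ?_⟩
  rcases isEmpty_or_nonempty A with hA | hA
  · have : IsEmpty (ℤ → A) := ⟨fun y => hA.false (y 0)⟩
    refine ⟨1, fun f g _ => ?_⟩
    apply Subtype.ext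
    apply Equiv.ext
    intro y
    exact (this.false y).elim
  · have : Inhabited A := ⟨Classical.choice hA⟩
    obtain ⟨ψ, hψ⟩ := SoficEmb.main_embed X hX hunc σX hσ A
    refine ⟨(QuotientGroup.mk' (Subgroup.zpowers σX)).comp ψ, ?_⟩
    rw [injective_iff_map_eq_one]
    intro f hf
    exact hψ f ((QuotientGroup.eq_one_iff _).1 hf)
end

section
/- Let Σ be a finite alphabet and let a, b, c ∈ Σ be three distinct elements. For distinct p, q ∈ Σ define F_{p,q} : Σ × Σ → Σ by F_{p,q}(p, e) = q and F_{p,q}(q, e) = p for every e ∈ Σ with e ∉ {p, q}, and F_{p,q}(d, e) = d in all other cases; and define f_{p,q} : Σ^ℕ → Σ^ℕ by f_{p,q}(x)(i) = F_{p,q}(x(i), x(i+1)). Then each f_{p,q} is a shift-commuting homeomorphism of Σ^ℕ with f_{p,q} ∘ f_{p,q} = id, and the composition f_{a,b} ∘ f_{b,c} has infinite order: (f_{a,b} ∘ f_{b,c})^k ≠ id for every integer k ≥ 1. -/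
def shiftMapN (A : Type*) : (ℕ → A) → (ℕ → A) := fun x i => x (i + 1)

/-- The local rule `F_{p,q}`. -/
def Fpq {Γ : Type*} [DecidableEq Γ] (p q : Γ) : Γ × Γ → Γ := fun de =>
  if de.1 = p ∧ de.2 ≠ p ∧ de.2 ≠ q then q
  else if de.1 = q ∧ de.2 ≠ p ∧ de.2 ≠ q then p
  else de.1

/-- The cellular automaton `f_{p,q}` with local rule `F_{p,q}`. -/
def fpq {Γ : Type*} [DecidableEq Γ] (p q : Γ) : (ℕ → Γ) → (ℕ → Γ) := fun x i =>
  Fpq p q (x i, x (i + 1))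

/-- `y` starts with the word `b^m a c a`. -/
def FrontAt {Γ : Type*} (a b c : Γ) (m : ℕ) (y : ℕ → Γ) : Prop :=
  (∀ i < m, y i = b) ∧ y m = a ∧ y (m + 1) = c ∧ y (m + 2) = a

theorem front_step {Γ : Type*} [DecidableEq Γ] (a b c : Γ) (hab : a ≠ b) (hac : a ≠ c)
    (hbc : b ≠ c) (m : ℕ) (y : ℕ → Γ) (h : FrontAt a b c (m + 2) y) :
    FrontAt a b c m ((fpq a b ∘ fpq b c) y) := by
  obtain ⟨h1, h2, h3, h4⟩ := h
  have z1 : ∀ i < m + 1, fpq b c y i = b := by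
    intro i hi
    have e1 := h1 i (by omega)
    have e2 := h1 (i + 1) (by omega)
    simp [fpq, Fpq, e1, e2]
  have z2 : fpq b c y (m + 1) = c := by
    have e1 := h1 (m + 1) (by omega)
    simp [fpq, Fpq, e1, h2, hab, hac]
  have z3 : fpq b c y (m + 2) = a := by
    simp [fpq, Fpq, h2, hab, hac]
  have z4 : fpq b c y (m + 3) = b := by
    have h3' : y (m + 3) = c := h3
    have h4' : y (m + 3 + 1) = a := h4
    simp [fpq, Fpq, h3', h4', hab, hac, hbc.symm]
  refine ⟨?_, ?_, ?_, ?_⟩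
  · intro i hi
    have e1 := z1 i (by omega)
    have e2 := z1 (i + 1) (by omega)
    simp only [Function.comp]
    rw [fpq, e1, e2]
    simp [Fpq]
  · have e1 := z1 m (by omega)
    simp only [Function.comp]
    rw [fpq, e1, z2]
    simp [Fpq, hab.symm, hac.symm, hbc.symm]
  · simp only [Function.comp]
    rw [fpq, z2]
    simp [Fpq, hac.symm, hbc.symm]
  · simp only [Function.comp]
    rw [fpq, z3, z4]
    simp [Fpq, hab]

theorem front_iterate {Γ : Type*} [DecidableEq Γ] (a b c : Γ) (hab : a ≠ b) (hac : a ≠ c)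
    (hbc : b ≠ c) (k : ℕ) : ∀ y : ℕ → Γ, FrontAt a b c (2 * k) y →
    FrontAt a b c 0 ((fpq a b ∘ fpq b c)^[k] y) := by
  induction k with
  | zero => intro y h; exact h
  | succ k ih =>
    intro y h
    rw [Function.iterate_succ_apply]
    exact ih _ (front_step a b c hab hac hbc _ y h)

theorem fpq_invol {Γ : Type*} [DecidableEq Γ] (p q : Γ) (hpq : p ≠ q) (x : ℕ → Γ) :
    fpq p q (fpq p q x) = x := by
  funext i
  simp only [fpq, Fpq]
  grind

theorem fpq_continuous {Γ : Type*} [DecidableEq Γ] [TopologicalSpace Γ]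
    [DiscreteTopology Γ] (p q : Γ) : Continuous (fpq p q) := by
  refine continuous_pi fun i => ?_
  have h : Continuous (Fpq p q) := continuous_of_discreteTopology
  exact h.comp ((continuous_apply i).prodMk (continuous_apply (i + 1)))

theorem stmt18 (Γ : Type*) [Fintype Γ] [DecidableEq Γ] [TopologicalSpace Γ]
    [DiscreteTopology Γ] (a b c : Γ) (hab : a ≠ b) (hac : a ≠ c) (hbc : b ≠ c) :
    (∀ p q : Γ, p ≠ q →
      (∃ h : (ℕ → Γ) ≃ₜ (ℕ → Γ), ⇑h = fpq p q) ∧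
        fpq p q ∘ shiftMapN Γ = shiftMapN Γ ∘ fpq p q ∧
        fpq p q ∘ fpq p q = id) ∧
      ∀ k : ℕ, 1 ≤ k → (fpq a b ∘ fpq b c)^[k] ≠ id := by
  refine ⟨fun p q hpq => ⟨⟨⟨⟨fpq p q, fpq p q, fpq_invol p q hpq, fpq_invol p q hpq⟩,
    fpq_continuous p q, fpq_continuous p q⟩, rfl⟩, rfl, funext (fpq_invol p q hpq)⟩, ?_⟩
  intro k hk hid
  let y : ℕ → Γ := fun i => if i < 2 * k then b else if i = 2 * k + 1 then c else a
  have hy : FrontAt a b c (2 * k) y := by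
    refine ⟨fun i hi => ?_, ?_, ?_, ?_⟩ <;> simp [y]
    omega
  have h := (front_iterate a b c hab hac hbc k y hy).2.1
  rw [hid] at h
  have h0 : y 0 = b := hy.1 0 (by omega)
  exact hab (h.symm.trans h0)
end

section
/- Let K be a finite field and n ≥ 1, let V = (Fin n → K), and let LAut(V^ℤ) denote the group, under composition, of homeomorphisms f : V^ℤ → V^ℤ which are K-linear and satisfy f ∘ σ = σ ∘ f. Then there is an injective group homomorphism from LAut(V^ℤ) into GL_n(K((x))), the group of invertible n × n matrices over the field of formal Laurent series over K. -/
/-- `f` is a reversible linear cellular automaton (one direction): continuous, `K`-linear,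
and shift-commuting. -/
def LinCA (K : Type*) [Field K] [TopologicalSpace K] (n : ℕ)
    (f : Equiv.Perm (ℤ → (Fin n → K))) : Prop :=
  Continuous ⇑f ∧ (∀ x y, f (x + y) = f x + f y) ∧
    (∀ (c : K) (x), f (c • x) = c • f x) ∧
    ∀ x, f (shiftMapZ (Fin n → K) x) = shiftMapZ (Fin n → K) (f x)

theorem LinCA.mul {K : Type*} [Field K] [TopologicalSpace K] {n : ℕ}
    {f g : Equiv.Perm (ℤ → (Fin n → K))} (hf : LinCA K n f) (hg : LinCA K n g) :
    LinCA K n (f * g) := by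
  refine ⟨by simpa [Equiv.Perm.coe_mul] using hf.1.comp hg.1, fun x y => ?_, fun c x => ?_,
    fun x => ?_⟩
  · simp only [Equiv.Perm.mul_apply, hg.2.1, hf.2.1]
  · simp only [Equiv.Perm.mul_apply, hg.2.2.1, hf.2.2.1]
  · simp only [Equiv.Perm.mul_apply, hg.2.2.2, hf.2.2.2]

theorem LinCA.one {K : Type*} [Field K] [TopologicalSpace K] {n : ℕ} :
    LinCA K n 1 :=
  ⟨by simpa [Equiv.Perm.coe_one] using continuous_id, fun _ _ => rfl, fun _ _ => rfl,
    fun _ => rfl⟩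

/-- The group of reversible linear cellular automata on the alphabet `V = Fin n → K`. -/
def LAut (K : Type*) [Field K] [TopologicalSpace K] (n : ℕ) :
    Subgroup (Equiv.Perm (ℤ → (Fin n → K))) where
  carrier := {f | LinCA K n f ∧ LinCA K n f⁻¹}
  one_mem' := ⟨LinCA.one, by rw [inv_one]; exact LinCA.one⟩
  mul_mem' := fun hf hg => ⟨hf.1.mul hg.1, by rw [mul_inv_rev]; exact hg.2.mul hf.2⟩
  inv_mem' := fun hf => ⟨hf.2, by rw [inv_inv]; exact hf.1⟩


section helpers
variable {K : Type} [Field K] [TopologicalSpace K] [DiscreteTopology K] {n : ℕ}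

/-- shift by an arbitrary integer -/
def shZ {A : Type} (k : ℤ) (x : ℤ → A) : ℤ → A := fun i => x (i + k)

/-- basis configuration -/
def bas (K : Type) [Field K] {n : ℕ} (l : Fin n) : ℤ → (Fin n → K) :=
  Pi.single 0 (Pi.single l 1)

theorem LinCA.sh {f : Equiv.Perm (ℤ → (Fin n → K))} (hf : LinCA K n f) (k : ℤ) :
    ∀ x, f (shZ k x) = shZ k (f x) := by
  have h1 : ∀ x, f (shZ 1 x) = shZ 1 (f x) := hf.2.2.2
  have hadd : ∀ (a b : ℤ) (x : ℤ → (Fin n → K)), shZ (a + b) x = shZ a (shZ b x) := by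
    intro a b x; funext i; simp only [shZ]; congr 1; ring
  have h0 : ∀ x : ℤ → (Fin n → K), shZ 0 x = x := by
    intro x; funext i; simp [shZ]
  have hm : ∀ x, f (shZ (-1) x) = shZ (-1) (f x) := by
    intro x
    have h2 : f x = shZ 1 (f (shZ (-1) x)) := by
      rw [← h1, ← hadd]; simp [h0]
    rw [h2, ← hadd]; simp [h0]
  induction k using Int.induction_on with
  | zero => intro x; simp [h0]
  | succ i ih => intro x; rw [hadd, ih, h1, ← hadd]
  | pred i ih => intro x; rw [sub_eq_add_neg, hadd, ih, hm, ← hadd]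

theorem LinCA.formula {f : Equiv.Perm (ℤ → (Fin n → K))} (hf : LinCA K n f) :
    ∃ S : Finset ℤ, (∀ s, s ∉ S → ∀ l, f (bas K l) s = 0) ∧
      ∀ x k i, f x k i = ∑ s ∈ S, ∑ l, f (bas K l) s i * x (k - s) l := by
  let F : (ℤ → (Fin n → K)) →ₗ[K] (ℤ → (Fin n → K)) :=
    { toFun := f, map_add' := hf.2.1, map_smul' := hf.2.2.1 }
  have hF : ∀ x, f x = F x := fun _ => rfl
  have hsh : ∀ k x, F (shZ k x) = shZ k (F x) := fun k x => hf.sh k x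
  have hev : ∀ (x : ℤ → (Fin n → K)) k, F x k = F (shZ k x) 0 := by
    intro x k; rw [hsh]; simp [shZ]
  have hS : ∃ S : Finset ℤ, ∀ y : ℤ → (Fin n → K), (∀ s ∈ S, y (-s) = 0) → F y 0 = 0 := by
    have hc : Continuous fun y => f y 0 := (continuous_apply 0).comp hf.1
    have ho : IsOpen ((fun y => f y 0) ⁻¹' {0}) := (isOpen_discrete _).preimage hc
    rw [isOpen_pi_iff] at ho
    obtain ⟨I, u, hu, hI⟩ := ho 0 (by simp [hF])
    refine ⟨I.image (fun s => -s), fun y hy => ?_⟩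
    apply hI
    intro a ha
    have := hy (-a) (Finset.mem_image_of_mem _ ha)
    rw [neg_neg] at this
    rw [this]
    exact (hu a ha).2
  obtain ⟨S, hS⟩ := hS
  have hx0 : ∀ y i, F y 0 i = ∑ s ∈ S, ∑ l, F (bas K l) s i * y (-s) l := by
    intro y i
    have key : F (y - ∑ s ∈ S, ∑ l, y (-s) l • shZ s (bas K l)) 0 = 0 := by
      apply hS
      intro t ht
      funext j
      simp only [Pi.sub_apply, Finset.sum_apply, Pi.smul_apply, shZ, bas, smul_eq_mul]
      rw [Finset.sum_eq_single t]
      · rw [Finset.sum_eq_single j]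
        · simp
        · intro b _ hb
          simp [Pi.single_apply, hb.symm]
        · simp
      · intro b _ hb
        have : -t + b ≠ 0 := by intro h; apply hb; omega
        simp [Pi.single_apply, this]
      · simp [ht]
    rw [map_sub, Pi.sub_apply, sub_eq_zero] at key
    rw [key]
    simp only [map_sum, map_smul, hsh, Finset.sum_apply, Pi.smul_apply, shZ, smul_eq_mul, zero_add]
    simp only [mul_comm]
  refine ⟨S, fun s hs l => ?_, fun x k i => ?_⟩
  · rw [hF, hev]
    apply hS
    intro t ht
    have : -t + s ≠ 0 := by intro h; apply hs; rwa [show s = t by omega]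
    simp [shZ, bas, Pi.single_apply, this]
  · simp only [hF]
    rw [hev, hx0]
    simp only [shZ, neg_add_eq_sub]

theorem LinCA.pwo {f : Equiv.Perm (ℤ → (Fin n → K))} (hf : LinCA K n f) (i l : Fin n) :
    (Function.support fun k => f (bas K l) k i).IsPWO := by
  obtain ⟨S, h, -⟩ := hf.formula
  refine (S.finite_toSet.subset ?_).isPWO
  intro s hs
  by_contra hn
  exact hs (by simp [h s hn])

/-- matrix of a linear CA -/
noncomputable def LinCA.mat {f : Equiv.Perm (ℤ → (Fin n → K))} (hf : LinCA K n f) :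
    Matrix (Fin n) (Fin n) (LaurentSeries K) :=
  fun i l => ⟨fun k => f (bas K l) k i, hf.pwo i l⟩

theorem LinCA.mat_coeff {f : Equiv.Perm (ℤ → (Fin n → K))} (hf : LinCA K n f) (i l : Fin n)
    (k : ℤ) : HahnSeries.coeff (hf.mat i l) k = f (bas K l) k i := rfl

theorem LinCA.mat_mul {f g : Equiv.Perm (ℤ → (Fin n → K))} (hf : LinCA K n f)
    (hg : LinCA K n g) (hfg : LinCA K n (f * g)) : hfg.mat = hf.mat * hg.mat := by
  ext i j k
  obtain ⟨S, h0, h⟩ := hf.formula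
  rw [Matrix.mul_apply, hfg.mat_coeff, Equiv.Perm.mul_apply, h, HahnSeries.coeff_sum,
    Finset.sum_comm]
  refine Finset.sum_congr rfl fun l _ => ?_
  have e : hf.mat i l = ∑ s ∈ S, HahnSeries.single s (f (bas K l) s i) := by
    ext k
    rw [hf.mat_coeff, HahnSeries.coeff_sum]
    rw [Finset.sum_eq_single k]
    · simp
    · intro b _ hb
      exact HahnSeries.coeff_single_of_ne hb.symm
    · intro hk
      simp [h0 k hk]
  rw [e, Finset.sum_mul, HahnSeries.coeff_sum]
  refine Finset.sum_congr rfl fun s _ => ?_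
  have := HahnSeries.coeff_single_mul_add (r := f (bas K l) s i) (x := hg.mat l j)
    (a := k - s) (b := s)
  rw [sub_add_cancel] at this
  rw [this, hg.mat_coeff]

theorem LinCA.mat_one (h : LinCA K n 1) : h.mat = 1 := by
  ext i j k
  rw [h.mat_coeff, Matrix.one_apply]
  simp only [bas, Equiv.Perm.one_apply, Pi.single_apply]
  split_ifs <;> simp_all [HahnSeries.coeff_one, Pi.single_apply]

theorem LinCA.mat_inj {f g : Equiv.Perm (ℤ → (Fin n → K))} (hf : LinCA K n f)
    (hg : LinCA K n g) (h : hf.mat = hg.mat) : f = g := by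
  have hb : ∀ l k i, f (bas K l) k i = g (bas K l) k i := by
    intro l k i
    rw [← hf.mat_coeff, h, hg.mat_coeff]
  obtain ⟨S, hS0, hS⟩ := hf.formula
  obtain ⟨T, hT0, hT⟩ := hg.formula
  ext x k i
  rw [hS, hT]
  have e1 := Finset.sum_subset (f := fun s => ∑ l, f (bas K l) s i * x (k - s) l)
    (Finset.subset_union_left (s₁ := S) (s₂ := T)) (fun s _ hs => by simp [hS0 s hs])
  have e2 := Finset.sum_subset (f := fun s => ∑ l, g (bas K l) s i * x (k - s) l)
    (Finset.subset_union_right (s₁ := S) (s₂ := T)) (fun s _ hs => by simp [hT0 s hs])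
  rw [e1, e2]
  simp only [hb]

end helpers

theorem stmt19 (K : Type) [Field K] [Fintype K] [TopologicalSpace K] [DiscreteTopology K]
    (n : ℕ) (hn : 1 ≤ n) :
    ∃ φ : LAut K n →* Matrix.GeneralLinearGroup (Fin n) (LaurentSeries K),
      Function.Injective φ := by
  let ψ : LAut K n →* Matrix (Fin n) (Fin n) (LaurentSeries K) :=
    { toFun := fun f => f.2.1.mat
      map_one' := LinCA.mat_one _
      map_mul' := fun f g => LinCA.mat_mul f.2.1 g.2.1 _ }
  refine ⟨ψ.toHomUnits, fun f g h => ?_⟩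
  have h2 : ψ f = ψ g := congrArg Units.val h
  exact Subtype.ext (LinCA.mat_inj f.2.1 g.2.1 h2)
end
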